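/- (Theorem 5.6) Let μ ∈ (1,2) and let Ω ⊂ ℝ² be a bounded domain such that ∂Ω in a neighborhood of the origin consists of two C² curves σ₁ and σ₂, each with an endpoint at the origin, intersecting at the origin at angle μπ (so the tangent cone of Ω at the origin has opening angle μπ). Suppose u ∈ C^∞(Ω) satisfies Δu = e^{2u} in Ω and u(z) → +∞ as z → ∂Ω. Let d, d₁, d₂ denote the distances to ∂Ω, σ₁, σ₂ respectively, and define f_μ(z) = −log( μ |z| sin( arcsin( d₁(z)/|z| ) / μ ) ) if d₁(z) < d₂(z); f_μ(z) = −log( μ |z| sin( θ/μ ) ) if d₁(z) = d₂(z), where θ is the angle measured anticlockwise from the tangent ray of σ₁ at the origin to the ray from the origin through z; and f_μ(z) = −log( μ |z| sin( arcsin( d₂(z)/|z| ) / μ ) ) if d₁(z) > d₂(z). Then there exist positive constants δ and C, depending only on the geometry of ∂Ω, such that |u(z) − f_μ(z)| ≤ C d(z) for all z ∈ Ω ∩ B_δ. -/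

import Mathlib

/-- The Laplacian of a function on `ℂ ≅ ℝ²`: sum of the second directional
derivatives in the two coordinate directions `1` and `I`. -/
noncomputable def lap (u : ℂ → ℝ) (z : ℂ) : ℝ :=
  fderiv ℝ (fun w => fderiv ℝ u w 1) z 1 +
  fderiv ℝ (fun w => fderiv ℝ u w Complex.I) z Complex.I

/-- The polar angle of a nonzero complex number, normalized to lie in `(0, 2π]`. -/
noncomputable def polarAngle (z : ℂ) : ℝ :=
  if 0 < Complex.arg z then Complex.arg z else Complex.arg z + 2 * Real.pi

/-- The real (Euclidean) inner product on `ℂ ≅ ℝ²`. -/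
def realInner (a b : ℂ) : ℝ := a.re * b.re + a.im * b.im

/-- The closed finite cone with vertex `p`, axis direction `e`, height `h`
and half-opening angle `θ₀`. -/
def finiteCone (p e : ℂ) (h θ₀ : ℝ) : Set ℂ :=
  {z | ∃ (t : ℝ) (ω : ℂ), 0 ≤ t ∧ t ≤ h ∧ ‖ω‖ = 1 ∧
    Real.cos θ₀ ≤ realInner ω e ∧ z = p + t • ω}

/-- `Ω` satisfies the uniform exterior cone condition with height `h` and
half-opening angle `θ₀`. -/
def UnifExtCone (Ω : Set ℂ) (h θ₀ : ℝ) : Prop :=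
  ∀ p ∈ frontier Ω, ∃ e : ℂ, ‖e‖ = 1 ∧ finiteCone p e h θ₀ ∩ Ω = ∅

/-- The open sector `{r e^{iθ} : 0 < r < r₀, a < θ < b}`. -/
def sector (a b r₀ : ℝ) : Set ℂ :=
  {z | ∃ r θ : ℝ, 0 < r ∧ r < r₀ ∧ a < θ ∧ θ < b ∧
    z = (r : ℂ) * Complex.exp ((θ : ℂ) * Complex.I)}

/-- `Ω` has tangent cone `V_μ = {(r,θ) : r > 0, 0 < θ < μπ}` at the origin:
for every `ε > 0` there is `r₀ > 0` with
`{(r,θ) : 0 < r < r₀, ε < θ < μπ − ε} ⊆ Ω ∩ B_{r₀} ⊆ {(r,θ) : 0 < r < r₀, −ε < θ < μπ + ε}`. -/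
def HasTangentCone (Ω : Set ℂ) (μ : ℝ) : Prop :=
  ∀ ε : ℝ, 0 < ε → ∃ r₀ : ℝ, 0 < r₀ ∧
    sector ε (μ * Real.pi - ε) r₀ ⊆ Ω ∩ Metric.ball 0 r₀ ∧
    Ω ∩ Metric.ball 0 r₀ ⊆ sector (-ε) (μ * Real.pi + ε) r₀

/-- `∂Ω` in a neighborhood of the origin consists of two `C²` curves `γ₁, γ₂`, each
parametrized by arc length on `[0, bᵢ]` with an endpoint at the origin, meeting at the
origin at angle `μπ`; coordinates are chosen (after a rotation) so that the tangent ray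
of `γ₁` at the origin is the positive real axis and that of `γ₂` makes angle `μπ` with
it, the tangent cone of `Ω` at the origin being `V_μ`. -/
structure CornerAt (Ω : Set ℂ) (μ : ℝ) (γ₁ γ₂ : ℝ → ℂ) (b₁ b₂ : ℝ) : Prop where
  b₁_pos : 0 < b₁
  b₂_pos : 0 < b₂
  smooth₁ : ContDiff ℝ 2 γ₁
  smooth₂ : ContDiff ℝ 2 γ₂
  start₁ : γ₁ 0 = 0
  start₂ : γ₂ 0 = 0
  inj₁ : Set.InjOn γ₁ (Set.Icc 0 b₁)
  inj₂ : Set.InjOn γ₂ (Set.Icc 0 b₂)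
  unitSpeed₁ : ∀ t ∈ Set.Icc (0 : ℝ) b₁, ‖deriv γ₁ t‖ = 1
  unitSpeed₂ : ∀ t ∈ Set.Icc (0 : ℝ) b₂, ‖deriv γ₂ t‖ = 1
  tangent₁ : deriv γ₁ 0 = 1
  tangent₂ : deriv γ₂ 0 = Complex.exp ((μ * Real.pi : ℝ) * Complex.I)
  boundary : ∃ r : ℝ, 0 < r ∧
    frontier Ω ∩ Metric.ball 0 r
      = (γ₁ '' Set.Icc 0 b₁ ∪ γ₂ '' Set.Icc 0 b₂) ∩ Metric.ball 0 r
  tangentCone : HasTangentCone Ω μ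

/-- The comparison function `f_μ` for a corner of angle `μπ`, `μ ∈ (1,2)`, built from
the distances `d₁, d₂` to the two boundary curves `σ₁, σ₂` and the polar angle `θ`
measured anticlockwise from the tangent ray of `σ₁` at the origin. -/
noncomputable def fMu (μ : ℝ) (σ₁ σ₂ : Set ℂ) (z : ℂ) : ℝ :=
  if Metric.infDist z σ₁ < Metric.infDist z σ₂ then
    -Real.log (μ * ‖z‖ * Real.sin (Real.arcsin (Metric.infDist z σ₁ / ‖z‖) / μ))
  else if Metric.infDist z σ₂ < Metric.infDist z σ₁ then
    -Real.log (μ * ‖z‖ * Real.sin (Real.arcsin (Metric.infDist z σ₂ / ‖z‖) / μ))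
  else
    -Real.log (μ * ‖z‖ * Real.sin (polarAngle z / μ))

namespace LiouvilleCorner

open Complex Filter Topology ComplexConjugate

/-- Real directional derivative of the real part of a holomorphic function. -/
theorem hasFDerivAt_re {f : ℂ → ℂ} {f' z : ℂ} (h : HasDerivAt f f' z) :
    HasFDerivAt (fun w => (f w).re) (reCLM.comp (f' • (1 : ℂ →L[ℝ] ℂ))) z :=
  reCLM.hasFDerivAt.comp z h.complexToReal_fderiv

theorem hasFDerivAt_im {f : ℂ → ℂ} {f' z : ℂ} (h : HasDerivAt f f' z) :
    HasFDerivAt (fun w => (f w).im) (imCLM.comp (f' • (1 : ℂ →L[ℝ] ℂ))) z :=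
  imCLM.hasFDerivAt.comp z h.complexToReal_fderiv

theorem fderiv_re_sub_log_cos {χ Φ : ℂ → ℂ} {z : ℂ} {μ : ℝ} (hμ : 0 < μ)
    (hχ : DifferentiableAt ℂ χ z) (hΦ : DifferentiableAt ℂ Φ z)
    (hc : 0 < Real.cos ((Φ z).im / μ)) (e : ℂ) :
    DifferentiableAt ℝ (fun w => (χ w).re - Real.log (μ * Real.cos ((Φ w).im / μ))) z ∧
    fderiv ℝ (fun w => (χ w).re - Real.log (μ * Real.cos ((Φ w).im / μ))) z e =
      (deriv χ z * e).re + Real.tan ((Φ z).im / μ) *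
        ((deriv Φ z * e).im / μ) := by
  have h1 := hasFDerivAt_re hχ.hasDerivAt
  have h2 := (hasFDerivAt_im hΦ.hasDerivAt).mul_const (μ⁻¹)
  have h3 := ((h2.cos.const_mul μ).log (by
    have : (Φ z).im * μ⁻¹ = (Φ z).im / μ := by ring
    rw [this]; positivity))
  have h4 := h1.sub h3
  simp only [← div_eq_mul_inv] at h4
  have h5 : HasFDerivAt (fun w => (χ w).re - Real.log (μ * Real.cos ((Φ w).im / μ))) _ z := h4
  refine ⟨h5.differentiableAt, ?_⟩
  rw [h5.fderiv, Real.tan_eq_sin_div_cos]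
  simp
  field_simp

theorem lap_re_sub_log_cos {χ Φ : ℂ → ℂ} {z : ℂ} {μ : ℝ} (hμ : 0 < μ)
    (hχ : AnalyticAt ℂ χ z) (hΦ : AnalyticAt ℂ Φ z)
    (hc : 0 < Real.cos ((Φ z).im / μ)) :
    lap (fun w => (χ w).re - Real.log (μ * Real.cos ((Φ w).im / μ))) z =
      (‖deriv Φ z‖ / (μ * Real.cos ((Φ z).im / μ))) ^ 2 := by
  have hcont : ContinuousAt (fun w => Real.cos ((Φ w).im / μ)) z := by
    have := hΦ.continuousAt
    fun_prop
  have hev : ∀ᶠ w in 𝓝 z, AnalyticAt ℂ χ w ∧ AnalyticAt ℂ Φ w ∧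
      0 < Real.cos ((Φ w).im / μ) :=
    hχ.eventually_analyticAt.and (hΦ.eventually_analyticAt.and
      (hcont.eventually (lt_mem_nhds hc)))
  have key : ∀ e : ℂ,
      fderiv ℝ (fun w => fderiv ℝ
        (fun w => (χ w).re - Real.log (μ * Real.cos ((Φ w).im / μ))) w e) z e =
      (deriv (deriv χ) z * e * e).re +
        ((1 / Real.cos ((Φ z).im / μ) ^ 2) * ((deriv Φ z * e).im / μ) ^ 2 +
        Real.tan ((Φ z).im / μ) *
        ((deriv (deriv Φ) z * e * e).im / μ)) := by
    intro e
    have heq : (fun w => fderiv ℝ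
        (fun w => (χ w).re - Real.log (μ * Real.cos ((Φ w).im / μ))) w e) =ᶠ[𝓝 z]
        fun w => (deriv χ w * e).re + Real.tan ((Φ w).im / μ) *
        ((deriv Φ w * e).im / μ) := by
      filter_upwards [hev] with w hw
      exact (fderiv_re_sub_log_cos hμ hw.1.differentiableAt hw.2.1.differentiableAt hw.2.2 e).2
    rw [heq.fderiv_eq]
    have h1 := hasFDerivAt_re (hχ.deriv.differentiableAt.hasDerivAt.mul_const e)
    have h2 := (hasFDerivAt_im (hΦ.deriv.differentiableAt.hasDerivAt.mul_const e)).mul_const (μ⁻¹)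
    have h3 := (hasFDerivAt_im hΦ.differentiableAt.hasDerivAt).mul_const (μ⁻¹)
    have h0 : Real.cos ((Φ z).im * μ⁻¹) ≠ 0 := by
      rw [← div_eq_mul_inv]; exact hc.ne'
    have h4 := h1.add (((Real.hasDerivAt_tan h0).comp_hasFDerivAt z h3).mul h2)
    simp only [← div_eq_mul_inv] at h4
    have h5 : HasFDerivAt (fun w => (deriv χ w * e).re + Real.tan ((Φ w).im / μ) *
        ((deriv Φ w * e).im / μ)) _ z := h4
    rw [h5.fderiv]
    simp
    ring
  unfold lap
  rw [key 1, key I]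
  have hn : ‖deriv Φ z‖ ^ 2 = (deriv Φ z).re * (deriv Φ z).re + (deriv Φ z).im * (deriv Φ z).im := by
    rw [Complex.sq_norm, Complex.normSq_apply]
  rw [div_pow ‖deriv Φ z‖, hn]
  simp
  field_simp
  ring

theorem contDiffAt_re_sub_log_cos {χ Φ : ℂ → ℂ} {z : ℂ} {μ : ℝ} (hμ : 0 < μ)
    (hχ : AnalyticAt ℂ χ z) (hΦ : AnalyticAt ℂ Φ z)
    (hc : 0 < Real.cos ((Φ z).im / μ)) :
    ContDiffAt ℝ 2 (fun w => (χ w).re - Real.log (μ * Real.cos ((Φ w).im / μ))) z := by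
  have h1 : ContDiffAt ℝ 2 χ z := hχ.contDiffAt.restrict_scalars ℝ
  have h2 : ContDiffAt ℝ 2 Φ z := hΦ.contDiffAt.restrict_scalars ℝ
  have h3 : ContDiffAt ℝ 2 (fun w => (χ w).re) z := reCLM.contDiff.contDiffAt.comp z h1
  have h4 : ContDiffAt ℝ 2 (fun w => (Φ w).im) z := imCLM.contDiff.contDiffAt.comp z h2
  exact h3.sub (ContDiffAt.log (contDiffAt_const.mul
    (Real.contDiff_cos.contDiffAt.comp z (h4.div_const μ))) (mul_pos hμ hc).ne')

/-- At a local maximum of a `C²` function, second directional derivatives are nonpositive. -/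
theorem fderiv_fderiv_nonpos_of_isLocalMax {f : ℂ → ℝ} {z : ℂ} (hf : ContDiffAt ℝ 2 f z)
    (hmax : IsLocalMax f z) (e : ℂ) :
    fderiv ℝ (fun w => fderiv ℝ f w e) z e ≤ 0 := by
  by_contra! hpos
  have hd : ∀ᶠ w in 𝓝 z, DifferentiableAt ℝ f w := by
    filter_upwards [hf.eventually (by simp)] with w hw
    exact hw.differentiableAt (by simp)
  set line : ℝ → ℂ := fun t => z + t • e with hline
  have hl : ∀ t, HasDerivAt line e t := fun t => by
    have := ((hasDerivAt_id t).smul_const e).const_add z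
    rwa [one_smul] at this
  have hl0 : line 0 = z := by simp [hline]
  have hlc : Tendsto line (𝓝 0) (𝓝 z) := by
    have := (hl 0).continuousAt.tendsto; rwa [hl0] at this
  set g : ℝ → ℝ := fun t => f (line t)
  have hg1 : deriv g =ᶠ[𝓝 0] fun t => fderiv ℝ f (line t) e := by
    filter_upwards [hlc.eventually hd] with t ht
    exact (ht.hasFDerivAt.comp_hasDerivAt t (hl t)).deriv
  have hD : DifferentiableAt ℝ (fun w => fderiv ℝ f w e) z := by
    have h1 : ContDiffAt ℝ 1 (fderiv ℝ f) z := hf.fderiv_right (by norm_num)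
    exact (h1.differentiableAt (by simp)).clm_apply (differentiableAt_const e)
  have hg2 : deriv (deriv g) 0 = fderiv ℝ (fun w => fderiv ℝ f w e) z e := by
    rw [hg1.deriv_eq]
    have h2 : HasFDerivAt (fun w => fderiv ℝ f w e) _ (line 0) := hl0 ▸ hD.hasFDerivAt
    have := (h2.comp_hasDerivAt 0 (hl 0)).deriv
    simpa [Function.comp_def, hl0] using this
  have hgmax : IsLocalMax g 0 := by
    have : ∀ᶠ t in 𝓝 (0:ℝ), f (line t) ≤ f z := hlc.eventually hmax
    filter_upwards [this] with t ht
    simpa [g, hl0] using ht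
  have hg0 : deriv g 0 = 0 := hgmax.deriv_eq_zero
  have hgc : ContinuousAt g 0 := by
    have : ContinuousAt f (line 0) := by rw [hl0]; exact hf.continuousAt
    exact this.comp (hl 0).continuousAt
  have hgmin : IsLocalMin g 0 := isLocalMin_of_deriv_deriv_pos (by rw [hg2]; exact hpos) hg0 hgc
  have hconst : g =ᶠ[𝓝 0] fun _ => g 0 := by
    filter_upwards [hgmax, hgmin] with t h1 h2 using le_antisymm h1 h2
  have : deriv (deriv g) 0 = 0 := by
    have h := hconst.deriv
    rw [h.deriv_eq]; simp
  rw [hg2] at this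
  exact hpos.ne' this

theorem lap_sub_nonpos_of_isLocalMax {f g : ℂ → ℝ} {z : ℂ} (hf : ContDiffAt ℝ 2 f z)
    (hg : ContDiffAt ℝ 2 g z) (hmax : IsLocalMax (fun w => f w - g w) z) :
    lap f z ≤ lap g z := by
  have key : ∀ e : ℂ, fderiv ℝ (fun w => fderiv ℝ f w e) z e ≤
      fderiv ℝ (fun w => fderiv ℝ g w e) z e := by
    intro e
    have h := fderiv_fderiv_nonpos_of_isLocalMax (hf.sub hg) hmax e
    have diff : ∀ {f : ℂ → ℝ}, ContDiffAt ℝ 2 f z →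
        (∀ᶠ w in 𝓝 z, DifferentiableAt ℝ f w) ∧
        DifferentiableAt ℝ (fun w => fderiv ℝ f w e) z := by
      intro f hf
      refine ⟨?_, ?_⟩
      · filter_upwards [hf.eventually (by simp)] with w hw
        exact hw.differentiableAt (by simp)
      · have h1 : ContDiffAt ℝ 1 (fderiv ℝ f) z := hf.fderiv_right (by norm_num)
        exact (h1.differentiableAt (by simp)).clm_apply (differentiableAt_const e)
    have heq : (fun w => fderiv ℝ (fun w => f w - g w) w e) =ᶠ[𝓝 z]
        fun w => fderiv ℝ f w e - fderiv ℝ g w e := by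
      filter_upwards [(diff hf).1, (diff hg).1] with w h1 h2
      rw [fderiv_fun_sub h1 h2]; rfl
    have h' : fderiv ℝ (fun w => fderiv ℝ (fun w => f w - g w) w e) z e ≤ 0 := h
    rw [heq.fderiv_eq, fderiv_fun_sub (diff hf).2 (diff hg).2] at h'
    have h'' : fderiv ℝ (fun w => fderiv ℝ f w e) z e - fderiv ℝ (fun w => fderiv ℝ g w e) z e ≤ 0 := h'
    linarith
  unfold lap
  exact add_le_add (key 1) (key I)

/-- Comparison principle for the Liouville equation. -/
theorem liouville_comparison {D : Set ℂ} (hD : IsOpen D) (hb : Bornology.IsBounded D)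
    {u v : ℂ → ℝ} (hu : ∀ z ∈ D, ContDiffAt ℝ 2 u z) (hv : ∀ z ∈ D, ContDiffAt ℝ 2 v z)
    (hue : ∀ z ∈ D, lap u z = Real.exp (2 * u z))
    (hve : ∀ z ∈ D, lap v z = Real.exp (2 * v z))
    (hbd : ∀ p ∈ frontier D, Tendsto (fun z => v z - u z) (𝓝[D] p) atTop) :
    ∀ z ∈ D, u z ≤ v z := by
  intro z₀ hz₀
  by_contra! hlt
  have hwc : ∀ z ∈ D, ContinuousAt (fun w => u w - v w) z := fun z hz =>
    (hu z hz).continuousAt.sub (hv z hz).continuousAt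
  set S : Set ℂ := {z | z ∈ D ∧ u z₀ - v z₀ ≤ u z - v z} with hS
  have hSclosed : IsClosed S := by
    refine isClosed_of_closure_subset fun p hp => ?_
    have hpD : p ∈ closure D := closure_mono (fun z hz => hz.1) hp
    have hfr : ∃ᶠ z in 𝓝[D] p, u z₀ - v z₀ ≤ u z - v z := by
      rw [frequently_nhdsWithin_iff]
      rw [mem_closure_iff_frequently] at hp
      exact hp.mono fun z hz => ⟨hz.2, hz.1⟩
    by_cases hpin : p ∈ D
    · refine ⟨hpin, ?_⟩
      by_contra! hc
      have : ∀ᶠ z in 𝓝[D] p, u z - v z < u z₀ - v z₀ :=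
        nhdsWithin_le_nhds ((hwc p hpin).eventually (gt_mem_nhds hc))
      obtain ⟨z, h1, h2⟩ := (hfr.and_eventually this).exists
      linarith
    · have hpf : p ∈ frontier D := by
        rw [hD.frontier_eq]; exact ⟨hpD, hpin⟩
      have := (hbd p hpf).eventually (eventually_gt_atTop (v z₀ - u z₀))
      obtain ⟨z, h1, h2⟩ := (hfr.and_eventually this).exists
      linarith
  have hScomp : IsCompact S := Metric.isCompact_of_isClosed_isBounded hSclosed
    (hb.subset fun z hz => hz.1)
  obtain ⟨z₁, hz₁, hmax⟩ := hScomp.exists_isMaxOn ⟨z₀, hz₀, le_rfl⟩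
    (fun z hz => (hwc z hz.1).continuousWithinAt)
  have hloc : IsLocalMax (fun w => u w - v w) z₁ := by
    filter_upwards [hD.mem_nhds hz₁.1] with z hz
    by_cases h : u z₀ - v z₀ ≤ u z - v z
    · exact hmax ⟨hz, h⟩
    · have := hz₁.2
      linarith
  have h1 := lap_sub_nonpos_of_isLocalMax (hu z₁ hz₁.1) (hv z₁ hz₁.1) hloc
  rw [hue z₁ hz₁.1, hve z₁ hz₁.1, Real.exp_le_exp] at h1
  have := hz₁.2
  linarith

/-- The bisecting direction of the cone `{0 < θ < μπ}`. -/
noncomputable def axis (μ : ℝ) : ℂ := exp ((μ * Real.pi / 2 : ℝ) * I)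

/-- The direction of the second edge of the cone `{0 < θ < μπ}`. -/
noncomputable def edge (μ : ℝ) : ℂ := exp ((μ * Real.pi : ℝ) * I)

/-- The open cone `{0 < θ < μπ}`, for `1 < μ < 2`. -/
def cone (μ : ℝ) : Set ℂ := {P | 0 < P.im ∨ 0 < (edge μ * conj P).im}

/-- The conformal radius type function `μ r sin (θ / μ)` of the cone, up to normalization. -/
noncomputable def coneFn (μ : ℝ) (P : ℂ) : ℝ :=
  μ * ‖P‖ * Real.cos (arg (conj (axis μ) * P) / μ)

/-- The map bending the lune of curvature `2τ` onto the cone. -/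
noncomputable def bend (μ τ : ℝ) (Y : ℂ) : ℂ :=
  Y - ((τ / Real.sin (μ * Real.pi / 2) * ‖Y‖ ^ 2 : ℝ) : ℂ) * axis μ

/-- The lune with vertex `a`, first edge direction `m` and signed curvature `2τ`. -/
def lune (μ : ℝ) (a m : ℂ) (τ : ℝ) : Set ℂ := {z | bend μ τ (conj m * (z - a)) ∈ cone μ}

/-- The exact solution on a lune. -/
noncomputable def luneSol (μ : ℝ) (a m : ℂ) (τ : ℝ) (z : ℂ) : ℝ :=
  -Real.log (coneFn μ (bend μ τ (conj m * (z - a))))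

theorem norm_axis (μ : ℝ) : ‖axis μ‖ = 1 := norm_exp_ofReal_mul_I _

theorem norm_edge (μ : ℝ) : ‖edge μ‖ = 1 := norm_exp_ofReal_mul_I _

theorem conj_mul_self_of_norm_one {m : ℂ} (h : ‖m‖ = 1) : conj m * m = 1 := by
  rw [mul_comm, mul_conj, normSq_eq_norm_sq, h]; simp

theorem axis_mul_axis (μ : ℝ) : axis μ * axis μ = edge μ := by
  unfold axis edge
  rw [← Complex.exp_add]
  congr 1
  push_cast; ring

theorem axis_re (μ : ℝ) : (axis μ).re = Real.cos (μ * Real.pi / 2) := exp_ofReal_mul_I_re _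

theorem axis_im (μ : ℝ) : (axis μ).im = Real.sin (μ * Real.pi / 2) := exp_ofReal_mul_I_im _

theorem edge_im (μ : ℝ) : (edge μ).im = Real.sin (μ * Real.pi) := exp_ofReal_mul_I_im _

theorem edge_mul_conj_axis (μ : ℝ) : edge μ * conj (axis μ) = axis μ := by
  rw [← axis_mul_axis, mul_assoc, mul_comm (axis μ) (conj _),
    conj_mul_self_of_norm_one (norm_axis μ), mul_one]

theorem sin_half_pos {μ : ℝ} (h1 : 1 < μ) (h2 : μ < 2) : 0 < Real.sin (μ * Real.pi / 2) := by
  have := Real.pi_pos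
  apply Real.sin_pos_of_pos_of_lt_pi <;> nlinarith

theorem polar_of_arg (μ : ℝ) (P : ℂ) :
    P = ‖P‖ * exp ((arg (conj (axis μ) * P) + μ * Real.pi / 2 : ℝ) * I) := by
  have h := norm_mul_exp_arg_mul_I (conj (axis μ) * P)
  rw [norm_mul, norm_conj, norm_axis, one_mul] at h
  have h2 : P = axis μ * (conj (axis μ) * P) := by
    rw [← mul_assoc, mul_comm (axis μ), conj_mul_self_of_norm_one (norm_axis μ), one_mul]
  conv_lhs => rw [h2, ← h]
  unfold axis
  rw [mul_left_comm, ← Complex.exp_add]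
  congr 2
  push_cast; ring

theorem im_polar (ρ x : ℝ) : ((ρ : ℂ) * exp ((x : ℝ) * I)).im = ρ * Real.sin x := by
  rw [im_ofReal_mul, exp_ofReal_mul_I_im]

theorem re_polar (ρ x : ℝ) : ((ρ : ℂ) * exp ((x : ℝ) * I)).re = ρ * Real.cos x := by
  rw [re_ofReal_mul, exp_ofReal_mul_I_re]

theorem edge_mul_conj_polar (μ ρ x : ℝ) : edge μ * conj ((ρ : ℂ) * exp ((x : ℝ) * I)) =
    (ρ : ℂ) * exp ((μ * Real.pi - x : ℝ) * I) := by
  unfold edge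
  rw [map_mul, conj_ofReal, ← exp_conj, mul_left_comm, ← Complex.exp_add]
  congr 2
  simp
  ring

theorem cone_iff {μ : ℝ} (h1 : 1 < μ) (h2 : μ < 2) (P : ℂ) :
    P ∈ cone μ ↔ P ≠ 0 ∧ |arg (conj (axis μ) * P)| < μ * Real.pi / 2 := by
  have hpi := Real.pi_pos
  have hP := polar_of_arg μ P
  set x := arg (conj (axis μ) * P) with hx
  have hx1 : -Real.pi < x := neg_pi_lt_arg _
  have hx2 : x ≤ Real.pi := arg_le_pi _
  have him : P.im = ‖P‖ * Real.sin (x + μ * Real.pi / 2) := by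
    conv_lhs => rw [hP]
    exact im_polar _ _
  have him2 : (edge μ * conj P).im = ‖P‖ * Real.sin (μ * Real.pi / 2 - x) := by
    conv_lhs => rw [hP, edge_mul_conj_polar, im_polar]
    congr 2; ring
  show 0 < P.im ∨ 0 < (edge μ * conj P).im ↔ _
  rw [him, him2]
  constructor
  · intro h
    have hP0 : P ≠ 0 := by
      rintro rfl
      simp at h
    have hn : 0 < ‖P‖ := norm_pos_iff.2 hP0
    refine ⟨hP0, ?_⟩
    by_contra! hc
    have a1 : Real.sin (x + μ * Real.pi / 2) ≤ 0 ∧ Real.sin (μ * Real.pi / 2 - x) ≤ 0 := by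
      rcases le_abs.1 hc with hc | hc
      · constructor
        · have : Real.sin (x + μ * Real.pi / 2) = - Real.sin (x + μ * Real.pi / 2 - Real.pi) := by
            rw [Real.sin_sub_pi]; ring
          rw [this]
          have := Real.sin_nonneg_of_nonneg_of_le_pi (x := x + μ * Real.pi / 2 - Real.pi)
            (by nlinarith) (by nlinarith)
          linarith
        · exact Real.sin_nonpos_of_nonpos_of_neg_pi_le (by nlinarith) (by nlinarith)
      · constructor
        · exact Real.sin_nonpos_of_nonpos_of_neg_pi_le (by nlinarith) (by nlinarith)
        · have : Real.sin (μ * Real.pi / 2 - x) = - Real.sin (μ * Real.pi / 2 - x - Real.pi) := by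
            rw [Real.sin_sub_pi]; ring
          rw [this]
          have := Real.sin_nonneg_of_nonneg_of_le_pi (x := μ * Real.pi / 2 - x - Real.pi)
            (by nlinarith) (by nlinarith)
          linarith
    rcases h with h | h
    · nlinarith [a1.1]
    · nlinarith [a1.2]
  · rintro ⟨hP0, hlt⟩
    have hn : 0 < ‖P‖ := norm_pos_iff.2 hP0
    rw [abs_lt] at hlt
    rcases le_total x 0 with h | h
    · left
      exact mul_pos hn (Real.sin_pos_of_pos_of_lt_pi (by linarith) (by nlinarith))
    · right
      exact mul_pos hn (Real.sin_pos_of_pos_of_lt_pi (by linarith) (by nlinarith))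

theorem isOpen_cone (μ : ℝ) : IsOpen (cone μ) := by
  apply IsOpen.union
  · exact isOpen_lt continuous_const continuous_im
  · exact isOpen_lt continuous_const
      (continuous_im.comp (continuous_const.mul continuous_conj))

theorem continuous_bend (μ τ : ℝ) : Continuous (bend μ τ) := by
  unfold bend; fun_prop

theorem isOpen_lune (μ : ℝ) (a m : ℂ) (τ : ℝ) : IsOpen (lune μ a m τ) :=
  (isOpen_cone μ).preimage ((continuous_bend μ τ).comp (by fun_prop))

theorem coneFn_pos {μ : ℝ} (h1 : 1 < μ) (h2 : μ < 2) {P : ℂ} (h : P ∈ cone μ) :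
    0 < coneFn μ P := by
  rw [cone_iff h1 h2] at h
  have := norm_pos_iff.2 h.1
  have hpi := Real.pi_pos
  rw [abs_lt] at h
  refine mul_pos (by positivity) (Real.cos_pos_of_mem_Ioo ⟨?_, ?_⟩)
  · rw [lt_div_iff₀ (by linarith)]; linarith
  · rw [div_lt_iff₀ (by linarith)]; linarith

theorem continuousAt_coneFn_zero (μ : ℝ) : ContinuousAt (coneFn μ) 0 := by
  have h0 : coneFn μ 0 = 0 := by simp [coneFn]
  unfold ContinuousAt
  rw [h0]
  have hb : ∀ P, |coneFn μ P| ≤ |μ| * ‖P‖ := by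
    intro P
    unfold coneFn
    rw [abs_mul, abs_mul, abs_norm]
    exact mul_le_of_le_one_right (by positivity) (Real.abs_cos_le_one _)
  refine squeeze_zero_norm hb ?_
  have : Continuous fun P : ℂ => |μ| * ‖P‖ := by fun_prop
  simpa using this.tendsto 0

theorem continuousAt_coneFn {μ : ℝ} {P : ℂ} (h : conj (axis μ) * P ∈ slitPlane) :
    ContinuousAt (coneFn μ) P := by
  unfold coneFn
  have : ContinuousAt (fun P => arg (conj (axis μ) * P)) P :=
    ContinuousAt.comp (f := fun P => conj (axis μ) * P) (g := arg) (continuousAt_arg h) (by fun_prop)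
  fun_prop

theorem conj_axis_mul_mem_slitPlane {μ : ℝ} {P : ℂ} (h2 : μ < 2) (hP : P ≠ 0)
    (h : |arg (conj (axis μ) * P)| ≤ μ * Real.pi / 2) :
    conj (axis μ) * P ∈ slitPlane := by
  have hne : conj (axis μ) * P ≠ 0 := by
    refine mul_ne_zero ?_ hP
    rw [← norm_pos_iff, norm_conj, norm_axis]; exact one_pos
  rw [mem_slitPlane_iff_arg]
  refine ⟨?_, hne⟩
  intro hc
  have hpi := Real.pi_pos
  rw [hc, abs_of_pos hpi] at h
  nlinarith

theorem coneFn_boundary {μ : ℝ} (h1 : 1 < μ) (h2 : μ < 2) {P : ℂ}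
    (hP : P ∈ closure (cone μ)) (hP' : P ∉ cone μ) :
    ContinuousAt (coneFn μ) P ∧ coneFn μ P = 0 := by
  by_cases h0 : P = 0
  · subst h0
    exact ⟨continuousAt_coneFn_zero μ, by simp [coneFn]⟩
  have hpi := Real.pi_pos
  have hcl : 0 ≤ P.im ∨ 0 ≤ (edge μ * conj P).im := by
    have hc : IsClosed {P : ℂ | 0 ≤ P.im ∨ 0 ≤ (edge μ * conj P).im} :=
      (isClosed_le continuous_const continuous_im).union
        (isClosed_le continuous_const
          (continuous_im.comp (continuous_const.mul continuous_conj)))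
    refine closure_minimal ?_ hc hP
    rintro Q (h | h)
    · exact Or.inl h.le
    · exact Or.inr h.le
  have hge : μ * Real.pi / 2 ≤ |arg (conj (axis μ) * P)| := by
    by_contra! hc
    exact hP' ((cone_iff h1 h2 P).2 ⟨h0, hc⟩)
  have heq : |arg (conj (axis μ) * P)| = μ * Real.pi / 2 := by
    have hpol := polar_of_arg μ P
    set x := arg (conj (axis μ) * P) with hx
    have hx1 : -Real.pi < x := neg_pi_lt_arg _
    have hx2 : x ≤ Real.pi := arg_le_pi _
    have him : P.im = ‖P‖ * Real.sin (x + μ * Real.pi / 2) := by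
      conv_lhs => rw [hpol]
      exact im_polar _ _
    have him2 : (edge μ * conj P).im = ‖P‖ * Real.sin (μ * Real.pi / 2 - x) := by
      conv_lhs => rw [hpol, edge_mul_conj_polar, im_polar]
      congr 2; ring
    have hn : 0 < ‖P‖ := norm_pos_iff.2 h0
    rw [him, him2] at hcl
    have hcl' : 0 ≤ Real.sin (x + μ * Real.pi / 2) ∨ 0 ≤ Real.sin (μ * Real.pi / 2 - x) := by
      rcases hcl with h | h
      · exact Or.inl (nonneg_of_mul_nonneg_right h hn)
      · exact Or.inr (nonneg_of_mul_nonneg_right h hn)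
    by_contra hne
    have hgt := lt_of_le_of_ne hge (Ne.symm hne)
    rcases lt_abs.1 hgt with hc | hc
    · have e1 : Real.sin (μ * Real.pi / 2 - x) < 0 :=
        Real.sin_neg_of_neg_of_neg_pi_lt (by nlinarith) (by nlinarith)
      have e2 : 0 < Real.sin (x + μ * Real.pi / 2 - Real.pi) :=
        Real.sin_pos_of_pos_of_lt_pi (by nlinarith) (by nlinarith)
      rw [Real.sin_sub_pi] at e2
      rcases hcl' with h | h <;> linarith
    · have e1 : Real.sin (x + μ * Real.pi / 2) < 0 :=
        Real.sin_neg_of_neg_of_neg_pi_lt (by nlinarith) (by nlinarith)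
      have e2 : 0 < Real.sin (μ * Real.pi / 2 - x - Real.pi) :=
        Real.sin_pos_of_pos_of_lt_pi (by nlinarith) (by nlinarith)
      rw [Real.sin_sub_pi] at e2
      rcases hcl' with h | h <;> linarith
  refine ⟨continuousAt_coneFn (conj_axis_mul_mem_slitPlane h2 h0 heq.le), ?_⟩
  unfold coneFn
  rw [← Real.cos_abs, abs_div, heq, abs_of_pos (by linarith : 0 < μ)]
  have : μ * Real.pi / 2 / μ = Real.pi / 2 := by field_simp
  rw [this, Real.cos_pi_div_two, mul_zero]

theorem conj_axis_mul_bend (μ τ : ℝ) (Y : ℂ) :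
    conj (axis μ) * bend μ τ Y = (conj (axis μ) * Y) *
      (1 - ((τ / Real.sin (μ * Real.pi / 2) : ℝ) : ℂ) * conj (conj (axis μ) * Y)) := by
  have h1 : ((‖Y‖ ^ 2 : ℝ) : ℂ) = (conj (axis μ) * Y) * conj (conj (axis μ) * Y) := by
    rw [mul_conj, normSq_eq_norm_sq, norm_mul, norm_conj, norm_axis, one_mul]
  have h2 := conj_mul_self_of_norm_one (norm_axis μ)
  unfold bend
  rw [ofReal_mul, h1]
  linear_combination
    (-((τ / Real.sin (μ * Real.pi / 2) : ℝ) : ℂ) *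
      ((conj (axis μ) * Y) * conj (conj (axis μ) * Y))) * h2

/-- On a lune the solution is, near each point, of the form treated in
`lap_re_sub_log_cos`. -/
theorem luneSol_spec {μ : ℝ} (h1 : 1 < μ) (h2 : μ < 2) {a m : ℂ} (hm : ‖m‖ = 1) {τ : ℝ}
    {z₀ : ℂ} (hz₀ : z₀ ∈ lune μ a m τ) :
    ContDiffAt ℝ 2 (luneSol μ a m τ) z₀ ∧
    lap (luneSol μ a m τ) z₀ = Real.exp (2 * luneSol μ a m τ z₀) := by
  have hμ : 0 < μ := by linarith
  have hpi := Real.pi_pos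
  set s : ℂ := ((τ / Real.sin (μ * Real.pi / 2) : ℝ) : ℂ) with hs
  set c : ℂ := conj (axis μ) * conj m with hc
  have hcn : ‖c‖ = 1 := by rw [hc, norm_mul, norm_conj, norm_conj, norm_axis, hm, one_mul]
  set W : ℂ → ℂ := fun z => c * (z - a) with hW
  have hWd : ∀ z, HasDerivAt W c z := fun z => by
    simpa using ((hasDerivAt_id z).sub_const a).const_mul c
  have hbend : ∀ z, conj (axis μ) * bend μ τ (conj m * (z - a)) = W z * (1 - s * conj (W z)) := by
    intro z
    rw [conj_axis_mul_bend]
    simp only [hW, hc, hs, mul_assoc]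
  set ψ : ℂ → ℂ := fun z => W z * (1 - s * W z) with hψ
  have hfac : ∀ z, 1 - s * W z = conj (1 - s * conj (W z)) := by
    intro z
    have hsc : conj s = s := conj_ofReal _
    rw [map_sub, map_one, map_mul, hsc, conj_conj]
  have hmem := (cone_iff h1 h2 _).1 hz₀
  have hne : ∀ z, z ∈ lune μ a m τ → W z ≠ 0 ∧ 1 - s * W z ≠ 0 := by
    intro z hz
    have h := ((cone_iff h1 h2 _).1 hz).1
    have h' : W z * (1 - s * conj (W z)) ≠ 0 := by
      rw [← hbend]
      refine mul_ne_zero ?_ h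
      rw [← norm_pos_iff, norm_conj, norm_axis]; exact one_pos
    refine ⟨left_ne_zero_of_mul h', ?_⟩
    rw [hfac]
    exact (map_ne_zero _).2 (right_ne_zero_of_mul h')
  have hnorm : ∀ z, ‖bend μ τ (conj m * (z - a))‖ = ‖ψ z‖ := by
    intro z
    have : ‖conj (axis μ) * bend μ τ (conj m * (z - a))‖ = ‖bend μ τ (conj m * (z - a))‖ := by
      rw [norm_mul, norm_conj, norm_axis, one_mul]
    rw [← this, hbend, hψ]
    simp only [norm_mul]
    rw [hfac, norm_conj]
  have harg : ∀ z, z ∈ lune μ a m τ →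
      arg (conj (axis μ) * bend μ τ (conj m * (z - a))) = arg (W z / (1 - s * W z)) := by
    intro z hz
    have h := (hne z hz).2
    have hq : 0 < normSq (1 - s * W z) := normSq_pos.2 h
    have : conj (axis μ) * bend μ τ (conj m * (z - a)) =
        (normSq (1 - s * W z) : ℝ) * (W z / (1 - s * W z)) := by
      rw [hbend, ← mul_conj]
      rw [show conj (1 - s * W z) = 1 - s * conj (W z) by rw [hfac, conj_conj]]
      generalize 1 - s * W z = q at h
      field_simp
    rw [this, arg_real_mul _ hq]
  set Φ : ℂ → ℂ := fun z => log (W z / (1 - s * W z)) with hΦ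
  set χ : ℂ → ℂ := fun z => -log (ψ z / ψ z₀) - (Real.log ‖ψ z₀‖ : ℝ) with hχ
  obtain ⟨hW0, hV0⟩ := hne z₀ hz₀
  have hψ0 : ψ z₀ ≠ 0 := mul_ne_zero hW0 hV0
  have hWa : AnalyticAt ℂ W z₀ := by
    simp only [hW]; fun_prop
  have hψa : AnalyticAt ℂ ψ z₀ := by
    simp only [hψ]; fun_prop
  have hslit : W z₀ / (1 - s * W z₀) ∈ slitPlane := by
    rw [mem_slitPlane_iff_arg]
    refine ⟨?_, div_ne_zero hW0 hV0⟩
    rw [← harg z₀ hz₀]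
    exact (mem_slitPlane_iff_arg.1 (conj_axis_mul_mem_slitPlane h2 hmem.1 hmem.2.le)).1
  have hΦa : AnalyticAt ℂ Φ z₀ :=
    (hWa.div (analyticAt_const.sub (analyticAt_const.mul hWa)) hV0).clog hslit
  have hχa : AnalyticAt ℂ χ z₀ :=
    ((hψa.div analyticAt_const hψ0).clog (by
      show ψ z₀ / ψ z₀ ∈ slitPlane
      rw [div_self hψ0]; exact one_mem_slitPlane)).neg.sub analyticAt_const
  have hform : luneSol μ a m τ =ᶠ[𝓝 z₀]
      fun w => (χ w).re - Real.log (μ * Real.cos ((Φ w).im / μ)) := by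
    filter_upwards [(isOpen_lune μ a m τ).mem_nhds hz₀] with w hw
    have hp := coneFn_pos h1 h2 hw
    unfold luneSol
    have hψw : ψ w ≠ 0 := mul_ne_zero (hne w hw).1 (hne w hw).2
    have e1 : (χ w).re = - Real.log ‖ψ w‖ := by
      simp only [hχ, sub_re, neg_re, ofReal_re, log_re, norm_div]
      rw [Real.log_div (norm_ne_zero_iff.2 hψw) (norm_ne_zero_iff.2 hψ0)]
      ring
    have e2 : (Φ w).im = arg (conj (axis μ) * bend μ τ (conj m * (w - a))) := by
      simp only [hΦ, log_im]; rw [harg w hw]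
    rw [e1, e2]
    unfold coneFn at hp ⊢
    rw [hnorm] at hp ⊢
    have hψp := norm_pos_iff.2 hψw
    have hcp : Real.cos (arg (conj (axis μ) * bend μ τ (conj m * (w - a))) / μ) ≠ 0 :=
      right_ne_zero_of_mul hp.ne'
    rw [mul_right_comm, Real.log_mul (mul_ne_zero hμ.ne' hcp) hψp.ne']
    ring
  have him : (Φ z₀).im = arg (conj (axis μ) * bend μ τ (conj m * (z₀ - a))) := by
    simp only [hΦ, log_im]; rw [harg z₀ hz₀]
  have hcos : 0 < Real.cos ((Φ z₀).im / μ) := by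
    rw [him]
    have hh := abs_lt.1 hmem.2
    refine Real.cos_pos_of_mem_Ioo ⟨?_, ?_⟩
    · rw [lt_div_iff₀ (by linarith)]; linarith
    · rw [div_lt_iff₀ (by linarith)]; linarith
  refine ⟨(contDiffAt_re_sub_log_cos hμ hχa hΦa hcos).congr_of_eventuallyEq hform, ?_⟩
  have hlap : lap (luneSol μ a m τ) z₀ =
      lap (fun w => (χ w).re - Real.log (μ * Real.cos ((Φ w).im / μ))) z₀ := by
    unfold lap
    have key : ∀ e : ℂ, (fun w => fderiv ℝ (luneSol μ a m τ) w e) =ᶠ[𝓝 z₀]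
        fun w => fderiv ℝ (fun w => (χ w).re - Real.log (μ * Real.cos ((Φ w).im / μ))) w e := by
      intro e
      filter_upwards [hform.eventuallyEq_nhds] with w hw
      rw [hw.fderiv_eq]
    rw [(key 1).fderiv_eq, (key I).fderiv_eq]
  rw [hlap, lap_re_sub_log_cos hμ hχa hΦa hcos]
  have hdΦ : deriv Φ z₀ = c / ψ z₀ := by
    have hd := (((hWd z₀).div (((hWd z₀).const_mul s).const_sub 1) hV0).clog hslit).deriv
    have : deriv Φ z₀ = (c * (1 - s * W z₀) - W z₀ * -(s * c)) / (1 - s * W z₀) ^ 2 /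
        (W z₀ / (1 - s * W z₀)) := hd
    rw [this, show c * (1 - s * W z₀) - W z₀ * -(s * c) = c by ring]
    simp only [hψ]
    generalize 1 - s * W z₀ = q at hV0
    field_simp
  have hexp : Real.exp (luneSol μ a m τ z₀) = ‖deriv Φ z₀‖ / (μ * Real.cos ((Φ z₀).im / μ)) := by
    unfold luneSol
    rw [Real.exp_neg, Real.exp_log (coneFn_pos h1 h2 hz₀), hdΦ, norm_div, hcn]
    unfold coneFn
    rw [hnorm, him]
    field_simp
  rw [two_mul, Real.exp_add, hexp]
  ring

theorem bend_im {μ : ℝ} (h1 : 1 < μ) (h2 : μ < 2) (τ : ℝ) (Y : ℂ) :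
    (bend μ τ Y).im = Y.im - τ * ‖Y‖ ^ 2 := by
  have hS := (sin_half_pos h1 h2).ne'
  unfold bend
  rw [sub_im, im_ofReal_mul, axis_im]
  field_simp

theorem edge_mul_conj_bend (μ τ : ℝ) (Y : ℂ) :
    edge μ * conj (bend μ τ Y) = bend μ τ (edge μ * conj Y) := by
  unfold bend
  rw [map_sub, map_mul, conj_ofReal, norm_mul, norm_conj, norm_edge, one_mul, mul_sub,
    mul_left_comm, edge_mul_conj_axis]

theorem mem_lune_iff {μ : ℝ} (h1 : 1 < μ) (h2 : μ < 2) {a m : ℂ} (hm : ‖m‖ = 1) (τ : ℝ) (z : ℂ) :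
    z ∈ lune μ a m τ ↔ τ * ‖z - a‖ ^ 2 < inner ℝ (I * m) (z - a) ∨
      τ * ‖z - a‖ ^ 2 < inner ℝ (-(I * edge μ * m)) (z - a) := by
  have hn : ‖conj m * (z - a)‖ = ‖z - a‖ := by rw [norm_mul, norm_conj, hm, one_mul]
  have e1 : (conj m * (z - a)).im = inner ℝ (I * m) (z - a) := by
    rw [Complex.inner]
    simp only [map_mul, conj_I, mul_re, mul_im, neg_re, neg_im, conj_re, conj_im, I_re, I_im,
      sub_re, sub_im]
    ring
  have e2 : (edge μ * conj (conj m * (z - a))).im = inner ℝ (-(I * edge μ * m)) (z - a) := by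
    rw [Complex.inner]
    simp only [map_mul, map_neg, conj_conj, conj_I, mul_re, mul_im, neg_re, neg_im, conj_re,
      conj_im, I_re, I_im, sub_re, sub_im]
    ring
  have hn2 : ‖edge μ * conj (conj m * (z - a))‖ = ‖z - a‖ := by
    rw [norm_mul, norm_edge, one_mul, norm_conj, hn]
  change 0 < (bend μ τ (conj m * (z - a))).im ∨
    0 < (edge μ * conj (bend μ τ (conj m * (z - a)))).im ↔ _
  rw [edge_mul_conj_bend, bend_im h1 h2, bend_im h1 h2, hn, hn2, e1, e2]
  simp only [sub_pos]

theorem isBounded_lune {μ : ℝ} (h1 : 1 < μ) (h2 : μ < 2) {a m : ℂ} (hm : ‖m‖ = 1) {τ : ℝ}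
    (hτ : 0 < τ) : Bornology.IsBounded (lune μ a m τ) := by
  refine (Metric.isBounded_closedBall (x := a) (r := 1 / τ)).subset ?_
  intro z hz
  rw [mem_closedBall_iff_norm, le_div_iff₀ hτ]
  have key : ∀ n : ℂ, ‖n‖ = 1 → τ * ‖z - a‖ ^ 2 < inner ℝ n (z - a) → ‖z - a‖ * τ ≤ 1 := by
    intro n hn h
    have h3 := real_inner_le_norm n (z - a)
    rw [hn, one_mul] at h3
    by_contra! hc
    have h0 := norm_nonneg (z - a)
    have : ‖z - a‖ * 1 ≤ ‖z - a‖ * (‖z - a‖ * τ) := mul_le_mul_of_nonneg_left hc.le h0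
    nlinarith
  rcases (mem_lune_iff h1 h2 hm τ z).1 hz with h | h
  · exact key _ (by simp [hm]) h
  · exact key _ (by simp [hm, norm_edge]) h

theorem tendsto_luneSol_frontier {μ : ℝ} (h1 : 1 < μ) (h2 : μ < 2) {a m : ℂ} {τ : ℝ} {p : ℂ}
    (hp : p ∈ frontier (lune μ a m τ)) :
    Tendsto (luneSol μ a m τ) (𝓝[lune μ a m τ] p) atTop := by
  have hc : Continuous fun z => bend μ τ (conj m * (z - a)) :=
    (continuous_bend μ τ).comp (by fun_prop)
  have hP : bend μ τ (conj m * (p - a)) ∈ closure (cone μ) :=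
    map_mem_closure (f := fun z => bend μ τ (conj m * (z - a))) hc (frontier_subset_closure hp) fun z hz => hz
  have hP' : bend μ τ (conj m * (p - a)) ∉ cone μ := by
    rw [(isOpen_lune μ a m τ).frontier_eq] at hp
    exact hp.2
  obtain ⟨hca, hz⟩ := coneFn_boundary h1 h2 hP hP'
  have ht : Tendsto (fun z => coneFn μ (bend μ τ (conj m * (z - a)))) (𝓝 p) (𝓝 0) := by
    have := hca.tendsto.comp hc.continuousAt.tendsto
    rwa [hz] at this
  have ht' : Tendsto (fun z => coneFn μ (bend μ τ (conj m * (z - a)))) (𝓝[lune μ a m τ] p)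
      (𝓝[>] 0) := by
    refine tendsto_nhdsWithin_iff.2 ⟨ht.mono_left nhdsWithin_le_nhds, ?_⟩
    filter_upwards [self_mem_nhdsWithin] with z hz
    exact coneFn_pos h1 h2 hz
  exact tendsto_neg_atBot_atTop.comp (Real.tendsto_log_nhdsGT_zero.comp ht')

theorem le_luneSol {μ : ℝ} (h1 : 1 < μ) (h2 : μ < 2) {a m : ℂ} (hm : ‖m‖ = 1) {τ : ℝ}
    (hτ : 0 < τ) {Ω : Set ℂ} {u : ℂ → ℝ} (hu : ∀ z ∈ Ω, ContDiffAt ℝ 2 u z)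
    (hue : ∀ z ∈ Ω, lap u z = Real.exp (2 * u z)) (hcl : closure (lune μ a m τ) ⊆ Ω) :
    ∀ z ∈ lune μ a m τ, u z ≤ luneSol μ a m τ z := by
  have hsub := subset_closure.trans hcl
  refine liouville_comparison (isOpen_lune μ a m τ) (isBounded_lune h1 h2 hm hτ)
    (fun z hz => hu z (hsub hz)) (fun z hz => (luneSol_spec h1 h2 hm hz).1)
    (fun z hz => hue z (hsub hz)) (fun z hz => (luneSol_spec h1 h2 hm hz).2) ?_
  intro p hp
  have hc : Tendsto (fun z => -u z) (𝓝[lune μ a m τ] p) (𝓝 (-u p)) :=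
    ((hu p (hcl (frontier_subset_closure hp))).continuousAt.tendsto.mono_left
      nhdsWithin_le_nhds).neg
  simpa [sub_eq_add_neg] using (tendsto_luneSol_frontier h1 h2 hp).atTop_add hc

theorem luneSol_le {μ : ℝ} (h1 : 1 < μ) (h2 : μ < 2) {a m : ℂ} (hm : ‖m‖ = 1) {τ : ℝ}
    {Ω : Set ℂ} (hΩ : IsOpen Ω) (hb : Bornology.IsBounded Ω) {u : ℂ → ℝ}
    (hu : ∀ z ∈ Ω, ContDiffAt ℝ 2 u z) (hue : ∀ z ∈ Ω, lap u z = Real.exp (2 * u z))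
    (hbd : ∀ p ∈ frontier Ω, Tendsto u (𝓝[Ω] p) atTop)
    (hcl : closure Ω ⊆ lune μ a m τ) :
    ∀ z ∈ Ω, luneSol μ a m τ z ≤ u z := by
  have hsub := subset_closure.trans hcl
  refine liouville_comparison hΩ hb (fun z hz => (luneSol_spec h1 h2 hm (hsub hz)).1)
    hu (fun z hz => (luneSol_spec h1 h2 hm (hsub hz)).2) hue ?_
  intro p hp
  have hc : Tendsto (fun z => -luneSol μ a m τ z) (𝓝[Ω] p) (𝓝 (-luneSol μ a m τ p)) :=
    ((luneSol_spec h1 h2 hm (hcl (frontier_subset_closure hp))).1.continuousAt.tendsto.mono_left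
      nhdsWithin_le_nhds).neg
  simpa [sub_eq_add_neg] using (hbd p hp).atTop_add hc

theorem tendsto_luneSol_shift {μ : ℝ} (h1 : 1 < μ) (h2 : μ < 2) {a m z : ℂ} {τ : ℝ}
    (hz : z ∈ lune μ a m τ) (w : ℂ) :
    (∀ᶠ ε : ℝ in 𝓝[>] 0, z ∈ lune μ (a + ε • w) m τ) ∧
    Tendsto (fun ε : ℝ => luneSol μ (a + ε • w) m τ z) (𝓝[>] 0) (𝓝 (luneSol μ a m τ z)) := by
  have hc : Continuous fun ε : ℝ => bend μ τ (conj m * (z - (a + ε • w))) :=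
    (continuous_bend μ τ).comp (by fun_prop)
  have h0 : bend μ τ (conj m * (z - (a + (0 : ℝ) • w))) = bend μ τ (conj m * (z - a)) := by simp
  have hz' : bend μ τ (conj m * (z - a)) ∈ cone μ := hz
  have ht : Tendsto (fun ε : ℝ => bend μ τ (conj m * (z - (a + ε • w)))) (𝓝[>] 0)
      (𝓝 (bend μ τ (conj m * (z - a)))) := by
    rw [← h0]; exact hc.continuousAt.tendsto.mono_left nhdsWithin_le_nhds
  refine ⟨ht.eventually ((isOpen_cone μ).mem_nhds hz'), ?_⟩
  have hi := (cone_iff h1 h2 _).1 hz'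
  have hcf : ContinuousAt (coneFn μ) (bend μ τ (conj m * (z - a))) :=
    continuousAt_coneFn (conj_axis_mul_mem_slitPlane h2 hi.1 hi.2.le)
  exact ((hcf.tendsto.comp ht).log (coneFn_pos h1 h2 hz').ne').neg

theorem le_luneSol_of_shift {μ : ℝ} (h1 : 1 < μ) (h2 : μ < 2) {a m : ℂ} (hm : ‖m‖ = 1) {τ : ℝ}
    (hτ : 0 < τ) {Ω : Set ℂ} {u : ℂ → ℝ} (hu : ∀ z ∈ Ω, ContDiffAt ℝ 2 u z)
    (hue : ∀ z ∈ Ω, lap u z = Real.exp (2 * u z)) {w : ℂ} {ε₀ : ℝ} (hε₀ : 0 < ε₀)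
    (hcl : ∀ ε : ℝ, 0 < ε → ε < ε₀ → closure (lune μ (a + ε • w) m τ) ⊆ Ω) {z : ℂ}
    (hz : z ∈ lune μ a m τ) : u z ≤ luneSol μ a m τ z := by
  obtain ⟨hm1, ht⟩ := tendsto_luneSol_shift h1 h2 hz w
  refine ge_of_tendsto ht ?_
  filter_upwards [hm1, Ioo_mem_nhdsGT hε₀] with ε hε hε'
  exact le_luneSol h1 h2 hm hτ hu hue (hcl ε hε'.1 hε'.2) z hε

theorem luneSol_le_of_shift {μ : ℝ} (h1 : 1 < μ) (h2 : μ < 2) {a m : ℂ} (hm : ‖m‖ = 1) {τ : ℝ}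
    {Ω : Set ℂ} (hΩ : IsOpen Ω) (hb : Bornology.IsBounded Ω) {u : ℂ → ℝ}
    (hu : ∀ z ∈ Ω, ContDiffAt ℝ 2 u z) (hue : ∀ z ∈ Ω, lap u z = Real.exp (2 * u z))
    (hbd : ∀ p ∈ frontier Ω, Tendsto u (𝓝[Ω] p) atTop) {w : ℂ} {ε₀ : ℝ} (hε₀ : 0 < ε₀)
    (hcl : ∀ ε : ℝ, 0 < ε → ε < ε₀ → closure Ω ⊆ lune μ (a + ε • w) m τ) {z : ℂ} (hz : z ∈ Ω)
    (hz' : z ∈ lune μ a m τ) : luneSol μ a m τ z ≤ u z := by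
  obtain ⟨hm1, ht⟩ := tendsto_luneSol_shift h1 h2 hz' w
  refine le_of_tendsto ht ?_
  filter_upwards [Ioo_mem_nhdsGT hε₀] with ε hε'
  exact luneSol_le h1 h2 hm hΩ hb hu hue hbd (hcl ε hε'.1 hε'.2) z hz

theorem inter_frontier_nonempty {X : Type*} [TopologicalSpace X] {s t : Set X}
    (ht : IsPreconnected t) (h : (t ∩ s).Nonempty) (h' : (t ∩ sᶜ).Nonempty) :
    (t ∩ frontier s).Nonempty := by
  by_contra hc
  rw [Set.not_nonempty_iff_eq_empty, Set.eq_empty_iff_forall_notMem] at hc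
  obtain ⟨x, hx, hxs⟩ := h
  obtain ⟨y, hy, hys⟩ := h'
  have hxi : x ∈ interior s := by
    by_contra hxi
    exact hc x ⟨hx, subset_closure hxs, hxi⟩
  have hyc : y ∉ closure s := fun hyc => hc y ⟨hy, hyc, fun h => hys (interior_subset h)⟩
  obtain ⟨z, -, hz1, hz2⟩ := ht (interior s) (closure s)ᶜ isOpen_interior isClosed_closure.isOpen_compl
    (fun z hz => by
      by_contra hz'
      rw [Set.mem_union, not_or, Set.mem_compl_iff, not_not] at hz'
      exact hc z ⟨hz, hz'.2, hz'.1⟩) ⟨x, hx, hxi⟩ ⟨y, hy, hyc⟩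
  exact hz2 (subset_closure (interior_subset hz1))

theorem norm_sub_smul_sq {n : ℂ} (hn : ‖n‖ = 1) (R : ℝ) (y : ℂ) :
    ‖y - R • n‖ ^ 2 = ‖y‖ ^ 2 - 2 * R * inner ℝ n y + R ^ 2 := by
  rw [norm_sub_sq_real, norm_smul, hn, mul_one, Real.norm_eq_abs, sq_abs, real_inner_smul_right,
    real_inner_comm]
  ring

theorem norm_sub_smul_le_iff {n : ℂ} (hn : ‖n‖ = 1) {R : ℝ} (hR : 0 < R) (y : ℂ) :
    ‖y - R • n‖ ≤ R ↔ 1 / (2 * R) * ‖y‖ ^ 2 ≤ inner ℝ n y := by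
  rw [← sq_le_sq₀ (norm_nonneg _) hR.le, norm_sub_smul_sq hn, one_div, inv_mul_le_iff₀ (by positivity)]
  constructor <;> intro h <;> linarith

/-- If the point `y` lies well outside the disc of radius `R` touching the origin in direction `n`,
then it also lies outside the disc moved slightly in a direction `w` pointing inwards. -/
theorem lt_norm_sub_of_shift {n w y : ℂ} (hn : ‖n‖ = 1) (hw : ‖w‖ = 1) {R S ε : ℝ} (hR : 0 < R)
    (hS : S ≤ inner ℝ n w) (hy : inner ℝ n y ≤ ‖y‖ ^ 2 / (4 * R)) (hε : 0 < ε)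
    (hε' : ε < 2 * R * S) : R < ‖y - ε • w - R • n‖ := by
  rw [← sq_lt_sq₀ hR.le (norm_nonneg _), norm_sub_smul_sq hn, norm_sub_smul_sq hw, inner_sub_right,
    real_inner_smul_right]
  rw [le_div_iff₀ (by positivity)] at hy
  have h1 := real_inner_le_norm w y
  rw [hw, one_mul] at h1
  have h2 : ε * inner ℝ w y ≤ ε * ‖y‖ := mul_le_mul_of_nonneg_left h1 hε.le
  have h3 : 2 * R * ε * S ≤ 2 * R * ε * inner ℝ n w := mul_le_mul_of_nonneg_left hS (by positivity)
  have h4 : ε * ε < ε * (2 * R * S) := mul_lt_mul_of_pos_left hε' hε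
  nlinarith [sq_nonneg (‖y‖ - 2 * ε)]

theorem inner_I_mul_axis (μ : ℝ) {m : ℂ} (hm : ‖m‖ = 1) :
    inner ℝ (I * m) (m * axis μ) = Real.sin (μ * Real.pi / 2) := by
  have h : m * axis μ * conj (I * m) = -(I * axis μ) := by
    rw [map_mul, conj_I]
    linear_combination (-(I * axis μ)) * conj_mul_self_of_norm_one hm
  rw [Complex.inner, h, neg_re, I_mul_re, axis_im, neg_neg]

theorem inner_edge_mul_axis (μ : ℝ) {m : ℂ} (hm : ‖m‖ = 1) :
    inner ℝ (-(I * edge μ * m)) (m * axis μ) = Real.sin (μ * Real.pi / 2) := by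
  have h : conj (edge μ) * axis μ = conj (axis μ) := by
    conv_rhs => rw [← edge_mul_conj_axis, map_mul, conj_conj]
  have h' : m * axis μ * conj (-(I * edge μ * m)) = I * conj (axis μ) := by
    rw [map_neg, map_mul, map_mul, conj_I]
    linear_combination (I * conj (edge μ) * axis μ) * conj_mul_self_of_norm_one hm + I * h
  rw [Complex.inner, h', I_mul_re, conj_im, axis_im, neg_neg]

theorem norm_I_mul {m : ℂ} (hm : ‖m‖ = 1) : ‖I * m‖ = 1 := by simp [hm]

theorem norm_edge_mul (μ : ℝ) {m : ℂ} (hm : ‖m‖ = 1) : ‖-(I * edge μ * m)‖ = 1 := by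
  simp [hm, norm_edge]

theorem closure_lune_subset {μ : ℝ} (h1 : 1 < μ) (h2 : μ < 2) {a m : ℂ} (hm : ‖m‖ = 1) {R : ℝ}
    (hR : 0 < R) {Ω : Set ℂ}
    (hF : ∀ q ∈ frontier Ω, R < ‖q - a - R • (I * m)‖ ∧ R < ‖q - a - R • (-(I * edge μ * m))‖)
    (hx : a + (R * Real.sin (μ * Real.pi / 2)) • (m * axis μ) ∈ Ω) :
    closure (lune μ a m (1 / (2 * R))) ⊆ Ω := by
  have hS := sin_half_pos h1 h2
  have hw : ‖m * axis μ‖ = 1 := by rw [norm_mul, hm, norm_axis, one_mul]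
  have key : ∀ n : ℂ, ‖n‖ = 1 → inner ℝ n (m * axis μ) = Real.sin (μ * Real.pi / 2) →
      (∀ q ∈ frontier Ω, R < ‖q - a - R • n‖) → Metric.closedBall (a + R • n) R ⊆ Ω := by
    intro n hn hnw hq
    by_contra hc
    obtain ⟨z, hz, hz'⟩ := Set.not_subset.1 hc
    have hmem : a + (R * Real.sin (μ * Real.pi / 2)) • (m * axis μ) ∈
        Metric.closedBall (a + R • n) R := by
      rw [mem_closedBall_iff_norm, add_sub_add_left_eq_sub, norm_sub_smul_le_iff hn hR,
        real_inner_smul_right, hnw, norm_smul, hw, Real.norm_eq_abs, mul_one, sq_abs]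
      field_simp
      norm_num
    obtain ⟨q, hq1, hq2⟩ := inter_frontier_nonempty
      (convex_closedBall (a + R • n) R).isPreconnected ⟨_, hmem, hx⟩ ⟨z, hz, hz'⟩
    have := hq q hq2
    rw [mem_closedBall_iff_norm, ← sub_sub] at hq1
    linarith
  have hsub : lune μ a m (1 / (2 * R)) ⊆
      Metric.closedBall (a + R • (I * m)) R ∪ Metric.closedBall (a + R • (-(I * edge μ * m))) R := by
    intro z hz
    rcases (mem_lune_iff h1 h2 hm _ z).1 hz with h | h
    · left
      rw [mem_closedBall_iff_norm, ← sub_sub, norm_sub_smul_le_iff (norm_I_mul hm) hR]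
      exact h.le
    · right
      rw [mem_closedBall_iff_norm, ← sub_sub, norm_sub_smul_le_iff (norm_edge_mul μ hm) hR]
      exact h.le
  refine (closure_minimal hsub (Metric.isClosed_closedBall.union Metric.isClosed_closedBall)).trans
    (Set.union_subset ?_ ?_)
  · exact key _ (norm_I_mul hm) (inner_I_mul_axis μ hm) fun q hq => (hF q hq).1
  · exact key _ (norm_edge_mul μ hm) (inner_edge_mul_axis μ hm) fun q hq => (hF q hq).2

theorem closure_subset_lune {μ : ℝ} (h1 : 1 < μ) (h2 : μ < 2) {a m : ℂ} (hm : ‖m‖ = 1) {R : ℝ}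
    (hR : 0 < R) {Ω : Set ℂ}
    (hF : ∀ q ∈ frontier Ω, R < ‖q - a - R • (-(I * m))‖ ∨
      R < ‖q - a - R • (-(-(I * edge μ * m)))‖)
    (hx : a - (R * Real.sin (μ * Real.pi / 2)) • (m * axis μ) ∉ Ω) :
    closure Ω ⊆ lune μ a m (-(1 / (2 * R))) := by
  have hS := sin_half_pos h1 h2
  have hw : ‖m * axis μ‖ = 1 := by rw [norm_mul, hm, norm_axis, one_mul]
  set E := Metric.closedBall (a + R • (-(I * m))) R ∩
    Metric.closedBall (a + R • (-(-(I * edge μ * m)))) R with hE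
  have hEc : Convex ℝ E := (convex_closedBall _ _).inter (convex_closedBall _ _)
  have hmemE : a - (R * Real.sin (μ * Real.pi / 2)) • (m * axis μ) ∈ E := by
    have key : ∀ n : ℂ, ‖n‖ = 1 → inner ℝ n (m * axis μ) = Real.sin (μ * Real.pi / 2) →
        a - (R * Real.sin (μ * Real.pi / 2)) • (m * axis μ) ∈ Metric.closedBall (a + R • (-n)) R := by
      intro n hn hnw
      rw [mem_closedBall_iff_norm, ← sub_sub, norm_sub_smul_le_iff (by rwa [norm_neg]) hR,
        sub_sub_cancel_left, inner_neg_neg, norm_neg,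
        real_inner_smul_right, hnw, norm_smul, hw, Real.norm_eq_abs, mul_one, sq_abs]
      field_simp
      norm_num
    exact ⟨key _ (norm_I_mul hm) (inner_I_mul_axis μ hm),
      key _ (norm_edge_mul μ hm) (inner_edge_mul_axis μ hm)⟩
  have hEF : ∀ q ∈ frontier Ω, q ∉ E := by
    rintro q hq ⟨hq1, hq2⟩
    rw [mem_closedBall_iff_norm, ← sub_sub] at hq1 hq2
    rcases hF q hq with h | h <;> linarith
  have hEΩ : ∀ z ∈ Ω, z ∉ E := by
    intro z hz hzE
    obtain ⟨q, hq1, hq2⟩ := inter_frontier_nonempty hEc.isPreconnected ⟨z, hzE, hz⟩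
      ⟨_, hmemE, hx⟩
    exact hEF q hq2 hq1
  intro z hz
  have hzE : z ∉ E := by
    by_cases hzi : z ∈ Ω
    · exact hEΩ z hzi
    · exact hEF z ⟨hz, fun h => hzi (interior_subset h)⟩
  by_contra hc
  rw [mem_lune_iff h1 h2 hm] at hc
  push Not at hc
  refine hzE ⟨?_, ?_⟩
  · rw [mem_closedBall_iff_norm, ← sub_sub, norm_sub_smul_le_iff (by rw [norm_neg, norm_I_mul hm]) hR,
      inner_neg_left]
    linarith [hc.1]
  · rw [mem_closedBall_iff_norm, ← sub_sub,
      norm_sub_smul_le_iff (by rw [norm_neg, norm_edge_mul μ hm]) hR, inner_neg_left]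
    linarith [hc.2]

section

/-- A curve `γ` with unit velocity `g`, issuing from the origin in direction `e`, quantitatively
`C²` on `[0, T]` and bounded away from the origin on `[T, b]`. -/
structure Arc (γ g : ℝ → ℂ) (e : ℂ) (b K T η : ℝ) : Prop where
  T_pos : 0 < T
  T_le : T ≤ b
  K_pos : 0 < K
  η_pos : 0 < η
  KT : K * T ≤ 1 / 4
  zero : γ 0 = 0
  g_zero : g 0 = e
  norm_g : ∀ t ∈ Set.Icc 0 T, ‖g t‖ = 1
  deriv : ∀ t, HasDerivAt γ (g t) t
  lip : ∀ t ∈ Set.Icc 0 T, ∀ t' ∈ Set.Icc 0 T, ‖g t' - g t‖ ≤ K * |t' - t|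
  taylor : ∀ t ∈ Set.Icc 0 T, ∀ t' ∈ Set.Icc 0 T, ‖γ t' - γ t - (t' - t) • g t‖ ≤ K * (t' - t) ^ 2
  far : ∀ t ∈ Set.Icc T b, η ≤ ‖γ t‖

/-- The geometry of a domain near a corner of opening `μπ` at the origin. -/
structure Geo (Ω : Set ℂ) (μ : ℝ) (γ₁ g₁ γ₂ g₂ : ℝ → ℂ) (b₁ b₂ K T η r₀ κ : ℝ) : Prop where
  one_lt : 1 < μ
  lt_two : μ < 2
  arc₁ : Arc γ₁ g₁ 1 b₁ K T η
  arc₂ : Arc γ₂ g₂ (edge μ) b₂ K T η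
  KT₁ : K * T ≤ Real.sin (μ * Real.pi / 2) / 4
  KT₂ : K * T ≤ -Real.sin (μ * Real.pi) / 8
  isOpen : IsOpen Ω
  zero_mem : (0 : ℂ) ∈ frontier Ω
  r₀_pos : 0 < r₀
  κ_pos : 0 < κ
  κ_lt : κ < 1
  frontier_subset : ∀ q ∈ frontier Ω, ‖q‖ < r₀ →
    q ∈ γ₁ '' Set.Icc 0 b₁ ∪ γ₂ '' Set.Icc 0 b₂
  inner_mem : ∀ z : ℂ, ‖z‖ < r₀ → 0 < inner ℝ (axis μ) z → z ∈ Ω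
  inner_gt : ∀ z ∈ Ω, ‖z‖ < r₀ → -(κ * ‖z‖) < inner ℝ (axis μ) z
  abs_arg_lt : ∀ z ∈ Ω, ‖z‖ < r₀ →
    |arg (conj (axis μ) * z)| < μ * Real.pi / 2 + Real.pi / 4

theorem neg_sin_pos {μ : ℝ} (h1 : 1 < μ) (h2 : μ < 2) : 0 < -Real.sin (μ * Real.pi) := by
  have hpi := Real.pi_pos
  have := Real.sin_pos_of_pos_of_lt_pi (x := μ * Real.pi - Real.pi) (by nlinarith) (by nlinarith)
  rwa [Real.sin_sub_pi] at this

variable {γ g : ℝ → ℂ} {e : ℂ} {b K T η : ℝ}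

theorem Arc.norm_sub_smul_le (h : Arc γ g e b K T η) {t : ℝ} (ht : t ∈ Set.Icc 0 T) :
    ‖γ t - t • e‖ ≤ K * t ^ 2 := by
  have := h.taylor 0 ⟨le_rfl, h.T_pos.le⟩ t ht
  simpa [h.zero, h.g_zero] using this

theorem Arc.norm_sub_smul_le' (h : Arc γ g e b K T η) {t : ℝ} (ht : t ∈ Set.Icc 0 T) :
    ‖γ t - t • g t‖ ≤ K * t ^ 2 := by
  have := h.taylor t ht 0 ⟨le_rfl, h.T_pos.le⟩
  rw [← norm_neg, show -(γ t - t • g t) = γ 0 - γ t - (0 - t) • g t by rw [h.zero]; module]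
  exact this.trans (by rw [zero_sub, neg_sq])

theorem Arc.norm_g_sub_le (h : Arc γ g e b K T η) {t : ℝ} (ht : t ∈ Set.Icc 0 T) :
    ‖g t - e‖ ≤ K * t := by
  have := h.lip 0 ⟨le_rfl, h.T_pos.le⟩ t ht
  rwa [h.g_zero, sub_zero, abs_of_nonneg ht.1] at this

theorem Arc.le_norm_sub (h : Arc γ g e b K T η) {t t' : ℝ} (ht : t ∈ Set.Icc 0 T)
    (ht' : t' ∈ Set.Icc 0 T) : |t' - t| / 2 ≤ ‖γ t' - γ t‖ := by
  have h1 := h.taylor t ht t' ht'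
  have h2 : ‖(t' - t) • g t‖ = |t' - t| := by rw [norm_smul, h.norm_g t ht, mul_one]; rfl
  have h3 : ‖(t' - t) • g t‖ ≤ ‖γ t' - γ t - (t' - t) • g t‖ + ‖γ t' - γ t‖ := by
    have := norm_sub_le (γ t' - γ t) (γ t' - γ t - (t' - t) • g t)
    rw [sub_sub_cancel] at this
    linarith
  have h4 : |t' - t| ≤ T := abs_le.2 ⟨by linarith [ht.2, ht'.1], by linarith [ht.1, ht'.2]⟩
  have h5 : K * (t' - t) ^ 2 ≤ 1 / 4 * |t' - t| := by
    rw [← sq_abs, pow_two, ← mul_assoc]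
    refine mul_le_mul_of_nonneg_right ?_ (abs_nonneg _)
    exact (mul_le_mul_of_nonneg_left h4 h.K_pos.le).trans h.KT
  have := abs_nonneg (t' - t)
  linarith

theorem inner_I_mul_self (m : ℂ) (c : ℝ) : inner ℝ (I * m) (c • m) = 0 := by
  rw [Complex.inner]
  simp
  ring

/-- A disc of small radius touching the arc lies on one side of it. -/
theorem Arc.inner_le (h : Arc γ g e b K T η) {R : ℝ} (hR : 0 < R) (hKR : 16 * K * R ≤ 1)
    {t t' : ℝ} (ht : t ∈ Set.Icc 0 T) (ht' : t' ∈ Set.Icc 0 T) {s : ℝ} (hs : |s| = 1) :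
    inner ℝ (s • (I * g t)) (γ t' - γ t) ≤ ‖γ t' - γ t‖ ^ 2 / (4 * R) := by
  have h1 := h.taylor t ht t' ht'
  have h2 : inner ℝ (s • (I * g t)) (γ t' - γ t) =
      inner ℝ (s • (I * g t)) (γ t' - γ t - (t' - t) • g t) := by
    rw [inner_sub_right _ _ ((t' - t) • g t), real_inner_smul_left _ ((t' - t) • g t),
      inner_I_mul_self, mul_zero, sub_zero]
  have h3 := real_inner_le_norm (s • (I * g t)) (γ t' - γ t - (t' - t) • g t)
  rw [norm_smul, norm_I_mul (h.norm_g t ht), mul_one, Real.norm_eq_abs, hs, one_mul] at h3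
  have h4 := h.le_norm_sub ht ht'
  have h5 : (t' - t) ^ 2 ≤ 4 * ‖γ t' - γ t‖ ^ 2 := by
    rw [← sq_abs]; nlinarith [abs_nonneg (t' - t)]
  rw [h2, le_div_iff₀ (by positivity)]
  have h6 : inner ℝ (s • (I * g t)) (γ t' - γ t - (t' - t) • g t) ≤
      K * (4 * ‖γ t' - γ t‖ ^ 2) :=
    (h3.trans h1).trans (mul_le_mul_of_nonneg_left h5 h.K_pos.le)
  calc _ ≤ K * (4 * ‖γ t' - γ t‖ ^ 2) * (4 * R) := by gcongr
    _ = 16 * K * R * ‖γ t' - γ t‖ ^ 2 := by ring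
    _ ≤ _ := mul_le_of_le_one_left (by positivity) hKR

theorem Arc.exists_frame (h : Arc γ g 1 b K T η) {R : ℝ} (hR : 0 < R) {Λ : ℝ} (hΛ : 0 ≤ Λ)
    {t : ℝ} (ht : t ∈ Set.Icc 0 T) (hΛt : Λ * t ≤ 1) (htR : 2 * t ≤ R) {s : ℝ} (hs : s = 1 ∨ s = -1) :
    ∃ a m : ℂ, ‖m‖ = 1 ∧ a + (s * R) • (I * m) = γ t + (s * R) • (I * g t) ∧
      ‖a + (s * Λ * t ^ 2 : ℝ)‖ ≤ (2 * K + 4 / R) * t ^ 2 ∧ ‖m - 1‖ ≤ (2 * K + 4 / R) * t ∧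
      ‖m - g t‖ ≤ 2 / R * t := by
  obtain ⟨ht0, htT⟩ := ht
  have hK := h.K_pos
  have hs1 : |s| = 1 := by rcases hs with rfl | rfl <;> simp
  have hss : s * s = 1 := by rcases hs with rfl | rfl <;> simp
  set ψ : ℝ := (s * t + Λ * t ^ 2) / R with hψ
  have hψb : |ψ| ≤ 2 / R * t := by
    rw [hψ, abs_div, abs_of_pos hR, div_mul_eq_mul_div]
    gcongr
    calc |s * t + Λ * t ^ 2| ≤ |s * t| + |Λ * t ^ 2| := abs_add_le _ _
      _ = t + Λ * t * t := by
        rw [abs_mul, hs1, abs_of_nonneg ht0, abs_of_nonneg (by positivity)]; ring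
      _ ≤ 2 * t := by nlinarith
  have hψ1 : |ψ| ≤ 1 := hψb.trans (by rw [div_mul_eq_mul_div, div_le_one hR]; exact htR)
  set x : ℂ := ((-ψ : ℝ) : ℂ) * I with hx
  have hxn : ‖x‖ = |ψ| := by rw [hx, norm_mul, norm_I, mul_one, norm_real, Real.norm_eq_abs, abs_neg]
  have hr1 : ‖exp x‖ = 1 := norm_exp_ofReal_mul_I _
  have hr2 : ‖exp x - 1‖ ≤ |ψ| := by
    have := Real.norm_exp_I_mul_ofReal_sub_one_le (x := -ψ)
    rw [hx, mul_comm]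
    simpa using this
  have hr3 : ‖exp x - 1 - x‖ ≤ ψ ^ 2 := by
    have := norm_exp_sub_one_sub_id_le (x := x) (by rw [hxn]; exact hψ1)
    rwa [hxn, sq_abs] at this
  have hg := h.norm_g t ⟨ht0, htT⟩
  have hg1 := h.norm_g_sub_le ⟨ht0, htT⟩
  have hmg : ‖g t * exp x - g t‖ ≤ 2 / R * t := by
    rw [← mul_sub_one, norm_mul, hg, one_mul]
    exact hr2.trans hψb
  refine ⟨γ t + (s * R) • (I * (g t - g t * exp x)), g t * exp x, ?_, ?_, ?_, ?_, hmg⟩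
  · rw [norm_mul, hg, hr1, one_mul]
  · simp only [mul_sub, smul_sub]
    abel
  · have e1 : γ t + (s * R) • (I * (g t - g t * exp x)) + (s * Λ * t ^ 2 : ℝ) =
        (γ t - t • g t) - ((s * Λ * t ^ 2 : ℝ) : ℂ) * (g t - 1) -
          ((s * R : ℝ) : ℂ) * (I * g t * (exp x - 1 - x)) := by
      have e2 : (s * R : ℝ) * ψ = t + s * Λ * t ^ 2 := by
        rw [hψ]; field_simp; linear_combination t * hss
      have e3 : ((s * R : ℝ) : ℂ) * (ψ : ℝ) = (t + s * Λ * t ^ 2 : ℝ) := by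
        rw [← ofReal_mul, e2]
      rw [real_smul, real_smul, hx]
      push_cast at e3 ⊢
      linear_combination -g t * e3 + (s : ℂ) * R * g t * ψ * I_sq
    have e4 : ‖((s * Λ * t ^ 2 : ℝ) : ℂ) * (g t - 1)‖ ≤ K * t ^ 2 := by
      rw [norm_mul, norm_real, Real.norm_eq_abs, abs_mul, abs_mul, hs1, abs_of_nonneg hΛ,
        abs_of_nonneg (by positivity : (0 : ℝ) ≤ t ^ 2)]
      calc 1 * Λ * t ^ 2 * ‖g t - 1‖ ≤ 1 * Λ * t ^ 2 * (K * t) := by gcongr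
        _ = (Λ * t) * (K * t ^ 2) := by ring
        _ ≤ 1 * (K * t ^ 2) := by gcongr
        _ = _ := one_mul _
    have e5 : ‖((s * R : ℝ) : ℂ) * (I * g t * (exp x - 1 - x))‖ ≤ 4 / R * t ^ 2 := by
      rw [norm_mul, norm_mul, norm_I_mul hg, one_mul, norm_real, Real.norm_eq_abs, abs_mul, hs1,
        one_mul, abs_of_pos hR]
      calc R * ‖exp x - 1 - x‖ ≤ R * ψ ^ 2 := by gcongr
        _ ≤ R * (2 / R * t) ^ 2 := by rw [← sq_abs ψ]; gcongr
        _ = 4 / R * t ^ 2 := by field_simp; ring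
    rw [e1]
    calc _ ≤ _ := norm_sub_le _ _
      _ ≤ _ + _ := add_le_add_left (norm_sub_le _ _) _
      _ ≤ (K * t ^ 2 + K * t ^ 2) + 4 / R * t ^ 2 :=
        add_le_add (add_le_add (h.norm_sub_smul_le' ⟨ht0, htT⟩) e4) e5
      _ = _ := by ring
  · calc ‖g t * exp x - 1‖ = ‖(g t * exp x - g t) + (g t - 1)‖ := by rw [sub_add_sub_cancel]
      _ ≤ 2 / R * t + K * t := (norm_add_le _ _).trans (add_le_add hmg hg1)
      _ ≤ _ := by
        have : 0 ≤ 2 / R * t := by positivity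
        have : 0 ≤ K * t := by positivity
        have : (2 * K + 4 / R) * t = 2 * (2 / R * t + K * t) := by ring
        linarith

end

section

variable {γ g : ℝ → ℂ} {b K T η : ℝ}

theorem Arc.half_le_norm {e : ℂ} (h : Arc γ g e b K T η) {t : ℝ} (ht : t ∈ Set.Icc 0 T) :
    t / 2 ≤ ‖γ t‖ := by
  have := h.le_norm_sub ⟨le_rfl, h.T_pos.le⟩ ht
  rwa [h.zero, sub_zero, sub_zero, abs_of_nonneg ht.1] at this

theorem Arc.norm_le {e : ℂ} (h : Arc γ g e b K T η) {t : ℝ} (ht : t ∈ Set.Icc 0 T) :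
    ‖γ t‖ ≤ 2 * t := by
  have h1 := h.norm_sub_smul_le' ht
  have h2 : ‖t • g t‖ = t := by
    rw [norm_smul, h.norm_g t ht, mul_one, Real.norm_eq_abs, abs_of_nonneg ht.1]
  have h3 := norm_add_le (γ t - t • g t) (t • g t)
  rw [sub_add_cancel, h2] at h3
  have h4 : K * t ^ 2 ≤ 1 / 4 * t := by
    rw [pow_two, ← mul_assoc]
    exact mul_le_mul_of_nonneg_right
      ((mul_le_mul_of_nonneg_left ht.2 h.K_pos.le).trans h.KT) ht.1
  linarith [ht.1]

theorem inner_edge_normal (μ : ℝ) (c : ℝ) : inner ℝ (-(I * edge μ * 1)) (c : ℂ) =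
    c * Real.sin (μ * Real.pi) := by
  rw [Complex.inner, ← edge_im]
  simp

theorem inner_edge_normal_edge (μ : ℝ) (c : ℝ) :
    inner ℝ (-(I * edge μ * 1)) (c • edge μ) = 0 := by
  rw [Complex.inner]
  simp
  ring

theorem inner_I_edge (μ c : ℝ) : inner ℝ I (c • edge μ) = c * Real.sin (μ * Real.pi) := by
  rw [Complex.inner, ← edge_im]
  simp

theorem inner_le_abs_of_norm_le {n y : ℂ} (hn : ‖n‖ = 1) {B : ℝ} (hy : ‖y‖ ≤ B) :
    inner ℝ n y ≤ B := by
  have := real_inner_le_norm n y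
  rw [hn, one_mul] at this
  exact this.trans hy

/-- Comparison of the second edge of a tilted lune with that of the model cone. -/
theorem inner_edge_tilt_le {μ : ℝ} {a m q : ℂ} {s : ℝ}
    (hs : s = 1 ∨ s = -1) {Λ B t R : ℝ} (hR : 0 < R)
    (ha : ‖a + (s * Λ * t ^ 2 : ℝ)‖ ≤ B * t ^ 2) (hm1 : ‖m - 1‖ ≤ B * t) :
    inner ℝ (s • (-(I * edge μ * m))) (q - a) ≤ inner ℝ (s • (-(I * edge μ * 1))) q +
      (B + 2 * R * B ^ 2 + Λ * Real.sin (μ * Real.pi)) * t ^ 2 + ‖q - a‖ ^ 2 / (8 * R) := by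
  have hs1 : |s| = 1 := by rcases hs with rfl | rfl <;> simp
  have hss : s * s = 1 := by rcases hs with rfl | rfl <;> simp
  have hn0 : ‖-(s • (-(I * edge μ * 1)))‖ = 1 := by
    rw [norm_neg, norm_smul, Real.norm_eq_abs, hs1, one_mul, norm_edge_mul μ (by simp)]
  have e1 : inner ℝ (s • (-(I * edge μ * m))) (q - a) = inner ℝ (s • (-(I * edge μ * 1))) q +
      inner ℝ (-(s • (-(I * edge μ * 1)))) (a + (s * Λ * t ^ 2 : ℝ)) +
      Λ * Real.sin (μ * Real.pi) * t ^ 2 +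
      inner ℝ (s • (-(I * edge μ * (m - 1)))) (q - a) := by
    have e2 : s • (-(I * edge μ * m)) = s • (-(I * edge μ * 1)) + s • (-(I * edge μ * (m - 1))) := by
      rw [← smul_add]; congr 1; ring
    rw [e2, inner_add_left, inner_sub_right _ q a, inner_neg_left, inner_add_right _ a,
      real_inner_smul_left _ (((s * Λ * t ^ 2 : ℝ) : ℂ)), inner_edge_normal]
    linear_combination (Λ * t ^ 2 * Real.sin (μ * Real.pi)) * hss
  have e3 := inner_le_abs_of_norm_le hn0 ha
  have e4 : inner ℝ (s • (-(I * edge μ * (m - 1)))) (q - a) ≤ B * t * ‖q - a‖ := by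
    refine (real_inner_le_norm _ _).trans (mul_le_mul_of_nonneg_right ?_ (norm_nonneg _))
    rwa [norm_smul, Real.norm_eq_abs, hs1, one_mul, norm_neg, norm_mul, norm_mul, norm_I,
      norm_edge, one_mul, one_mul]
  have e5 : B * t * ‖q - a‖ ≤ ‖q - a‖ ^ 2 / (8 * R) + 2 * R * B ^ 2 * t ^ 2 := by
    rw [← sub_nonneg]
    have : ‖q - a‖ ^ 2 / (8 * R) + 2 * R * B ^ 2 * t ^ 2 - B * t * ‖q - a‖ =
        (‖q - a‖ - 4 * R * B * t) ^ 2 / (8 * R) := by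
      field_simp; ring
    rw [this]; positivity
  rw [e1]
  nlinarith

theorem Arc.inner_edge_le {μ : ℝ} (h : Arc γ g (edge μ) b K T η)
    {a m : ℂ} {s : ℝ} (hs : s = 1 ∨ s = -1) {Λ B t R : ℝ} (hR : 0 < R)
    (hKR : 64 * K * R ≤ 1) (hΛ : 0 ≤ Λ) (ht : 0 ≤ t) (hΛt : (Λ + B) * t ≤ 1)
    (ha : ‖a + (s * Λ * t ^ 2 : ℝ)‖ ≤ B * t ^ 2) (hm1 : ‖m - 1‖ ≤ B * t)
    (hΛB : B + 2 * R * B ^ 2 + 1 / (8 * R) ≤ Λ * (-Real.sin (μ * Real.pi)))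
    {t' : ℝ} (ht' : t' ∈ Set.Icc 0 T) :
    inner ℝ (s • (-(I * edge μ * m))) (γ t' - a) ≤ ‖γ t' - a‖ ^ 2 / (4 * R) := by
  have hs1 : |s| = 1 := by rcases hs with rfl | rfl <;> simp
  have hK := h.K_pos
  have key := inner_edge_tilt_le (μ := μ) (q := γ t') hs hR ha hm1
  have hn0 : ‖s • (-(I * edge μ * 1))‖ = 1 := by
    rw [norm_smul, Real.norm_eq_abs, hs1, one_mul, norm_edge_mul μ (by simp)]
  have e1 : inner ℝ (s • (-(I * edge μ * 1))) (γ t') ≤ K * t' ^ 2 := by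
    have := inner_le_abs_of_norm_le hn0 (h.norm_sub_smul_le ht')
    rwa [inner_sub_right, real_inner_smul_left _ (t' • edge μ), inner_edge_normal_edge, mul_zero,
      sub_zero] at this
  have han : ‖a‖ ≤ t := by
    have e2 := norm_sub_le (a + (s * Λ * t ^ 2 : ℝ)) ((s * Λ * t ^ 2 : ℝ) : ℂ)
    rw [add_sub_cancel_right, norm_real, Real.norm_eq_abs, abs_mul, abs_mul, hs1,
      abs_of_nonneg hΛ, abs_of_nonneg (by positivity : (0 : ℝ) ≤ t ^ 2)] at e2
    nlinarith
  have e3 := h.half_le_norm ht'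
  have e4 : ‖γ t'‖ ≤ ‖γ t' - a‖ + ‖a‖ := by
    simpa using norm_add_le (γ t' - a) a
  have e5 : t' ^ 2 ≤ 8 * ‖γ t' - a‖ ^ 2 + 8 * t ^ 2 := by
    have : t' ≤ 2 * (‖γ t' - a‖ + t) := by linarith
    have h3 : t' ^ 2 ≤ (2 * (‖γ t' - a‖ + t)) ^ 2 := pow_le_pow_left₀ ht'.1 this 2
    nlinarith [sq_nonneg (‖γ t' - a‖ - t)]
  have e6 : K * t' ^ 2 ≤ (‖γ t' - a‖ ^ 2 + t ^ 2) / (8 * R) := by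
    rw [le_div_iff₀ (by positivity)]
    calc K * t' ^ 2 * (8 * R) ≤ K * (8 * ‖γ t' - a‖ ^ 2 + 8 * t ^ 2) * (8 * R) := by gcongr
      _ = 64 * K * R * (‖γ t' - a‖ ^ 2 + t ^ 2) := by ring
      _ ≤ _ := mul_le_of_le_one_left (by positivity) hKR
  have e7 : (B + 2 * R * B ^ 2 + 1 / (8 * R)) * t ^ 2 ≤ Λ * (-Real.sin (μ * Real.pi)) * t ^ 2 := by
    gcongr
  have e8 : (‖γ t' - a‖ ^ 2 + t ^ 2) / (8 * R) + ‖γ t' - a‖ ^ 2 / (8 * R) =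
      ‖γ t' - a‖ ^ 2 / (4 * R) + 1 / (8 * R) * t ^ 2 := by
    field_simp; ring
  nlinarith

theorem Arc.inner_edge_le_of_one {μ : ℝ} (h1 : 1 < μ) (h2 : μ < 2) (h : Arc γ g 1 b K T η)
    (hKT : K * T ≤ -Real.sin (μ * Real.pi) / 8)
    {a m : ℂ} {Λ B t R : ℝ} (hR : 0 < R)
    (ha : ‖a + (1 * Λ * t ^ 2 : ℝ)‖ ≤ B * t ^ 2) (hm1 : ‖m - 1‖ ≤ B * t)
    (hΛB : B + 2 * R * B ^ 2 + 1 / (8 * R) ≤ Λ * (-Real.sin (μ * Real.pi)))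
    {t' : ℝ} (ht' : t' ∈ Set.Icc 0 T) :
    inner ℝ ((1 : ℝ) • (-(I * edge μ * m))) (γ t' - a) ≤ ‖γ t' - a‖ ^ 2 / (4 * R) := by
  have hS := neg_sin_pos h1 h2
  have key := inner_edge_tilt_le (μ := μ) (q := γ t') (Or.inl rfl) hR ha hm1
  have e1 : inner ℝ ((1 : ℝ) • (-(I * edge μ * 1))) (γ t') ≤ 0 := by
    have := inner_le_abs_of_norm_le (norm_edge_mul μ (m := 1) (by simp)) (h.norm_sub_smul_le ht')
    rw [inner_sub_right, show t' • (1 : ℂ) = ((t' : ℝ) : ℂ) by simp, inner_edge_normal] at this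
    rw [one_smul]
    have h3 : K * t' ^ 2 ≤ -Real.sin (μ * Real.pi) / 8 * t' := by
      rw [pow_two, ← mul_assoc]
      exact mul_le_mul_of_nonneg_right
        ((mul_le_mul_of_nonneg_left ht'.2 h.K_pos.le).trans hKT) ht'.1
    nlinarith [ht'.1]
  have e7 : (B + 2 * R * B ^ 2 + 1 / (8 * R)) * t ^ 2 ≤ Λ * (-Real.sin (μ * Real.pi)) * t ^ 2 := by
    gcongr
  have e8 : ‖γ t' - a‖ ^ 2 / (8 * R) ≤ ‖γ t' - a‖ ^ 2 / (4 * R) := by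
    gcongr; norm_num
  have e9 : 0 ≤ 1 / (8 * R) * t ^ 2 := by positivity
  nlinarith

/-- A small disc touching the first arc from the inside of the corner avoids the second arc. -/
theorem inner_normal_le_of_edge {μ : ℝ} (h1 : 1 < μ) (h2 : μ < 2) {γ₁ g₁ γ₂ g₂ : ℝ → ℂ} {b₁ b₂ : ℝ}
    (h₁ : Arc γ₁ g₁ 1 b₁ K T η) (h₂ : Arc γ₂ g₂ (edge μ) b₂ K T η)
    (hKT₁ : K * T ≤ Real.sin (μ * Real.pi / 2) / 4)
    (hKT₂ : K * T ≤ -Real.sin (μ * Real.pi) / 8) {R : ℝ} (hR : 0 < R)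
    (hKR : 16 * K * R ≤ Real.sin (μ * Real.pi / 2) ^ 2)
    {t t' : ℝ} (ht : t ∈ Set.Icc 0 T) (ht' : t' ∈ Set.Icc 0 T) :
    inner ℝ (I * g₁ t) (γ₂ t' - γ₁ t) ≤ ‖γ₂ t' - γ₁ t‖ ^ 2 / (4 * R) := by
  have hS := sin_half_pos h1 h2
  have hS2 := neg_sin_pos h1 h2
  have hK := h₁.K_pos
  have mulT : ∀ {x c : ℝ}, x ∈ Set.Icc 0 T → K * T ≤ c → K * x ≤ c := fun hx hc =>
    (mul_le_mul_of_nonneg_left hx.2 hK.le).trans hc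
  have hn := norm_I_mul (h₁.norm_g t ht)
  have e1 : inner ℝ (I * g₁ t) (γ₂ t') ≤ 0 := by
    have a1 : inner ℝ (I * g₁ t) (γ₂ t') = inner ℝ (I * (g₁ t - 1)) (γ₂ t') +
        inner ℝ I (γ₂ t' - t' • edge μ) + t' * Real.sin (μ * Real.pi) := by
      rw [← inner_I_edge, inner_sub_right, add_assoc, sub_add_cancel, ← inner_add_left]
      congr 1; ring
    have a2 : inner ℝ (I * (g₁ t - 1)) (γ₂ t') ≤ K * t * (2 * t') := by
      refine (real_inner_le_norm _ _).trans (mul_le_mul ?_ (h₂.norm_le ht') (norm_nonneg _)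
        (mul_nonneg hK.le ht.1))
      rw [norm_mul, norm_I, one_mul]; exact h₁.norm_g_sub_le ht
    have a3 := inner_le_abs_of_norm_le norm_I (h₂.norm_sub_smul_le ht')
    have a4 : K * t * (2 * t') ≤ -Real.sin (μ * Real.pi) / 8 * (2 * t') :=
      mul_le_mul_of_nonneg_right (mulT ht hKT₂) (by linarith [ht'.1])
    have a5 : K * t' * t' ≤ -Real.sin (μ * Real.pi) / 8 * t' :=
      mul_le_mul_of_nonneg_right (mulT ht' hKT₂) ht'.1
    rw [a1]
    nlinarith [ht'.1]
  have e2 : -inner ℝ (I * g₁ t) (γ₁ t) ≤ K * t ^ 2 := by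
    have := inner_le_abs_of_norm_le (n := -(I * g₁ t)) (by rwa [norm_neg]) (h₁.norm_sub_smul_le' ht)
    rwa [inner_neg_left, inner_sub_right, inner_I_mul_self, sub_zero] at this
  have e3 : Real.sin (μ * Real.pi / 2) / 2 * t ≤ ‖γ₂ t' - γ₁ t‖ := by
    have a1 : (t + t') * Real.sin (μ * Real.pi / 2) =
        inner ℝ (I * axis μ) (t' • edge μ - t • (1 : ℂ)) := by
      have : (t' • edge μ - t • (1 : ℂ)) * conj (I * axis μ) =
          (-t' : ℝ) * (I * axis μ) + (t : ℝ) * (I * conj (axis μ)) := by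
        rw [map_mul, conj_I, real_smul, real_smul, ofReal_neg]
        linear_combination (-t' * I) * edge_mul_conj_axis μ
      rw [Complex.inner, this, add_re, re_ofReal_mul, re_ofReal_mul, I_mul_re, I_mul_re, conj_im,
        axis_im]
      ring
    have a2 : t' • edge μ - t • (1 : ℂ) = (γ₂ t' - γ₁ t) - (γ₂ t' - t' • edge μ) +
        (γ₁ t - t • (1 : ℂ)) := by abel
    have a3 : ‖t' • edge μ - t • (1 : ℂ)‖ ≤ ‖γ₂ t' - γ₁ t‖ + K * t' ^ 2 + K * t ^ 2 := by
      rw [a2]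
      calc _ ≤ ‖(γ₂ t' - γ₁ t) - (γ₂ t' - t' • edge μ)‖ + ‖γ₁ t - t • (1 : ℂ)‖ := norm_add_le _ _
        _ ≤ (‖γ₂ t' - γ₁ t‖ + ‖γ₂ t' - t' • edge μ‖) + ‖γ₁ t - t • (1 : ℂ)‖ :=
          add_le_add_left (norm_sub_le _ _) _
        _ ≤ _ := add_le_add (add_le_add le_rfl (h₂.norm_sub_smul_le ht')) (h₁.norm_sub_smul_le ht)
    have a4 := inner_le_abs_of_norm_le (norm_I_mul (norm_axis μ)) a3
    rw [← a1] at a4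
    have a5 : K * t' * t' ≤ Real.sin (μ * Real.pi / 2) / 4 * t' :=
      mul_le_mul_of_nonneg_right (mulT ht' hKT₁) ht'.1
    have a6 : K * t * t ≤ Real.sin (μ * Real.pi / 2) / 4 * t :=
      mul_le_mul_of_nonneg_right (mulT ht hKT₁) ht.1
    have a7 := mul_nonneg hS.le ht.1
    have a8 := mul_nonneg hS.le ht'.1
    nlinarith
  have e4 : (Real.sin (μ * Real.pi / 2) / 2 * t) ^ 2 ≤ ‖γ₂ t' - γ₁ t‖ ^ 2 :=
    pow_le_pow_left₀ (mul_nonneg (by positivity) ht.1) e3 2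
  rw [le_div_iff₀ (by positivity), inner_sub_right]
  have e5 : inner ℝ (I * g₁ t) (γ₂ t') - inner ℝ (I * g₁ t) (γ₁ t) ≤ K * t ^ 2 := by linarith
  calc _ ≤ K * t ^ 2 * (4 * R) := by gcongr
    _ = 16 * K * R * (t ^ 2 / 4) := by ring
    _ ≤ Real.sin (μ * Real.pi / 2) ^ 2 * (t ^ 2 / 4) := by gcongr
    _ = (Real.sin (μ * Real.pi / 2) / 2 * t) ^ 2 := by ring
    _ ≤ _ := e4

end

section

theorem eventually_mul_le (c : ℝ) {d : ℝ} (hd : 0 < d) : ∀ᶠ t : ℝ in 𝓝 0, c * t ≤ d := by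
  have : Tendsto (fun t : ℝ => c * t) (𝓝 0) (𝓝 (c * 0)) := tendsto_id.const_mul c
  rw [mul_zero] at this
  exact this.eventually_le_const hd

theorem exists_pos_forall_mem_Icc {p : ℝ → Prop} (h : ∀ᶠ t : ℝ in 𝓝 0, p t) :
    ∃ δ > 0, ∀ t ∈ Set.Icc 0 δ, p t := by
  obtain ⟨ε, hε, h⟩ := Metric.eventually_nhds_iff.1 h
  refine ⟨ε / 2, half_pos hε, fun t ht => h ?_⟩
  rw [Real.dist_eq, sub_zero, abs_of_nonneg ht.1]
  linarith [ht.2]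

variable {Ω : Set ℂ} {μ : ℝ} {γ₁ g₁ γ₂ g₂ : ℝ → ℂ} {b₁ b₂ K T η r₀ κ : ℝ}

theorem lt_norm_sub_of_far {R S t ε : ℝ} {a w n q : ℂ} (hq : 5 * R ≤ ‖q‖) (ha : ‖a‖ ≤ t)
    (ht : 2 * t ≤ R) (hw : ‖w‖ = 1) (hn : ‖n‖ = 1) (hε : 0 < ε) (hS : S ≤ 1) (hR : 0 < R)
    (hε' : ε < R * S) : R < ‖q - (a + ε • w) - R • n‖ := by
  have h1 : ‖(a + ε • w) + R • n‖ ≤ t + ε + R := by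
    refine (norm_add₃_le).trans ?_
    rw [norm_smul, norm_smul, hw, hn, mul_one, mul_one, Real.norm_of_nonneg hε.le,
      Real.norm_of_nonneg hR.le]
    linarith
  have h2 := norm_sub_norm_le q ((a + ε • w) + R • n)
  rw [← sub_sub] at h2
  linarith [mul_le_of_le_one_right hR.le hS]

set_option maxHeartbeats 1000000 in
/-- A corner domain contains, respectively is contained in, translates of lunes osculating the
first boundary arc at a given point. -/
theorem Geo.exists_lune (G : Geo Ω μ γ₁ g₁ γ₂ g₂ b₁ b₂ K T η r₀ κ) :
    ∃ R L δ : ℝ, 0 < R ∧ 0 < L ∧ 0 < δ ∧ δ ≤ T ∧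
      ∀ t ∈ Set.Icc 0 δ, ∀ s : ℝ, s = 1 ∨ s = -1 → ∃ a m : ℂ, ‖m‖ = 1 ∧
        a + (s * R) • (I * m) = γ₁ t + (s * R) • (I * g₁ t) ∧ ‖a‖ ≤ L * t ^ 2 ∧ ‖m - 1‖ ≤ L * t ∧
        (s = 1 → ∃ ε₀ : ℝ, 0 < ε₀ ∧ ∀ ε : ℝ, 0 < ε → ε < ε₀ →
          closure (lune μ (a + ε • (m * axis μ)) m (1 / (2 * R))) ⊆ Ω) ∧
        (s = -1 → ∃ ε₀ : ℝ, 0 < ε₀ ∧ ∀ ε : ℝ, 0 < ε → ε < ε₀ →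
          closure Ω ⊆ lune μ (a + ε • (-(m * axis μ))) m (-(1 / (2 * R)))) := by
  have h1 := G.one_lt
  have h2 := G.lt_two
  have hS := sin_half_pos h1 h2
  have hS2 := neg_sin_pos h1 h2
  have hSle : Real.sin (μ * Real.pi / 2) ≤ 1 := Real.sin_le_one _
  have hK := G.arc₁.K_pos
  have hη := G.arc₁.η_pos
  have hr₀ := G.r₀_pos
  have hκ := G.κ_pos
  have hκ1 := G.κ_lt
  set S := Real.sin (μ * Real.pi / 2) with hSdef
  obtain ⟨R, hR, hR1, hR2, hR3, hR4⟩ : ∃ R : ℝ, 0 < R ∧ 64 * K * R ≤ 1 ∧ 16 * K * R ≤ S ^ 2 ∧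
      5 * R ≤ η ∧ 5 * R ≤ r₀ := by
    have hev := ((eventually_mul_le (64 * K) one_pos).and
      ((eventually_mul_le (16 * K) (pow_pos hS 2)).and
        ((eventually_mul_le 5 hη).and (eventually_mul_le 5 hr₀))))
    obtain ⟨δ, hδ, h⟩ := exists_pos_forall_mem_Icc hev
    exact ⟨δ, hδ, h δ ⟨hδ.le, le_rfl⟩⟩
  set B := 2 * K + 4 / R with hBdef
  have hB : 0 < B := by positivity
  set Λ := (B + 2 * R * B ^ 2 + 1 / (8 * R)) / (-Real.sin (μ * Real.pi)) with hΛdef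
  have hΛ : 0 < Λ := by positivity
  have hΛB : B + 2 * R * B ^ 2 + 1 / (8 * R) ≤ Λ * (-Real.sin (μ * Real.pi)) := by
    rw [hΛdef, div_mul_cancel₀ _ hS2.ne']
  have hev := ((eventually_mul_le 1 G.arc₁.T_pos).and ((eventually_mul_le (Λ + B) one_pos).and
      ((eventually_mul_le 2 hR).and ((eventually_mul_le 4 (mul_pos hR hS)).and
        ((eventually_mul_le B (d := (1 - κ) / 2) (by linarith)).and
          (eventually_mul_le 4 (d := (1 - κ) * (R * S))
            (mul_pos (by linarith) (mul_pos hR hS))))))))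
  obtain ⟨δ, hδ, hev⟩ := exists_pos_forall_mem_Icc hev
  refine ⟨R, B + Λ, δ, hR, by positivity, hδ, by linarith [(hev δ ⟨hδ.le, le_rfl⟩).1], ?_⟩
  intro t ht s hs
  obtain ⟨c1, c2, c3, c4, c5, c6⟩ := hev t ht
  rw [one_mul] at c1
  have ht0 := ht.1
  have htT : t ∈ Set.Icc 0 T := ⟨ht0, c1⟩
  have hΛt : Λ * t ≤ 1 := by linarith [mul_nonneg hB.le ht0]
  obtain ⟨a, m, hm, hc, ha, hm1, hmg⟩ := G.arc₁.exists_frame hR hΛ.le htT hΛt c3 hs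
  rw [← hBdef] at ha hm1
  have hRS := mul_pos hR hS
  have hRS1 : R * S ≤ R := mul_le_of_le_one_right hR.le hSle
  have hKR1 : 16 * K * R ≤ 1 := by linarith
  have hs1 : |s| = 1 := by rcases hs with rfl | rfl <;> simp
  have hss : s * s = 1 := by rcases hs with rfl | rfl <;> simp
  have hw : ‖m * axis μ‖ = 1 := by rw [norm_mul, hm, norm_axis, one_mul]
  have hws : ‖s • (m * axis μ)‖ = 1 := by rw [norm_smul, hw, Real.norm_eq_abs, hs1, one_mul]
  have ha2 : ‖a‖ ≤ (B + Λ) * t ^ 2 := by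
    have e2 := norm_sub_le (a + (s * Λ * t ^ 2 : ℝ)) ((s * Λ * t ^ 2 : ℝ) : ℂ)
    rw [add_sub_cancel_right, norm_real, Real.norm_eq_abs, abs_mul, abs_mul, hs1,
      abs_of_nonneg hΛ.le, abs_of_nonneg (by positivity : (0 : ℝ) ≤ t ^ 2)] at e2
    linarith
  have hat : ‖a‖ ≤ t := by linarith [mul_le_mul_of_nonneg_right c2 ht0]
  have key : ∀ n₁ w' : ℂ, inner ℝ (s • n₁) (s • w') = inner ℝ n₁ w' := by
    intro n₁ w'
    rw [real_inner_smul_left, real_inner_smul_right, ← mul_assoc, hss, one_mul]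
  have hgw : S / 2 ≤ inner ℝ (s • (I * g₁ t)) (s • (m * axis μ)) := by
    rw [key]
    have e1 : inner ℝ (I * g₁ t) (m * axis μ) = S - inner ℝ (I * (m - g₁ t)) (m * axis μ) := by
      rw [hSdef, ← inner_I_mul_axis μ hm, ← inner_sub_left]
      congr 1; ring
    have e2 := real_inner_le_norm (I * (m - g₁ t)) (m * axis μ)
    rw [norm_mul, norm_I, hw, one_mul, mul_one] at e2
    have e3 : 2 / R * t ≤ S / 2 := by
      rw [div_mul_eq_mul_div, div_le_iff₀ hR]; linarith
    rw [e1]; linarith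
  have hew : S ≤ inner ℝ (s • (-(I * edge μ * m))) (s • (m * axis μ)) := by
    rw [key, inner_edge_mul_axis μ hm]
  have hnI : ‖s • (I * m)‖ = 1 := by
    rw [norm_smul, norm_I_mul hm, Real.norm_eq_abs, hs1, one_mul]
  have hnE : ‖s • (-(I * edge μ * m))‖ = 1 := by
    rw [norm_smul, norm_edge_mul μ hm, Real.norm_eq_abs, hs1, one_mul]
  have hng : ‖s • (I * g₁ t)‖ = 1 := by
    rw [norm_smul, norm_I_mul (G.arc₁.norm_g t htT), Real.norm_eq_abs, hs1, one_mul]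
  have hD1 : ∀ (q : ℂ) (ε : ℝ), inner ℝ (s • (I * g₁ t)) (q - γ₁ t) ≤ ‖q - γ₁ t‖ ^ 2 / (4 * R) →
      0 < ε → ε < R * S → R < ‖q - (a + ε • s • (m * axis μ)) - R • (s • (I * m))‖ := by
    intro q ε hq hε hε'
    have := lt_norm_sub_of_shift hng hws hR hgw hq hε (by linarith)
    convert this using 2
    rw [smul_smul R s, smul_smul R s, mul_comm R s]
    linear_combination -hc
  have hD2 : ∀ (q : ℂ) (ε : ℝ), inner ℝ (s • (-(I * edge μ * m))) (q - a) ≤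
      ‖q - a‖ ^ 2 / (4 * R) → 0 < ε → ε < R * S →
      R < ‖q - (a + ε • s • (m * axis μ)) - R • (s • (-(I * edge μ * m)))‖ := by
    intro q ε hq hε hε'
    have := lt_norm_sub_of_shift hnE hws hR hew hq hε (by linarith)
    rwa [sub_sub q a] at this
  have hfr : ∀ q ∈ frontier Ω, 5 * R ≤ ‖q‖ ∨ (∃ t' ∈ Set.Icc 0 T, q = γ₁ t') ∨
      (∃ t' ∈ Set.Icc 0 T, q = γ₂ t') := by
    intro q hq
    by_cases hq5 : 5 * R ≤ ‖q‖
    · exact Or.inl hq5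
    rw [not_le] at hq5
    right
    rcases G.frontier_subset q hq (by linarith) with ⟨t', ht', rfl⟩ | ⟨t', ht', rfl⟩
    · refine Or.inl ⟨t', ⟨ht'.1, ?_⟩, rfl⟩
      by_contra hc
      linarith [G.arc₁.far t' ⟨(not_le.1 hc).le, ht'.2⟩]
    · refine Or.inr ⟨t', ⟨ht'.1, ?_⟩, rfl⟩
      by_contra hc
      linarith [G.arc₂.far t' ⟨(not_le.1 hc).le, ht'.2⟩]
  have hax : 1 - B * t ≤ inner ℝ (axis μ) (m * axis μ) := by
    have e1 : inner ℝ (axis μ) (m * axis μ) = 1 + inner ℝ (axis μ) ((m - 1) * axis μ) := by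
      rw [sub_mul, one_mul, inner_sub_right, real_inner_self_eq_norm_sq, norm_axis]; ring
    have e2 := real_inner_le_norm (axis μ) (-((m - 1) * axis μ))
    rw [norm_neg, norm_mul, norm_axis, one_mul, mul_one, inner_neg_right] at e2
    rw [e1]; linarith
  have hax' : (1 + κ) / 2 ≤ inner ℝ (axis μ) (m * axis μ) := by linarith
  have haa := abs_le.1 (abs_real_inner_le_norm (axis μ) a)
  rw [norm_axis, one_mul] at haa
  refine ⟨a, m, hm, hc, ha2, hm1.trans (by linarith [mul_nonneg hΛ.le ht0]), ?_, ?_⟩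
  · rintro rfl
    refine ⟨R * S, mul_pos hR hS, fun ε hε hε' => closure_lune_subset h1 h2 hm hR ?_ ?_⟩
    · simp only [one_smul] at hD1 hD2 hws
      intro q hq
      rcases hfr q hq with hq5 | ⟨t', ht', rfl⟩ | ⟨t', ht', rfl⟩
      · exact ⟨lt_norm_sub_of_far hq5 hat c3 hw (norm_I_mul hm) hε hSle hR hε',
          lt_norm_sub_of_far hq5 hat c3 hw (norm_edge_mul μ hm) hε hSle hR hε'⟩
      · refine ⟨hD1 _ ε ?_ hε hε', hD2 _ ε ?_ hε hε'⟩
        · simpa using G.arc₁.inner_le hR hKR1 htT ht' hs1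
        · simpa using G.arc₁.inner_edge_le_of_one h1 h2 G.KT₂ hR ha hm1 hΛB ht'
      · refine ⟨hD1 _ ε ?_ hε hε', hD2 _ ε ?_ hε hε'⟩
        · exact inner_normal_le_of_edge h1 h2 G.arc₁ G.arc₂ G.KT₁ G.KT₂ hR hR2 htT ht'
        · simpa using G.arc₂.inner_edge_le hs hR hR1 hΛ.le ht0 c2 ha hm1 hΛB ht'
    · rw [add_assoc, ← add_smul]
      refine G.inner_mem _ ?_ ?_
      · refine (norm_add_le _ _).trans_lt ?_
        rw [norm_smul, hw, mul_one, Real.norm_of_nonneg (by positivity)]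
        linarith
      · rw [inner_add_right, real_inner_smul_right]
        have e1 := mul_le_mul_of_nonneg_left hax' (add_pos hε hRS).le
        linarith [mul_pos hε hκ, mul_pos hRS hκ]
  · rintro rfl
    refine ⟨R * S, mul_pos hR hS, fun ε hε hε' => closure_subset_lune h1 h2 hm hR ?_ ?_⟩
    · simp only [neg_one_smul] at hD1 hD2 hws
      intro q hq
      rcases hfr q hq with hq5 | ⟨t', ht', rfl⟩ | ⟨t', ht', rfl⟩
      · exact Or.inl (lt_norm_sub_of_far hq5 hat c3 hws (by rw [norm_neg, norm_I_mul hm])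
          hε hSle hR hε')
      · refine Or.inl (hD1 _ ε ?_ hε hε')
        simpa using G.arc₁.inner_le hR hKR1 htT ht' hs1
      · refine Or.inr (hD2 _ ε ?_ hε hε')
        simpa using G.arc₂.inner_edge_le hs hR hR1 hΛ.le ht0 c2 ha hm1 hΛB ht'
    · intro hmem
      rw [smul_neg, add_sub_assoc, ← neg_add', ← add_smul] at hmem
      have hn : ‖a + -((ε + R * S) • (m * axis μ))‖ ≤ t + (ε + R * S) := by
        refine (norm_add_le _ _).trans ?_
        rw [norm_neg, norm_smul, hw, mul_one, Real.norm_of_nonneg (by positivity)]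
        linarith
      have := G.inner_gt _ hmem (by linarith)
      rw [inner_add_right, inner_neg_right, real_inner_smul_right] at this
      have e1 := mul_le_mul_of_nonneg_left hax' (add_pos hε hRS).le
      have e2 := mul_le_mul_of_nonneg_left hn hκ.le
      linarith [mul_le_mul_of_nonneg_right hκ1.le ht0, mul_le_mul_of_nonneg_left hκ1.le hε.le]

end

theorem abs_log_sub_log_le {c x y : ℝ} (hc : 0 < c) (hx : c ≤ x) (hy : c ≤ y) :
    |Real.log x - Real.log y| ≤ |x - y| / c := by
  have key : ∀ {x y : ℝ}, c ≤ x → c ≤ y → Real.log x - Real.log y ≤ |x - y| / c := by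
    intro x y hx hy
    have hx0 := hc.trans_le hx
    have hy0 := hc.trans_le hy
    rw [← Real.log_div hx0.ne' hy0.ne']
    refine (Real.log_le_sub_one_of_pos (div_pos hx0 hy0)).trans ?_
    rw [div_sub_one hy0.ne']
    calc (x - y) / y ≤ |x - y| / y := by gcongr; exact le_abs_self _
      _ ≤ |x - y| / c := by gcongr
  rw [abs_le]
  refine ⟨?_, key hx hy⟩
  have := key hy hx
  rw [abs_sub_comm] at this
  linarith

theorem abs_cot_sub_inv_le {x : ℝ} (hx : 0 < x) (hx' : x ≤ Real.pi / 2) :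
    1 / x - x ≤ Real.cos x / Real.sin x ∧ Real.cos x / Real.sin x ≤ 1 / x := by
  have hpi := Real.pi_pos
  have hs : 0 < Real.sin x := Real.sin_pos_of_pos_of_lt_pi hx (by linarith)
  have hc : 0 ≤ Real.cos x := Real.cos_nonneg_of_mem_Icc ⟨by linarith, hx'⟩
  constructor
  · rw [div_sub' hx.ne', div_le_div_iff₀ hx hs]
    rcases le_total (1 - x * x) 0 with h | h
    · nlinarith
    · have h1 := Real.one_sub_sq_div_two_le_cos (x := x)
      have h2 := Real.sin_le hx.le
      calc (1 - x * x) * Real.sin x ≤ (1 - x * x) * x := by gcongr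
        _ ≤ Real.cos x * x := by
          gcongr; nlinarith
  · rw [div_le_div_iff₀ hs hx, one_mul]
    rcases hx'.lt_or_eq with h | h
    · have := Real.lt_tan hx h
      have hc' : 0 < Real.cos x := Real.cos_pos_of_mem_Ioo ⟨by linarith, h⟩
      rw [Real.tan_eq_sin_div_cos, lt_div_iff₀ hc'] at this
      linarith
    · rw [h, Real.cos_pi_div_two]; simp

/-- The function `ω ↦ log (sin (ω / μ) / sin ω)` is Lipschitz. -/
theorem abs_log_sin_ratio_sub_le {μ : ℝ} (h1 : 1 < μ) {x y : ℝ}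
    (hx : x ∈ Set.Ioc 0 (Real.pi / 2)) (hy : y ∈ Set.Ioc 0 (Real.pi / 2)) :
    |(Real.log (Real.sin (x / μ)) - Real.log (Real.sin x)) -
      (Real.log (Real.sin (y / μ)) - Real.log (Real.sin y))| ≤ 2 * |x - y| := by
  have hpi := Real.pi_pos
  have hpi2 := Real.pi_le_four
  have hμ : 0 < μ := by linarith
  have hdiv : ∀ {t : ℝ}, t ∈ Set.Ioc 0 (Real.pi / 2) → 0 < t / μ ∧ t / μ ≤ t := fun ht =>
    ⟨div_pos ht.1 hμ, div_le_self ht.1.le h1.le⟩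
  have hd : ∀ t ∈ Set.Ioc 0 (Real.pi / 2), HasDerivWithinAt
      (fun t => Real.log (Real.sin (t / μ)) - Real.log (Real.sin t))
      (Real.cos (t / μ) * (1 / μ) / Real.sin (t / μ) - Real.cos t / Real.sin t)
      (Set.Ioc 0 (Real.pi / 2)) t := by
    intro t ht
    obtain ⟨a1, a2⟩ := hdiv ht
    have s1 : 0 < Real.sin (t / μ) :=
      Real.sin_pos_of_pos_of_lt_pi a1 (by linarith [ht.2])
    have s2 : 0 < Real.sin t := Real.sin_pos_of_pos_of_lt_pi ht.1 (by linarith [ht.2])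
    exact ((((hasDerivAt_id t).div_const μ).sin.log s1.ne').sub
      ((Real.hasDerivAt_sin t).log s2.ne')).hasDerivWithinAt
  have := (convex_Ioc 0 (Real.pi / 2)).norm_image_sub_le_of_norm_hasDerivWithin_le (C := 2) hd
    ?_ hy hx
  · exact this
  intro t ht
  obtain ⟨a1, a2⟩ := hdiv ht
  obtain ⟨c1, c2⟩ := abs_cot_sub_inv_le ht.1 ht.2
  obtain ⟨c3, c4⟩ := abs_cot_sub_inv_le a1 (a2.trans ht.2)
  have e1 : Real.cos (t / μ) * (1 / μ) / Real.sin (t / μ) =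
      1 / μ * (Real.cos (t / μ) / Real.sin (t / μ)) := by ring
  have e2 : 1 / μ * (1 / (t / μ)) = 1 / t := by field_simp
  have e3 : 1 / μ * (t / μ) ≤ t := by
    calc 1 / μ * (t / μ) ≤ 1 * t := by
          gcongr
          rw [div_le_one hμ]; exact h1.le
      _ = t := one_mul t
  have c3' := mul_le_mul_of_nonneg_left c3 (by positivity : 0 ≤ 1 / μ)
  have c4' := mul_le_mul_of_nonneg_left c4 (by positivity : 0 ≤ 1 / μ)
  rw [mul_sub, e2] at c3'
  rw [e2] at c4'
  rw [Real.norm_eq_abs, e1, abs_le]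
  have := ht.1
  have := ht.2
  constructor <;> linarith

theorem abs_arcsin_sub_arcsin_le {x y : ℝ} (hx : x ∈ Set.Icc (0 : ℝ) (9 / 10))
    (hy : y ∈ Set.Icc (0 : ℝ) (9 / 10)) : |Real.arcsin x - Real.arcsin y| ≤ 3 * |x - y| := by
  have := (convex_Icc (0 : ℝ) (9 / 10)).norm_image_sub_le_of_norm_hasDerivWithin_le (C := 3)
    (f := Real.arcsin) (f' := fun t => 1 / √(1 - t ^ 2)) (fun t ht =>
      (Real.hasDerivAt_arcsin (by linarith [ht.1]) (by linarith [ht.2])).hasDerivWithinAt)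
    ?_ hy hx
  · exact this
  intro t ht
  have h2 : (1 / 3 : ℝ) ≤ √(1 - t ^ 2) := by
    refine Real.le_sqrt_of_sq_le ?_
    nlinarith [ht.1, ht.2]
  rw [Real.norm_of_nonneg (by positivity), div_le_iff₀ (by linarith)]
  linarith

theorem abs_log_model_sub_le {μ : ℝ} (h1 : 1 < μ) {ρ h r d : ℝ} (hρ : 0 < ρ) (hh : 0 < h)
    (hhρ : h ≤ 9 / 10 * ρ) (hr : 0 < r) (hd : 0 < d) (hdr : d ≤ 9 / 10 * r) :
    |Real.log (μ * ρ * Real.sin (Real.arcsin (h / ρ) / μ)) -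
      Real.log (μ * r * Real.sin (Real.arcsin (d / r) / μ))| ≤
      |Real.log h - Real.log d| + 6 * |h / ρ - d / r| := by
  have hμ : 0 < μ := by linarith
  have hpi := Real.pi_pos
  have key : ∀ {ρ h : ℝ}, 0 < ρ → 0 < h → h ≤ 9 / 10 * ρ →
      h / ρ ∈ Set.Icc (0 : ℝ) (9 / 10) ∧ Real.arcsin (h / ρ) ∈ Set.Ioc 0 (Real.pi / 2) ∧
      Real.log (μ * ρ * Real.sin (Real.arcsin (h / ρ) / μ)) = Real.log μ + Real.log h +
        (Real.log (Real.sin (Real.arcsin (h / ρ) / μ)) -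
          Real.log (Real.sin (Real.arcsin (h / ρ)))) := by
    intro ρ h hρ hh hhρ
    have a1 : h / ρ ≤ 9 / 10 := by rwa [div_le_iff₀ hρ]
    have a0 : 0 < h / ρ := div_pos hh hρ
    have a2 : Real.arcsin (h / ρ) ∈ Set.Ioc 0 (Real.pi / 2) :=
      ⟨Real.arcsin_pos.2 a0, Real.arcsin_le_pi_div_two _⟩
    have s1 : 0 < Real.sin (Real.arcsin (h / ρ) / μ) := by
      refine Real.sin_pos_of_pos_of_lt_pi (div_pos a2.1 hμ) ?_
      have := div_le_self a2.1.le h1.le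
      linarith [a2.2]
    refine ⟨⟨a0.le, a1⟩, a2, ?_⟩
    rw [Real.sin_arcsin (by linarith) (by linarith), Real.log_mul (by positivity) s1.ne',
      Real.log_mul hμ.ne' hρ.ne', Real.log_div hh.ne' hρ.ne']
    ring
  obtain ⟨a1, a2, a3⟩ := key hρ hh hhρ
  obtain ⟨c1, c2, c3⟩ := key hr hd hdr
  have e1 := abs_log_sin_ratio_sub_le h1 a2 c2
  have e2 := abs_arcsin_sub_arcsin_le a1 c1
  rw [a3, c3]
  have e3 := abs_add_le (Real.log h - Real.log d)
    ((Real.log (Real.sin (Real.arcsin (h / ρ) / μ)) - Real.log (Real.sin (Real.arcsin (h / ρ)))) -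
    (Real.log (Real.sin (Real.arcsin (d / r) / μ)) - Real.log (Real.sin (Real.arcsin (d / r)))))
  rw [show ∀ a b c d e : ℝ, a + b + c - (a + d + e) = (b - d) + (c - e) by intros; ring]
  linarith

theorem coneFn_of_nonneg {μ : ℝ} (h1 : 1 < μ) (h2 : μ < 2) {P : ℂ} (hre : 0 ≤ P.re)
    (him : 0 ≤ P.im) :
    coneFn μ P = μ * ‖P‖ * Real.sin (Real.arcsin (P.im / ‖P‖) / μ) := by
  have hpi := Real.pi_pos
  have hμ : 0 < μ := by linarith
  by_cases hP : P = 0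
  · subst hP; simp [coneFn]
  have hn := norm_pos_iff.2 hP
  have h0 : 0 ≤ arg P := arg_nonneg_iff.2 him
  have h3 : arg P ≤ Real.pi / 2 := (abs_le.1 (abs_arg_le_pi_div_two_iff.2 hre)).2
  have e : conj (axis μ) * P = (‖P‖ : ℂ) * exp ((arg P - μ * Real.pi / 2 : ℝ) * I) := by
    conv_lhs => rw [← norm_mul_exp_arg_mul_I P]
    unfold axis
    rw [← exp_conj, mul_left_comm, ← Complex.exp_add]
    congr 2
    simp only [map_mul, conj_ofReal, conj_I]
    push_cast
    ring
  have e2 : arg (conj (axis μ) * P) = arg P - μ * Real.pi / 2 := by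
    rw [e, exp_mul_I]
    exact arg_mul_cos_add_sin_mul_I hn ⟨by nlinarith, by nlinarith⟩
  unfold coneFn
  rw [e2, ← arg_of_re_nonneg hre, sub_div, show μ * Real.pi / 2 / μ = Real.pi / 2 by field_simp,
    Real.cos_sub_pi_div_two]

theorem abs_arg_le_of_norm_sub_one_le {w : ℂ} {β : ℝ} (hβ : β ≤ 1 / 2) (hw : ‖w - 1‖ ≤ β) :
    |arg w| ≤ 4 * β := by
  have hpi := Real.pi_pos
  have hpi4 := Real.pi_le_four
  have hre := (abs_le.1 ((abs_re_le_norm (w - 1)).trans hw)).1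
  have him := (abs_im_le_norm (w - 1)).trans hw
  simp at hre him
  have hre' : 0 ≤ w.re := by linarith
  have hn : 1 / 2 ≤ ‖w‖ := by linarith [re_le_norm w]
  have h1 := Real.mul_abs_le_abs_sin (abs_arg_le_pi_div_two_iff.2 hre')
  rw [sin_arg, abs_div, abs_norm] at h1
  have h2 : |w.im| / ‖w‖ ≤ 2 * β := by
    rw [div_le_iff₀ (by linarith)]
    nlinarith [abs_nonneg w.im]
  have h3 : 1 / 2 * |arg w| ≤ 2 / Real.pi * |arg w| := by
    gcongr ?_ * _
    rw [div_le_div_iff₀ (by norm_num) hpi]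
    linarith
  linarith

theorem abs_log_coneFn_sub_le {μ : ℝ} (h1 : 1 < μ) (h2 : μ < 2) {z P : ℂ} (hz : z ≠ 0) {β : ℝ}
    (hβ : β ≤ 1 / 32) (hP : ‖P - z‖ ≤ β * ‖z‖)
    (hφ : |arg (conj (axis μ) * z)| ≤ μ * Real.pi / 2 - Real.pi / 4) :
    |Real.log (coneFn μ P) -
      Real.log (μ * ‖z‖ * Real.cos (arg (conj (axis μ) * z) / μ))| ≤ 34 * β := by
  have hpi := Real.pi_gt_three
  have hpi4 := Real.pi_le_four
  have hμ : 0 < μ := by linarith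
  have hn := norm_pos_iff.2 hz
  set w := P / z with hw
  have hPz : P = z * w := by rw [hw]; field_simp
  have hw1 : ‖w - 1‖ ≤ β := by
    rw [hw, div_sub_one hz, norm_div, div_le_iff₀ hn]; exact hP
  have hα := abs_arg_le_of_norm_sub_one_le (by linarith) hw1
  have hwn : |‖w‖ - 1| ≤ β := by
    have := abs_norm_sub_norm_le w 1
    rw [norm_one] at this
    exact this.trans hw1
  have hβ0 : 0 ≤ β := (norm_nonneg _).trans hw1
  have hwn2 : 1 / 2 ≤ ‖w‖ := by linarith [(abs_le.1 hwn).1]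
  have hw0 : w ≠ 0 := norm_pos_iff.1 (by linarith)
  set φ := arg (conj (axis μ) * z) with hφdef
  have hkz : conj (axis μ) * z ≠ 0 := by
    refine mul_ne_zero ?_ hz
    rw [← norm_pos_iff, norm_conj, norm_axis]; exact one_pos
  have hφ' := abs_le.1 hφ
  have hα' := abs_le.1 hα
  have harg : arg (conj (axis μ) * P) = φ + arg w := by
    rw [hPz, ← mul_assoc, arg_mul hkz hw0]
    constructor <;> nlinarith
  have hcos1 : 1 / 4 ≤ Real.cos (φ / μ) := by
    have a1 : |φ / μ| ≤ Real.pi / 2 - Real.pi / 8 := by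
      rw [abs_div, abs_of_pos hμ, div_le_iff₀ hμ]
      nlinarith
    rw [← Real.cos_abs]
    have a2 := Real.cos_le_cos_of_nonneg_of_le_pi (abs_nonneg _) (by linarith) a1
    rw [Real.cos_pi_div_two_sub] at a2
    have a3 := Real.mul_le_sin (x := Real.pi / 8) (by positivity) (by linarith)
    have a4 : 2 / Real.pi * (Real.pi / 8) = 1 / 4 := by field_simp; norm_num
    linarith
  have hcosd : |Real.cos ((φ + arg w) / μ) - Real.cos (φ / μ)| ≤ 4 * β := by
    refine (Real.abs_cos_sub_cos_le _ _).trans ?_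
    rw [← sub_div, add_sub_cancel_left, abs_div, abs_of_pos hμ]
    exact (div_le_self (abs_nonneg _) h1.le).trans hα
  have hcos2 : 1 / 8 ≤ Real.cos ((φ + arg w) / μ) := by linarith [(abs_le.1 hcosd).1]
  unfold coneFn
  have hw0' : ‖w‖ ≠ 0 := by positivity
  have hμz : μ * ‖z‖ ≠ 0 := by positivity
  rw [harg, hPz, norm_mul, ← mul_assoc, Real.log_mul (mul_ne_zero hμz hw0') (by linarith),
    Real.log_mul hμz hw0', Real.log_mul hμz (by linarith)]
  have e1 := abs_log_sub_log_le (by norm_num) hcos2 (by linarith : 1 / 8 ≤ Real.cos (φ / μ))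
  have e2 := abs_log_sub_log_le (by norm_num) hwn2 (by norm_num : (1 / 2 : ℝ) ≤ 1)
  rw [Real.log_one, sub_zero] at e2
  rw [show ∀ a b c d : ℝ, a + b + c - (a + d) = b + (c - d) by intros; ring]
  refine (abs_add_le _ _).trans ?_
  have e3 : |Real.cos ((φ + arg w) / μ) - Real.cos (φ / μ)| / (1 / 8) ≤ 4 * β / (1 / 8) := by gcongr
  have e4 : |‖w‖ - 1| / (1 / 2) ≤ β / (1 / 2) := by gcongr
  linarith

section

variable {γ g : ℝ → ℂ} {e : ℂ} {b K T η : ℝ}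

theorem Arc.continuous (h : Arc γ g e b K T η) : Continuous γ :=
  continuous_iff_continuousAt.2 fun t => (h.deriv t).continuousAt

theorem Arc.b_pos (h : Arc γ g e b K T η) : 0 < b := h.T_pos.trans_le h.T_le

theorem Arc.zero_mem (h : Arc γ g e b K T η) : (0 : ℂ) ∈ γ '' Set.Icc 0 b :=
  ⟨0, ⟨le_rfl, h.b_pos.le⟩, h.zero⟩

theorem Arc.infDist_le_norm (h : Arc γ g e b K T η) (z : ℂ) :
    Metric.infDist z (γ '' Set.Icc 0 b) ≤ ‖z‖ := by
  simpa using Metric.infDist_le_dist_of_mem (x := z) h.zero_mem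

theorem Arc.exists_infDist_eq (h : Arc γ g e b K T η) (z : ℂ) :
    ∃ t ∈ Set.Icc 0 b, Metric.infDist z (γ '' Set.Icc 0 b) = ‖z - γ t‖ := by
  obtain ⟨_, ⟨t, ht, rfl⟩, hd⟩ := (isCompact_Icc.image h.continuous).exists_infDist_eq_dist
    ⟨0, h.zero_mem⟩ z
  exact ⟨t, ht, by rw [hd, dist_eq_norm]⟩

/-- Points of the arc far along it are not closest to `z`. -/
theorem Arc.norm_le_norm_sub_of_le (h : Arc γ g e b K T η) {z : ℂ} (hη : 2 * ‖z‖ ≤ η) {t : ℝ}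
    (ht : t ∈ Set.Icc 0 b) (htz : T ≤ t ∨ 4 * ‖z‖ ≤ t) : ‖z‖ ≤ ‖z - γ t‖ := by
  have h1 : 2 * ‖z‖ ≤ ‖γ t‖ := by
    by_cases hT : T ≤ t
    · exact hη.trans (h.far t ⟨hT, ht.2⟩)
    · have := h.half_le_norm ⟨ht.1, (not_le.1 hT).le⟩
      rcases htz with h2 | h2
      · exact absurd h2 hT
      · linarith
  have := norm_sub_norm_le (γ t) z
  rw [norm_sub_rev] at this
  linarith

theorem Arc.infDist_sq (h : Arc γ g e b K T η) (he : ‖e‖ = 1) {z : ℂ} (hK : 40 * K * ‖z‖ ≤ 1)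
    (hT : ‖z‖ ≤ T) (hη : 2 * ‖z‖ ≤ η) :
    ‖z‖ ^ 2 - max 0 (inner ℝ e z) ^ 2 * (1 + 20 * K * ‖z‖) ≤
        Metric.infDist z (γ '' Set.Icc 0 b) ^ 2 ∧
      Metric.infDist z (γ '' Set.Icc 0 b) ^ 2 ≤
        ‖z‖ ^ 2 - max 0 (inner ℝ e z) ^ 2 * (1 - 20 * K * ‖z‖) := by
  have hKp := h.K_pos
  have hz0 := norm_nonneg z
  set c := max 0 (inner ℝ e z) with hc
  have hc0 : 0 ≤ c := le_max_left _ _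
  have hce : inner ℝ e z ≤ c := le_max_right _ _
  have hcz : c ≤ ‖z‖ := by
    refine max_le hz0 ?_
    have := real_inner_le_norm e z
    rwa [he, one_mul] at this
  have hcc : c * inner ℝ e z = c ^ 2 := by
    rcases le_total (inner ℝ e z) 0 with h' | h'
    · rw [hc, max_eq_left h']; ring
    · rw [hc, max_eq_right h']; ring
  constructor
  · obtain ⟨t, ht, hd⟩ := h.exists_infDist_eq z
    rw [hd]
    by_cases htz : T ≤ t ∨ 4 * ‖z‖ ≤ t
    · have h1 := pow_le_pow_left₀ hz0 (h.norm_le_norm_sub_of_le hη ht htz) 2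
      have : 0 ≤ c ^ 2 * (1 + 20 * K * ‖z‖) := by positivity
      linarith
    · push Not at htz
      obtain ⟨h1, h2⟩ := htz
      have htT : t ∈ Set.Icc 0 T := ⟨ht.1, h1.le⟩
      have ht0 := ht.1
      have e1 := h.norm_sub_smul_le htT
      have e2 : inner ℝ (γ t) z ≤ t * c + K * t ^ 2 * ‖z‖ := by
        have a1 : inner ℝ (γ t) z = t * inner ℝ e z + inner ℝ (γ t - t • e) z := by
          rw [inner_sub_left, real_inner_smul_left]; ring
        have a2 := (real_inner_le_norm (γ t - t • e) z).trans
          (mul_le_mul_of_nonneg_right e1 hz0)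
        have a3 := mul_le_mul_of_nonneg_left hce ht0
        linarith
      have hKt : K * t ≤ 1 / 4 := (mul_le_mul_of_nonneg_left h1.le hKp.le).trans h.KT
      have e3 : t - K * t ^ 2 ≤ ‖γ t‖ := by
        have := norm_sub_norm_le (t • e) (γ t)
        rw [norm_smul, he, mul_one, Real.norm_of_nonneg ht0, norm_sub_rev] at this
        linarith
      have e4 : t ^ 2 - 8 * K * ‖z‖ * t ^ 2 ≤ ‖γ t‖ ^ 2 := by
        have a1 := pow_le_pow_left₀ (by nlinarith) e3 2
        have a2 : K * t * t ^ 2 ≤ K * (4 * ‖z‖) * t ^ 2 := by gcongr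
        have a3 : 0 ≤ (K * t ^ 2) ^ 2 := sq_nonneg _
        linarith
      rw [norm_sub_sq_real, real_inner_comm]
      set x := 10 * K * ‖z‖ with hx
      have hx0 : 0 ≤ x := by positivity
      have hx1 : x ≤ 1 / 4 := by linarith
      have e5 : 0 ≤ t ^ 2 * (1 - x) - 2 * t * c + c ^ 2 * (1 + 2 * x) := by
        have : (1 - x) * (t ^ 2 * (1 - x) - 2 * t * c + c ^ 2 * (1 + 2 * x)) =
          ((1 - x) * t - c) ^ 2 + c ^ 2 * (x * (1 - 2 * x)) := by ring
        refine nonneg_of_mul_nonneg_right (a := 1 - x) ?_ (by linarith)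
        rw [this]
        have : 0 ≤ x * (1 - 2 * x) := mul_nonneg hx0 (by linarith)
        positivity
      linarith
  · have hcT : c ∈ Set.Icc 0 T := ⟨hc0, hcz.trans hT⟩
    have e1 := h.norm_sub_smul_le hcT
    have e2 : Metric.infDist z (γ '' Set.Icc 0 b) ≤ ‖z - γ c‖ := by
      rw [← dist_eq_norm]
      exact Metric.infDist_le_dist_of_mem ⟨c, ⟨hc0, hcT.2.trans h.T_le⟩, rfl⟩
    have e3 : ‖z - γ c‖ ≤ ‖z - c • e‖ + K * c ^ 2 := by
      have := norm_sub_le (z - c • e) (γ c - c • e)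
      rw [sub_sub_sub_cancel_right] at this
      linarith
    have e4 : ‖z - c • e‖ ^ 2 = ‖z‖ ^ 2 - c ^ 2 := by
      rw [norm_sub_sq_real, norm_smul, he, mul_one, Real.norm_of_nonneg hc0, real_inner_smul_right,
        real_inner_comm, hcc]
      ring
    have e5 : ‖z - c • e‖ ≤ ‖z‖ := by
      rw [← sq_le_sq₀ (norm_nonneg _) hz0, e4]
      linarith [sq_nonneg c]
    have e6 := pow_le_pow_left₀ Metric.infDist_nonneg (e2.trans e3) 2
    have e7 : K * c ^ 2 * ‖z - c • e‖ ≤ K * c ^ 2 * ‖z‖ := by gcongr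
    have e8 : (K * c ^ 2) ^ 2 ≤ K * c ^ 2 * ‖z‖ := by
      have : K * c ^ 2 ≤ ‖z‖ := by nlinarith
      rw [pow_two]
      gcongr
    have e9 : 0 ≤ K * c ^ 2 * ‖z‖ := by positivity
    linarith

/-- The foot of the perpendicular from `z` to the arc. -/
theorem Arc.exists_foot (h : Arc γ g e b K T η) {z : ℂ} (hη : 2 * ‖z‖ ≤ η)
    (hd : Metric.infDist z (γ '' Set.Icc 0 b) < ‖z‖) :
    ∃ t ∈ Set.Icc 0 (4 * ‖z‖), ∃ ν : ℝ, |ν| = Metric.infDist z (γ '' Set.Icc 0 b) ∧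
      z = γ t + ν • (I * g t) := by
  obtain ⟨t, ht, hdt⟩ := h.exists_infDist_eq z
  have h1 : ¬ (T ≤ t ∨ 4 * ‖z‖ ≤ t) := fun hc => by
    linarith [h.norm_le_norm_sub_of_le hη ht hc]
  push Not at h1
  have ht0 : 0 < t := by
    refine lt_of_le_of_ne ht.1 fun h0 => ?_
    rw [← h0, h.zero, sub_zero] at hdt
    linarith
  have hmin : IsLocalMin (fun s => ‖z - γ s‖ ^ 2) t := by
    have hI : Set.Icc 0 b ∈ 𝓝 t := Icc_mem_nhds ht0 (h1.1.trans_le h.T_le)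
    filter_upwards [hI] with s hs
    refine pow_le_pow_left₀ (norm_nonneg _) ?_ 2
    rw [← hdt, ← dist_eq_norm]
    exact Metric.infDist_le_dist_of_mem ⟨s, hs, rfl⟩
  have hder := (((hasDerivAt_const t z).sub (h.deriv t)).norm_sq)
  have h0 := hmin.hasDerivAt_eq_zero hder
  have hg := h.norm_g t ⟨ht0.le, h1.1.le⟩
  have hre : ((z - γ t) * conj (g t)).re = 0 := by
    simp only [zero_sub, inner_neg_right, Pi.sub_apply] at h0
    rw [real_inner_comm, Complex.inner] at h0
    linarith
  have hz : z - γ t = (((z - γ t) * conj (g t)).im : ℝ) • (I * g t) := by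
    have h2 := conj_mul_self_of_norm_one hg
    have h3 := re_add_im ((z - γ t) * conj (g t))
    rw [hre] at h3
    rw [real_smul]
    push_cast at h3
    linear_combination (-g t) * h3 - (z - γ t) * h2
  refine ⟨t, ⟨ht0.le, h1.2.le⟩, _, ?_, eq_add_of_sub_eq' hz⟩
  rw [hdt, hz, norm_smul, norm_I_mul hg, mul_one, Real.norm_eq_abs]
  congr 1
  rw [← hz]

theorem mem_lune_of_shift {μ : ℝ} {Ω : Set ℂ} (hΩ : IsOpen Ω) {a m w : ℂ} {τ ε₀ : ℝ} (hε₀ : 0 < ε₀)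
    (hcl : ∀ ε : ℝ, 0 < ε → ε < ε₀ → closure Ω ⊆ lune μ (a + ε • w) m τ) {z : ℂ} (hz : z ∈ Ω) :
    z ∈ lune μ a m τ := by
  have hc : Tendsto (fun ε : ℝ => z + ε • w) (𝓝[>] 0) (𝓝 z) := by
    have : Continuous fun ε : ℝ => z + ε • w := by fun_prop
    simpa using this.continuousWithinAt (s := Set.Ioi 0) (x := 0) |>.tendsto
  obtain ⟨ε, hε, hε1⟩ := ((hc.eventually (hΩ.mem_nhds hz)).and
    (Ioo_mem_nhdsGT hε₀)).exists
  have := hcl ε hε1.1 hε1.2 (subset_closure hε)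
  unfold lune at this ⊢
  rw [Set.mem_ofPred_eq] at this ⊢
  rwa [add_sub_add_right_eq_sub] at this

/-- `x` is the value at `z` of the solution on a lune which, when moved slightly, is contained in
`Ω`. -/
def UpperVal (Ω : Set ℂ) (μ : ℝ) (z : ℂ) (x : ℝ) : Prop :=
  ∃ (a m w : ℂ) (τ ε₀ : ℝ), ‖m‖ = 1 ∧ 0 < τ ∧ 0 < ε₀ ∧
    (∀ ε : ℝ, 0 < ε → ε < ε₀ → closure (lune μ (a + ε • w) m τ) ⊆ Ω) ∧
    z ∈ lune μ a m τ ∧ x = luneSol μ a m τ z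

/-- `x` is the value at `z` of the solution on a lune which, when moved slightly, contains `Ω`. -/
def LowerVal (Ω : Set ℂ) (μ : ℝ) (z : ℂ) (x : ℝ) : Prop :=
  ∃ (a m w : ℂ) (τ ε₀ : ℝ), ‖m‖ = 1 ∧ 0 < ε₀ ∧
    (∀ ε : ℝ, 0 < ε → ε < ε₀ → closure Ω ⊆ lune μ (a + ε • w) m τ) ∧
    z ∈ lune μ a m τ ∧ x = luneSol μ a m τ z

end

theorem inner_frame_sub {a m n p z : ℂ} {ρ ν : ℝ} (hm : ‖m‖ = 1) (hn : ‖n‖ = 1) (hρ : ρ ≠ 0)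
    (hc : a + ρ • (I * m) = p + ρ • (I * n)) (hz : z = p + ν • (I * n)) :
    inner ℝ (I * m) (z - a) - 1 / (2 * ρ) * ‖z - a‖ ^ 2 = ν - 1 / (2 * ρ) * ν ^ 2 := by
  have e1 := norm_sub_smul_sq (norm_I_mul hm) ρ (z - a)
  have e2 : z - a - ρ • (I * m) = (ν - ρ) • (I * n) := by
    rw [sub_sub, hc, hz, sub_smul]; abel
  rw [e2, norm_smul, norm_I_mul hn, mul_one, Real.norm_eq_abs, sq_abs] at e1
  field_simp
  linarith

theorem norm_bend_sub_le {μ : ℝ} (h1 : 1 < μ) (h2 : μ < 2) (τ : ℝ) (Y : ℂ) :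
    ‖bend μ τ Y - Y‖ ≤ |τ| / Real.sin (μ * Real.pi / 2) * ‖Y‖ ^ 2 := by
  have hS := sin_half_pos h1 h2
  unfold bend
  rw [sub_sub_cancel_left, norm_neg, norm_mul, norm_axis, mul_one, norm_real, Real.norm_eq_abs,
    abs_mul, abs_div, abs_of_pos hS, abs_of_nonneg (sq_nonneg ‖Y‖)]

/-- The solution on a lune osculating an arc, at a point whose foot is on the arc, is close to
the model solution with the same distance to the arc. -/
theorem abs_luneSol_sub_le {μ : ℝ} (h1 : 1 < μ) (h2 : μ < 2) {a m n p z : ℂ} {ρ ν M B : ℝ}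
    (hm : ‖m‖ = 1) (hn : ‖n‖ = 1) (hρ : ρ ≠ 0)
    (hc : a + ρ • (I * m) = p + ρ • (I * n)) (hz : z = p + ν • (I * n))
    (hν : 0 < ν) (hνz : ν ≤ 3 / 4 * ‖z‖) (hre : ‖z‖ / 2 ≤ z.re)
    (ha : ‖a‖ ≤ M * ‖z‖ ^ 2) (hm1 : ‖m - 1‖ ≤ M * ‖z‖)
    (hB : 2 * M + 4 * (|1 / (2 * ρ)| / Real.sin (μ * Real.pi / 2)) ≤ B)
    (hBz : 30 * B * ‖z‖ ≤ 1) :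
    z ∈ lune μ a m (1 / (2 * ρ)) ∧
      |luneSol μ a m (1 / (2 * ρ)) z -
        -Real.log (μ * ‖z‖ * Real.sin (Real.arcsin (ν / ‖z‖) / μ))| ≤ 18 * B * ν := by
  have hS := sin_half_pos h1 h2
  have key := inner_frame_sub hm hn hρ hc hz
  set τ := 1 / (2 * ρ) with hτ
  have hr : 0 < ‖z‖ := by linarith
  set r := ‖z‖ with hrdef
  have hM : 0 ≤ M := nonneg_of_mul_nonneg_left ((norm_nonneg _).trans hm1) hr
  have hτS : |τ| ≤ |τ| / Real.sin (μ * Real.pi / 2) :=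
    le_div_self (abs_nonneg _) hS (Real.sin_le_one _)
  have hτ0 := abs_nonneg τ
  have hτB : 4 * |τ| ≤ B := by linarith
  have hB0 : 0 ≤ B := by linarith
  have hMB : 2 * M ≤ B := by linarith [hτ0.trans hτS]
  have hτr : 30 * (|τ| * r) ≤ 1 := by
    linarith [mul_le_mul_of_nonneg_right hτB hr.le, mul_nonneg hτ0 hr.le]
  have hMr : M * r ≤ 1 := by
    linarith [mul_le_mul_of_nonneg_right hMB hr.le, mul_nonneg hB0 hr.le]
  have hτν := abs_le.1 (abs_mul τ (ν ^ 2)).le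
  rw [abs_of_nonneg (sq_nonneg ν)] at hτν
  have hτν2 : |τ| * ν ^ 2 ≤ ν * (|τ| * r) := by
    rw [pow_two, ← mul_assoc, mul_comm]
    exact mul_le_mul_of_nonneg_left (mul_le_mul_of_nonneg_left (by linarith) hτ0) hν.le
  have hτν3 : ν * (|τ| * r) ≤ ν * (1 / 30) := mul_le_mul_of_nonneg_left (by linarith) hν.le
  have hmem : z ∈ lune μ a m τ := by
    rw [mem_lune_iff h1 h2 hm]
    left
    linarith
  refine ⟨hmem, ?_⟩
  set Y := conj m * (z - a) with hY
  have hYn : ‖Y‖ = ‖z - a‖ := by rw [hY, norm_mul, norm_conj, hm, one_mul]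
  set P := bend μ τ Y with hP
  have him : P.im = ν - τ * ν ^ 2 := by
    rw [hP, bend_im h1 h2, hYn, ← key, hY, Complex.inner]
    simp
    ring
  have hza : ‖z - a‖ ≤ 2 * r := by
    have a1 := norm_sub_le z a
    have a2 : M * r ^ 2 = M * r * r := by ring
    have a3 := mul_le_mul_of_nonneg_right hMr hr.le
    rw [← hrdef] at a1
    linarith
  have hPz : ‖P - z‖ ≤ B * r ^ 2 := by
    have a1 := norm_bend_sub_le h1 h2 τ Y
    rw [← hP, hYn] at a1
    have a2 : ‖Y - z‖ ≤ M * r * r + M * r ^ 2 := by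
      have : Y - z = conj (m - 1) * z - conj m * a := by rw [hY, map_sub, map_one]; ring
      rw [this]
      refine (norm_sub_le _ _).trans ?_
      rw [norm_mul, norm_mul, norm_conj, norm_conj, hm, one_mul]
      gcongr
    have a3 := norm_add_le (P - Y) (Y - z)
    rw [sub_add_sub_cancel] at a3
    have a4 : |τ| / Real.sin (μ * Real.pi / 2) * ‖z - a‖ ^ 2 ≤
      |τ| / Real.sin (μ * Real.pi / 2) * (2 * r) ^ 2 := by gcongr
    have a5 := mul_le_mul_of_nonneg_right hB (sq_nonneg r)
    linarith
  have hBr : B * r ^ 2 = B * r * r := by ring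
  have hBr2 : B * r * r ≤ 1 / 30 * r := mul_le_mul_of_nonneg_right (by linarith) hr.le
  have hPre : 0 ≤ P.re := by
    have := (abs_le.1 ((abs_re_le_norm (P - z)).trans hPz)).1
    rw [sub_re] at this
    linarith
  have hPn := abs_le.1 ((abs_norm_sub_norm_le P z).trans hPz)
  rw [← hrdef] at hPn
  have hPim : 29 / 30 * ν ≤ P.im := by rw [him]; linarith
  have hPim' : P.im ≤ 31 / 30 * ν := by rw [him]; linarith
  have hPpos : 9 / 10 * r ≤ ‖P‖ := by linarith
  have hP0 : 0 < ‖P‖ := by linarith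
  unfold luneSol
  rw [← hY, ← hP, neg_sub_neg, abs_sub_comm, coneFn_of_nonneg h1 h2 hPre (by linarith)]
  refine (abs_log_model_sub_le h1 hP0 (by linarith) (by linarith) hr hν (by linarith)).trans ?_
  have hd : |P.im - ν| ≤ |τ| * ν ^ 2 := by
    rw [him, sub_sub_cancel_left, abs_neg, abs_mul, abs_of_nonneg (sq_nonneg ν)]
  have hlog : |Real.log P.im - Real.log ν| ≤ 4 * |τ| * ν := by
    refine (abs_log_sub_log_le (c := ν / 2) (by linarith) (by linarith) (by linarith)).trans ?_
    rw [div_le_iff₀ (by linarith)]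
    have : 0 ≤ |τ| * ν ^ 2 := by positivity
    linarith
  have hrat : |P.im / ‖P‖ - ν / r| ≤ 2 * (|τ| + B) * ν := by
    rw [div_sub_div _ _ hP0.ne' hr.ne', abs_div, abs_of_pos (mul_pos hP0 hr),
      div_le_iff₀ (mul_pos hP0 hr)]
    have b1 : P.im * r - ‖P‖ * ν = (P.im - ν) * r + (r - ‖P‖) * ν := by ring
    have b2 : |r - ‖P‖| ≤ B * r ^ 2 := abs_le.2 ⟨by linarith, by linarith⟩
    have b3 : |P.im * r - ‖P‖ * ν| ≤ ν * (|τ| * r) * r + B * r ^ 2 * ν := by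
      rw [b1]
      refine (abs_add_le _ _).trans ?_
      rw [abs_mul, abs_mul, abs_of_pos hr, abs_of_pos hν]
      gcongr
      exact hd.trans hτν2
    have b4 : 0 ≤ (|τ| + B) * ν * r := by positivity
    have b5 := mul_le_mul_of_nonneg_left hPpos b4
    linarith [mul_nonneg b4 hr.le]
  have : 0 ≤ B * ν := by positivity
  have h4 := mul_le_mul_of_nonneg_right hτB hν.le
  linarith

theorem re_eq_norm_mul_cos (μ : ℝ) (z : ℂ) :
    z.re = ‖z‖ * Real.cos (arg (conj (axis μ) * z) + μ * Real.pi / 2) := by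
  rw [← re_polar, ← polar_of_arg μ z]

theorem im_eq_norm_mul_sin (μ : ℝ) (z : ℂ) :
    z.im = ‖z‖ * Real.sin (arg (conj (axis μ) * z) + μ * Real.pi / 2) := by
  rw [← im_polar, ← polar_of_arg μ z]

theorem conj_axis_mul_eq (μ : ℝ) (z : ℂ) :
    conj (axis μ) * z = ‖z‖ * exp ((arg (conj (axis μ) * z) : ℝ) * I) := by
  have h := norm_mul_exp_arg_mul_I (conj (axis μ) * z)
  rw [norm_mul, norm_conj, norm_axis, one_mul] at h
  exact h.symm

theorem inner_axis (μ : ℝ) (z : ℂ) :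
    inner ℝ (axis μ) z = ‖z‖ * Real.cos (arg (conj (axis μ) * z)) := by
  rw [Complex.inner, mul_comm, ← re_polar, ← conj_axis_mul_eq]

theorem inner_I_axis (μ : ℝ) (z : ℂ) :
    inner ℝ (I * axis μ) z = ‖z‖ * Real.sin (arg (conj (axis μ) * z)) := by
  rw [Complex.inner, ← im_polar, ← conj_axis_mul_eq, map_mul, conj_I,
    show z * (-I * conj (axis μ)) = -(I * (conj (axis μ) * z)) by ring, neg_re, I_mul_re, neg_neg]

theorem inner_edge (μ : ℝ) (z : ℂ) :
    inner ℝ (edge μ) z = ‖z‖ * Real.cos (arg (conj (axis μ) * z) - μ * Real.pi / 2) := by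
  have e1 : z * conj (edge μ) = conj (axis μ) * (conj (axis μ) * z) := by
    rw [← axis_mul_axis, map_mul]; ring
  have hr := congrArg re (conj_axis_mul_eq μ z)
  have hi := congrArg im (conj_axis_mul_eq μ z)
  rw [re_polar] at hr
  rw [im_polar] at hi
  rw [Complex.inner, e1, mul_re, hr, hi, conj_re, conj_im, axis_re,
    axis_im, Real.cos_sub]
  ring

theorem inner_edge_normal_le {μ c : ℝ} (h1 : 1 < μ) (h2 : μ < 2) {z : ℂ}
    (hφ : arg (conj (axis μ) * z) ≤ 0) (hc : inner ℝ (axis μ) z ≤ -c) :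
    inner ℝ (-(I * edge μ * 1)) z ≤ -(Real.sin (μ * Real.pi / 2) * c) := by
  have hpi := Real.pi_pos
  have hS := sin_half_pos h1 h2
  have hC : Real.cos (μ * Real.pi / 2) ≤ 0 :=
    Real.cos_nonpos_of_pi_div_two_le_of_le (by nlinarith) (by nlinarith)
  have e1 : inner ℝ (-(I * edge μ * 1)) z = -Real.cos (μ * Real.pi / 2) * inner ℝ (I * axis μ) z +
      Real.sin (μ * Real.pi / 2) * inner ℝ (axis μ) z := by
    rw [← axis_mul_axis, Complex.inner, Complex.inner, Complex.inner, ← axis_re, ← axis_im]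
    simp
    ring
  have e2 : inner ℝ (I * axis μ) z ≤ 0 := by
    rw [inner_I_axis]
    exact mul_nonpos_of_nonneg_of_nonpos (norm_nonneg _)
      (Real.sin_nonpos_of_nonpos_of_neg_pi_le hφ (neg_pi_lt_arg _).le)
  have e3 := mul_le_mul_of_nonneg_left hc hS.le
  have e4 := mul_nonpos_of_nonneg_of_nonpos (neg_nonneg.2 hC) e2
  linarith

/-- A point of a lune near its first edge lies on the inner side of that edge. -/
theorem pos_of_mem_lune {μ : ℝ} (h1 : 1 < μ) (h2 : μ < 2) {a m n p z : ℂ} {ρ ν M c : ℝ}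
    (hm : ‖m‖ = 1) (hn : ‖n‖ = 1) (hρ : ρ < 0)
    (hc : a + ρ • (I * m) = p + ρ • (I * n)) (hz : z = p + ν • (I * n))
    (hmem : z ∈ lune μ a m (1 / (2 * ρ))) (hν : |ν| ≤ -ρ)
    (ha : ‖a‖ ≤ M * ‖z‖ ^ 2) (hm1 : ‖m - 1‖ ≤ M * ‖z‖) (hMz : M * ‖z‖ ≤ 1)
    (hE : inner ℝ (-(I * edge μ * 1)) z ≤ -c)
    (hs : 2 * M * ‖z‖ ^ 2 + 4 * ‖z‖ ^ 2 / (2 * -ρ) ≤ c) : 0 < ν := by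
  have key := inner_frame_sub hm hn hρ.ne hc hz
  rw [mem_lune_iff h1 h2 hm] at hmem
  by_contra hν0
  rw [not_lt] at hν0
  rcases hmem with h | h
  · have e1 : 0 < ν - 1 / (2 * ρ) * ν ^ 2 := by linarith
    have e2 : ν - 1 / (2 * ρ) * ν ^ 2 = ν * (2 * -ρ + ν) / (2 * -ρ) := by
      have := hρ.ne
      field_simp; ring
    rw [e2] at e1
    have e3 := (abs_le.1 hν).1
    have e4 : ν * (2 * -ρ + ν) / (2 * -ρ) ≤ 0 :=
      div_nonpos_of_nonpos_of_nonneg (mul_nonpos_of_nonpos_of_nonneg hν0 (by linarith))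
        (by linarith)
    linarith
  · have hr := norm_nonneg z
    have hza : ‖z - a‖ ≤ 2 * ‖z‖ := by
      have a1 := norm_sub_le z a
      have a2 : M * ‖z‖ ^ 2 = M * ‖z‖ * ‖z‖ := by ring
      have a3 := mul_le_mul_of_nonneg_right hMz hr
      linarith
    have e1 : inner ℝ (-(I * edge μ * m)) (z - a) ≤ -c + 2 * M * ‖z‖ ^ 2 := by
      have b1 : inner ℝ (-(I * edge μ * m)) (z - a) = inner ℝ (-(I * edge μ * 1)) z +
          inner ℝ (-(I * edge μ * (m - 1))) z + inner ℝ (I * edge μ * m) a := by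
        rw [← inner_add_left, inner_sub_right, inner_neg_left (I * edge μ * m) a, sub_neg_eq_add]
        congr 2; ring
      have b2 := real_inner_le_norm (-(I * edge μ * (m - 1))) z
      have b3 := real_inner_le_norm (I * edge μ * m) a
      rw [norm_neg, norm_mul, norm_mul, norm_I, norm_edge, one_mul, one_mul] at b2
      rw [norm_mul, norm_mul, norm_I, norm_edge, hm, one_mul, one_mul, one_mul] at b3
      have b4 := mul_le_mul_of_nonneg_right hm1 hr
      linarith
    have e2 : -(4 * ‖z‖ ^ 2 / (2 * -ρ)) ≤ 1 / (2 * ρ) * ‖z - a‖ ^ 2 := by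
      have b1 : 1 / (2 * ρ) * ‖z - a‖ ^ 2 = -(‖z - a‖ ^ 2 / (2 * -ρ)) := by field_simp
      rw [b1, neg_le_neg_iff]
      refine div_le_div_of_nonneg_right ?_ (by linarith)
      have := pow_le_pow_left₀ (norm_nonneg _) hza 2
      linarith
    linarith

section

variable {Ω : Set ℂ} {μ : ℝ} {γ₁ g₁ γ₂ g₂ : ℝ → ℂ} {b₁ b₂ K T η r₀ κ : ℝ}

theorem Geo.ne_zero (G : Geo Ω μ γ₁ g₁ γ₂ g₂ b₁ b₂ K T η r₀ κ) {z : ℂ} (hz : z ∈ Ω) : z ≠ 0 := by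
  rintro rfl
  exact G.isOpen.inter_frontier_eq.subset ⟨hz, G.zero_mem⟩

theorem seven_tenths_le_cos {θ : ℝ} (hθ : |θ| ≤ Real.pi / 4) : 7 / 10 ≤ Real.cos θ := by
  have h1 := Real.cos_le_cos_of_nonneg_of_le_pi (abs_nonneg θ) (by linarith [Real.pi_pos]) hθ
  rw [Real.cos_abs, Real.cos_pi_div_four] at h1
  have : (7 / 5 : ℝ) ≤ √2 := Real.le_sqrt_of_sq_le (by norm_num)
  linarith

theorem cos_half_neg {μ : ℝ} (h1 : 1 < μ) (h2 : μ < 2) : Real.cos (μ * Real.pi / 2) < 0 := by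
  have := Real.pi_pos
  exact Real.cos_neg_of_pi_div_two_lt_of_lt (by nlinarith) (by nlinarith)

theorem exists_pos_forall_mem_Ioo {p : ℝ → Prop} (h : ∀ᶠ t : ℝ in 𝓝 0, p t) :
    ∃ δ > 0, ∀ t : ℝ, 0 ≤ t → t < δ → p t := by
  obtain ⟨δ, hδ, h⟩ := exists_pos_forall_mem_Icc h
  exact ⟨δ, hδ, fun t h0 h1 => h t ⟨h0, h1.le⟩⟩

/-- Barriers at the points near the first arc. -/
theorem Geo.exists_near (G : Geo Ω μ γ₁ g₁ γ₂ g₂ b₁ b₂ K T η r₀ κ) :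
    ∃ C δ : ℝ, 0 < C ∧ 0 < δ ∧ ∀ z ∈ Ω, ‖z‖ < δ →
      |arg (conj (axis μ) * z) + μ * Real.pi / 2| < Real.pi / 4 →
      ∃ x y f, UpperVal Ω μ z x ∧ LowerVal Ω μ z y ∧
        f = -Real.log (μ * ‖z‖ * Real.sin
          (Real.arcsin (Metric.infDist z (γ₁ '' Set.Icc 0 b₁) / ‖z‖) / μ)) ∧
        |x - f| ≤ C * Metric.infDist z (γ₁ '' Set.Icc 0 b₁) ∧
        |y - f| ≤ C * Metric.infDist z (γ₁ '' Set.Icc 0 b₁) := by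
  have h1 := G.one_lt
  have h2 := G.lt_two
  have hS := sin_half_pos h1 h2
  have hC := cos_half_neg h1 h2
  have hK := G.arc₁.K_pos
  have hpi := Real.pi_pos
  obtain ⟨R, L, δ₀, hR, hL, hδ₀, hδT, hlune⟩ := G.exists_lune
  set S := Real.sin (μ * Real.pi / 2)
  set c := -Real.cos (μ * Real.pi / 2) with hc
  have hc0 : 0 < c := by linarith
  set M := 16 * L with hM
  set B := 2 * M + 4 * (1 / (2 * R) / S) with hB
  have hB0 : 0 < B := by positivity
  have hev := ((eventually_mul_le (200 * K) one_pos).and ((eventually_mul_le 2 G.arc₁.η_pos).and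
    ((eventually_mul_le 4 hδ₀).and ((eventually_mul_le (30 * B) one_pos).and
      ((eventually_mul_le 1 hR).and ((eventually_mul_le M one_pos).and
        ((eventually_mul_le (64 * K) hc0).and
          (eventually_mul_le (2 * M + 4 / (2 * R)) (d := S * (c / 4)) (by positivity)))))))))
  obtain ⟨δ, hδ, hev⟩ := exists_pos_forall_mem_Ioo hev
  refine ⟨18 * B, δ, by positivity, hδ, fun z hz hzδ hθ => ?_⟩
  obtain ⟨c1, c2, c3, c4, c5, c6, c7, c8⟩ := hev ‖z‖ (norm_nonneg z) hzδ
  have hz0 := G.ne_zero hz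
  have hr : 0 < ‖z‖ := norm_pos_iff.2 hz0
  set d := Metric.infDist z (γ₁ '' Set.Icc 0 b₁) with hd
  have hre : 7 / 10 * ‖z‖ ≤ z.re := by
    rw [re_eq_norm_mul_cos μ z, mul_comm]
    exact mul_le_mul_of_nonneg_left (seven_tenths_le_cos hθ.le) hr.le
  have hd34 : d ≤ 3 / 4 * ‖z‖ := by
    have e1 := (G.arc₁.infDist_sq (by simp) (z := z) (by linarith) (by linarith) c2).2
    rw [show inner ℝ (1 : ℂ) z = z.re by simp [Complex.inner], max_eq_right (by linarith)] at e1
    rw [← sq_le_sq₀ Metric.infDist_nonneg (by positivity)]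
    have e2 := pow_le_pow_left₀ (by positivity) hre 2
    have e3 : (7 / 10 * ‖z‖) ^ 2 * (9 / 10) ≤ z.re ^ 2 * (1 - 20 * K * ‖z‖) :=
      mul_le_mul e2 (by linarith) (by norm_num) (sq_nonneg _)
    linarith [sq_nonneg ‖z‖]
  obtain ⟨t, ht, ν, hν, hzt⟩ := G.arc₁.exists_foot c2 (by linarith : d < ‖z‖)
  rw [← hd] at hν
  have htT : t ∈ Set.Icc 0 T := ⟨ht.1, by linarith [ht.2]⟩
  have hlune := hlune t ⟨ht.1, by linarith [ht.2]⟩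
  have hg := G.arc₁.norm_g t htT
  have ht2 : t ^ 2 ≤ 16 * ‖z‖ ^ 2 := by
    have := pow_le_pow_left₀ ht.1 ht.2 2
    linarith
  have hbounds : ∀ {a m : ℂ}, ‖a‖ ≤ L * t ^ 2 → ‖m - 1‖ ≤ L * t →
      ‖a‖ ≤ M * ‖z‖ ^ 2 ∧ ‖m - 1‖ ≤ M * ‖z‖ := by
    intro a m ha hm1
    have e1 := mul_le_mul_of_nonneg_left ht2 hL.le
    have e2 := mul_le_mul_of_nonneg_left ht.2 hL.le
    have e3 : 0 ≤ L * ‖z‖ := by positivity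
    exact ⟨by linarith, by linarith⟩
  obtain ⟨a, m, hm, hc1, ha, hm1, -, hout⟩ := hlune (-1) (Or.inr rfl)
  obtain ⟨a', m', hm', hc1', ha', hm1', hin, -⟩ := hlune 1 (Or.inl rfl)
  obtain ⟨ha, hm1⟩ := hbounds ha hm1
  obtain ⟨ha', hm1'⟩ := hbounds ha' hm1'
  obtain ⟨ε₀, hε₀, hout⟩ := hout rfl
  obtain ⟨ε₁, hε₁, hin⟩ := hin rfl
  rw [neg_one_mul] at hc1
  rw [one_mul] at hc1'
  have hτ : -(1 / (2 * R)) = 1 / (2 * -R) := by rw [mul_neg, one_div_neg_eq_neg_one_div]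
  have hmem := mem_lune_of_shift G.isOpen hε₀ hout hz
  have hνpos : 0 < ν := by
    by_contra hν0
    rw [not_lt] at hν0
    have him : z.im ≤ 16 * K * ‖z‖ ^ 2 := by
      have e1 : z.im = (γ₁ t).im + ν * (g₁ t).re := by
        conv_lhs => rw [hzt]
        simp
      have e2 := (abs_le.1 ((abs_im_le_norm _).trans (G.arc₁.norm_sub_smul_le htT))).2
      have e3 := (abs_le.1 ((abs_re_le_norm _).trans (G.arc₁.norm_g_sub_le htT))).1
      simp at e2 e3
      have e4 := (mul_le_mul_of_nonneg_left htT.2 hK.le).trans G.arc₁.KT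
      have e5 := mul_nonpos_of_nonpos_of_nonneg hν0 (by linarith : 0 ≤ (g₁ t).re)
      have e6 := mul_le_mul_of_nonneg_left ht2 hK.le
      linarith
    have hax : inner ℝ (axis μ) z ≤ -(c / 4 * ‖z‖) := by
      have e1 : inner ℝ (axis μ) z = -c * z.re + S * z.im := by
        rw [Complex.inner, mul_re, conj_re, conj_im, axis_re, axis_im, hc]
        ring
      have e2 := mul_le_mul_of_nonneg_left hre hc0.le
      have e3 := mul_le_mul_of_nonneg_left him hS.le
      have e4 : S * (16 * K * ‖z‖ ^ 2) ≤ 1 * (16 * K * ‖z‖ ^ 2) :=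
        mul_le_mul_of_nonneg_right (Real.sin_le_one _) (by positivity)
      have e5 := mul_le_mul_of_nonneg_right c7 hr.le
      have e6 := mul_pos hc0 hr
      linarith
    have hφ : arg (conj (axis μ) * z) ≤ 0 := by
      have := (abs_lt.1 hθ).2
      nlinarith
    have hE := inner_edge_normal_le h1 h2 hφ hax
    refine hν0.not_gt (pos_of_mem_lune h1 h2 hm hg (neg_neg_of_pos hR) hc1 hzt (hτ ▸ hmem) ?_ ha hm1
      c6 hE ?_)
    · linarith
    · rw [neg_neg]
      have := mul_le_mul_of_nonneg_right c8 hr.le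
      have e2 : 4 * ‖z‖ ^ 2 / (2 * R) = 4 / (2 * R) * ‖z‖ * ‖z‖ := by ring
      rw [e2]
      linarith
  rw [abs_of_pos hνpos] at hν
  have habs : |1 / (2 * -R)| = 1 / (2 * R) := by
    rw [← hτ, abs_neg, abs_of_pos (by positivity)]
  have habs' : |1 / (2 * R)| = 1 / (2 * R) := abs_of_pos (by positivity)
  have hre2 : ‖z‖ / 2 ≤ z.re := by linarith
  rw [← hν] at hd34 ⊢
  obtain ⟨-, hlow⟩ := abs_luneSol_sub_le h1 h2 hm hg (neg_ne_zero.2 hR.ne') hc1 hzt hνpos hd34 hre2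
    ha hm1 (B := B) (by rw [habs]) c4
  obtain ⟨hmem', hup⟩ := abs_luneSol_sub_le h1 h2 hm' hg hR.ne' hc1' hzt hνpos hd34 hre2
    ha' hm1' (B := B) (by rw [habs']) c4
  rw [← hτ] at hlow
  exact ⟨_, _, _, ⟨a', m', _, _, ε₁, hm', by positivity, hε₁, hin, hmem', rfl⟩,
    ⟨a, m, _, _, ε₀, hm, hε₀, hout, hmem, rfl⟩, rfl, hup, hlow⟩

end

section

variable {Ω : Set ℂ} {μ : ℝ} {γ₁ g₁ γ₂ g₂ : ℝ → ℂ} {b₁ b₂ K T η r₀ κ : ℝ}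

theorem inner_one_left (μ : ℝ) (z : ℂ) :
    inner ℝ (1 : ℂ) z = ‖z‖ * Real.cos (arg (conj (axis μ) * z) + μ * Real.pi / 2) := by
  rw [← re_eq_norm_mul_cos]
  simp [Complex.inner]

/-- In the direction of the second quadrant both distances are attained at the corner. -/
theorem Geo.infDist_eq_norm (G : Geo Ω μ γ₁ g₁ γ₂ g₂ b₁ b₂ K T η r₀ κ) {z : ℂ}
    (hK : 40 * K * ‖z‖ ≤ 1) (hT : ‖z‖ ≤ T) (hη : 2 * ‖z‖ ≤ η)
    (hθ : Real.pi / 2 ≤ arg (conj (axis μ) * z) + μ * Real.pi / 2)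
    (hφ : arg (conj (axis μ) * z) ≤ 0) :
    Metric.infDist z (γ₁ '' Set.Icc 0 b₁) = ‖z‖ ∧
      Metric.infDist z (γ₂ '' Set.Icc 0 b₂) = ‖z‖ := by
  have h1 := G.one_lt
  have h2 := G.lt_two
  have hpi := Real.pi_pos
  have hμ1 : Real.pi < μ * Real.pi := by nlinarith
  have hμ2 : μ * Real.pi < 2 * Real.pi := by nlinarith
  have hr := norm_nonneg z
  have e1 := (G.arc₁.infDist_sq (by simp) hK hT hη).1
  have e2 := (G.arc₂.infDist_sq (norm_edge μ) hK hT hη).1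
  rw [inner_one_left μ, max_eq_left] at e1
  · rw [inner_edge, max_eq_left] at e2
    · constructor
      · refine (G.arc₁.infDist_le_norm z).antisymm ?_
        rw [← sq_le_sq₀ hr Metric.infDist_nonneg]
        linarith
      · refine (G.arc₂.infDist_le_norm z).antisymm ?_
        rw [← sq_le_sq₀ hr Metric.infDist_nonneg]
        linarith
    · refine mul_nonpos_of_nonneg_of_nonpos hr ?_
      rw [← Real.cos_neg]
      exact Real.cos_nonpos_of_pi_div_two_le_of_le (by linarith) (by linarith)
  · refine mul_nonpos_of_nonneg_of_nonpos hr ?_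
    exact Real.cos_nonpos_of_pi_div_two_le_of_le hθ (by linarith)

/-- Points making an acute angle with the first edge are closer to the first arc. -/
theorem Geo.exists_infDist_lt (G : Geo Ω μ γ₁ g₁ γ₂ g₂ b₁ b₂ K T η r₀ κ) :
    ∃ δ : ℝ, 0 < δ ∧ ∀ z ∈ Ω, ‖z‖ < δ →
      arg (conj (axis μ) * z) + μ * Real.pi / 2 < Real.pi / 2 →
      Metric.infDist z (γ₁ '' Set.Icc 0 b₁) < Metric.infDist z (γ₂ '' Set.Icc 0 b₂) := by
  have h1 := G.one_lt
  have h2 := G.lt_two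
  have hpi := Real.pi_pos
  have hS := sin_half_pos h1 h2
  have hC := cos_half_neg h1 h2
  have hκ := G.κ_pos
  have hκ1 := G.κ_lt
  have hK := G.arc₁.K_pos
  have hSC := Real.sin_sq_add_cos_sq (μ * Real.pi / 2)
  have hSh : Real.sin (μ * Real.pi / 2) = Real.cos ((μ - 1) * Real.pi / 2) := by
    rw [← Real.cos_sub_pi_div_two]; congr 1; ring
  set S := Real.sin (μ * Real.pi / 2)
  set D := Real.cos (μ * Real.pi / 2)
  set c := (1 - κ ^ 2) * D ^ 2 with hc
  have hκ2 : 0 < 1 - κ ^ 2 := by nlinarith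
  have hc0 : 0 < c := mul_pos hκ2 (sq_pos_of_neg hC)
  have hev := ((eventually_mul_le (40 * K) one_pos).and ((eventually_mul_le 2 G.arc₁.η_pos).and
    ((eventually_mul_le 1 G.arc₁.T_pos).and (eventually_mul_le (20 * K) (mul_pos hS hc0)))))
  obtain ⟨δ, hδ, hev⟩ := exists_pos_forall_mem_Ioo hev
  refine ⟨min δ r₀, lt_min hδ G.r₀_pos, fun z hz hzδ hθ => ?_⟩
  obtain ⟨c1, c2, c3, c4⟩ := hev ‖z‖ (norm_nonneg z) (hzδ.trans_le (min_le_left _ _))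
  have hzr := hzδ.trans_le (min_le_right _ _)
  have hr : 0 < ‖z‖ := norm_pos_iff.2 (G.ne_zero hz)
  rw [one_mul] at c3
  have e1 := (G.arc₁.infDist_sq (by simp) c1 c3 c2).2
  have e2 := (G.arc₂.infDist_sq (norm_edge μ) c1 c3 c2).1
  have hk := G.inner_gt z hz hzr
  have hφ := (abs_lt.1 (G.abs_arg_lt z hz hzr)).1
  have hφπ := neg_pi_lt_arg (conj (axis μ) * z)
  rw [inner_axis] at hk
  rw [inner_one_left μ] at e1
  rw [inner_edge] at e2
  set φ := arg (conj (axis μ) * z)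
  have hμ1 : Real.pi < μ * Real.pi := by nlinarith
  have hφ0 : φ < 0 := by linarith
  have hcosκ : -κ < Real.cos φ := by
    by_contra hcon
    linarith [mul_le_mul_of_nonneg_left (not_lt.1 hcon) hr.le]
  have hcosS : Real.cos φ ≤ S := by
    rw [hSh, ← Real.cos_neg φ]
    exact Real.cos_le_cos_of_nonneg_of_le_pi (by nlinarith) (by linarith) (by linarith)
  have hsin0 : 0 ≤ -Real.sin φ := by
    linarith [Real.sin_nonpos_of_nonpos_of_neg_pi_le hφ0.le hφπ.le]
  have hsin : c ≤ -Real.sin φ := by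
    have a1 := Real.sin_sq_add_cos_sq φ
    have a2 : c ≤ Real.sin φ ^ 2 := by
      rcases le_total 0 (Real.cos φ) with h | h
      · have b1 := pow_le_pow_left₀ h hcosS 2
        have b2 : c ≤ 1 * D ^ 2 :=
          mul_le_mul_of_nonneg_right (by linarith [sq_nonneg κ]) (sq_nonneg _)
        linarith
      · have b1 := pow_le_pow_left₀ (neg_nonneg.2 h) (neg_lt.1 hcosκ).le 2
        have b2 : c ≤ (1 - κ ^ 2) * 1 :=
          mul_le_mul_of_nonneg_left (by linarith [sq_nonneg S]) hκ2.le
        linarith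
    have a3 := Real.neg_one_le_sin φ
    nlinarith
  set p := Real.cos (φ + μ * Real.pi / 2)
  set q := Real.cos (φ - μ * Real.pi / 2)
  have hpq : 2 * (S * c) ≤ p - q := by
    have : p - q = 2 * (S * -Real.sin φ) := by
      simp only [p, q, Real.cos_add, Real.cos_sub]; ring
    rw [this]
    have := mul_le_mul_of_nonneg_left hsin hS.le
    linarith
  have hp0 : 0 < p := Real.cos_pos_of_mem_Ioo ⟨by linarith, hθ⟩
  have hp1 : p ≤ 1 := Real.cos_le_one _
  rw [max_eq_right (by positivity)] at e1
  rw [← sq_lt_sq₀ Metric.infDist_nonneg Metric.infDist_nonneg]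
  refine e1.trans_lt (lt_of_lt_of_le ?_ e2)
  set b := 20 * K * ‖z‖
  have hb : 0 < b := by positivity
  have hb2 : b ≤ 1 / 2 := by linarith
  have hSc := mul_pos hS hc0
  rw [mul_pow, show max 0 (‖z‖ * q) = ‖z‖ * max 0 q by
    rw [mul_max_of_nonneg _ _ hr.le, mul_zero], mul_pow, mul_assoc, mul_assoc]
  refine sub_lt_sub_left (mul_lt_mul_of_pos_left ?_ (by positivity)) _
  rcases le_total q 0 with hq | hq
  · rw [max_eq_left hq, zero_pow two_ne_zero, zero_mul]
    exact mul_pos (by positivity) (by linarith)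
  · rw [max_eq_right hq]
    have a1 : (S * c) * (p + q) < (p - q) * (p + q) :=
      mul_lt_mul_of_pos_right (by linarith) (by linarith)
    have a2 : b * (p + q) ≤ (S * c) * (p + q) := mul_le_mul_of_nonneg_right c4 (by linarith)
    have a3 : b * p * p ≤ b * p * 1 := mul_le_mul_of_nonneg_left hp1 (by positivity)
    have a4 : b * q * q ≤ b * q * 1 := mul_le_mul_of_nonneg_left (by linarith) (by positivity)
    linarith

end

section

theorem abs_log_arcsin_sub_le {μ r d b θ : ℝ} (h1 : 1 < μ) (h2 : μ < 2) (hr : 0 < r) (hd : 0 ≤ d)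
    (hb : 0 ≤ b) (hb' : 24 * b ≤ 1) (hθ : Real.pi / 4 ≤ θ) (hθ' : θ ≤ Real.pi / 2)
    (hlo : r ^ 2 - (r * Real.cos θ) ^ 2 * (1 + b) ≤ d ^ 2)
    (hhi : d ^ 2 ≤ r ^ 2 - (r * Real.cos θ) ^ 2 * (1 - b)) :
    |Real.log (μ * r * Real.sin (Real.arcsin (d / r) / μ)) -
      Real.log (μ * r * Real.sin (θ / μ))| ≤ 24 * b := by
  have hpi := Real.pi_pos
  have hμ : 0 < μ := by linarith
  have hC0 : 0 ≤ Real.cos θ := Real.cos_nonneg_of_mem_Icc ⟨by linarith, hθ'⟩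
  have hC2 : Real.cos θ ^ 2 ≤ 1 / 2 := by
    have h3 := Real.cos_le_cos_of_nonneg_of_le_pi (by linarith) (by linarith) hθ
    have h4 := pow_le_pow_left₀ hC0 h3 2
    rw [Real.cos_pi_div_four, div_pow, Real.sq_sqrt (by norm_num)] at h4
    linarith
  set x := d / r with hx
  have hx0 : 0 ≤ x := div_nonneg hd hr.le
  have hdx : d = r * x := by rw [hx]; field_simp
  set c := Real.cos θ with hc
  have hr2 : 0 < r ^ 2 := by positivity
  have hlo' : 1 - x ^ 2 ≤ c ^ 2 * (1 + b) := by
    rw [hdx] at hlo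
    refine le_of_mul_le_mul_left ?_ hr2
    linarith
  have hhi' : c ^ 2 * (1 - b) ≤ 1 - x ^ 2 := by
    rw [hdx] at hhi
    refine le_of_mul_le_mul_left ?_ hr2
    linarith
  have hc2 := sq_nonneg c
  have hx2 : 0 ≤ 1 - x ^ 2 := (mul_nonneg hc2 (by linarith)).trans hhi'
  set y := √(1 - x ^ 2) with hy
  have hy0 : 0 ≤ y := Real.sqrt_nonneg _
  have hy2 : y ^ 2 = 1 - x ^ 2 := Real.sq_sqrt hx2
  have hyc : |y - c| ≤ b := by
    have hc1 : c ≤ 1 := Real.cos_le_one _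
    have hcb : c * b ≤ 1 * b := mul_le_mul_of_nonneg_right hc1 hb
    have e1 : y ≤ c * (1 + b) := by
      rw [← sq_le_sq₀ hy0 (mul_nonneg hC0 (by linarith)), hy2, mul_pow]
      exact hlo'.trans (mul_le_mul_of_nonneg_left (by nlinarith) hc2)
    have e2 : c * (1 - b) ≤ y := by
      rw [← sq_le_sq₀ (mul_nonneg hC0 (by linarith)) hy0, hy2, mul_pow]
      exact (mul_le_mul_of_nonneg_left (by nlinarith) hc2).trans hhi'
    exact abs_le.2 ⟨by linarith, by linarith⟩
  have hc9 : c ≤ 9 / 10 := by nlinarith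
  have hy9 : y ≤ 9 / 10 := by
    have := mul_le_mul_of_nonneg_right hC2 (by linarith : 0 ≤ 1 + b)
    nlinarith
  have hθe : θ = Real.pi / 2 - Real.arcsin c := by
    rw [hc, ← Real.sin_pi_div_two_sub, Real.arcsin_sin (by linarith) (by linarith)]; ring
  have hθx : Real.arcsin x = Real.pi / 2 - Real.arcsin y := by
    have := Real.arccos_eq_arcsin hx0
    rw [Real.arccos] at this
    rw [← hy] at this
    linarith
  have hdiff : |Real.arcsin x - θ| ≤ 3 * b := by
    rw [hθx, hθe, sub_sub_sub_cancel_left, abs_sub_comm]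
    exact (abs_arcsin_sub_arcsin_le ⟨hy0, hy9⟩ ⟨hC0, hc9⟩).trans (by linarith)
  have hsin : |Real.sin (Real.arcsin x / μ) - Real.sin (θ / μ)| ≤ 3 * b := by
    refine (Real.abs_sin_sub_sin_le _ _).trans ?_
    rw [← sub_div, abs_div, abs_of_pos hμ]
    exact (div_le_self (abs_nonneg _) h1.le).trans hdiff
  have hs4 : 1 / 4 ≤ Real.sin (θ / μ) := by
    have hle : θ / μ ≤ Real.pi / 2 := (div_le_self (by linarith) h1.le).trans hθ'
    refine le_trans ?_ (Real.mul_le_sin (div_nonneg (by linarith) hμ.le) hle)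
    have : Real.pi / 8 ≤ θ / μ := by
      rw [le_div_iff₀ hμ]; nlinarith
    calc (1 : ℝ) / 4 = 2 / Real.pi * (Real.pi / 8) := by field_simp; norm_num
      _ ≤ _ := by gcongr
  have hs8 : 1 / 8 ≤ Real.sin (Real.arcsin x / μ) := by linarith [(abs_le.1 hsin).1]
  have hμr : μ * r ≠ 0 := by positivity
  rw [Real.log_mul hμr (by linarith), Real.log_mul hμr (by linarith), add_sub_add_left_eq_sub]
  refine (abs_log_sub_log_le (by norm_num) hs8 (by linarith)).trans ?_
  linarith

variable {Ω : Set ℂ} {μ : ℝ} {γ₁ g₁ γ₂ g₂ : ℝ → ℂ} {b₁ b₂ K T η r₀ κ : ℝ}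

/-- Barriers at the points away from the arcs. -/
theorem Geo.exists_middle (G : Geo Ω μ γ₁ g₁ γ₂ g₂ b₁ b₂ K T η r₀ κ) :
    ∃ C δ : ℝ, 0 < C ∧ 0 < δ ∧ ∀ z ∈ Ω, ‖z‖ < δ →
      Real.pi / 4 ≤ arg (conj (axis μ) * z) + μ * Real.pi / 2 → arg (conj (axis μ) * z) ≤ 0 →
      ∃ x y, UpperVal Ω μ z x ∧ LowerVal Ω μ z y ∧
        |x - -Real.log (μ * ‖z‖ * Real.cos (arg (conj (axis μ) * z) / μ))| ≤ C * ‖z‖ ∧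
        |y - -Real.log (μ * ‖z‖ * Real.cos (arg (conj (axis μ) * z) / μ))| ≤ C * ‖z‖ := by
  have h1 := G.one_lt
  have h2 := G.lt_two
  have hS := sin_half_pos h1 h2
  have hpi := Real.pi_pos
  obtain ⟨R, L, δ₀, hR, hL, hδ₀, hδT, hlune⟩ := G.exists_lune
  have hlune := hlune 0 ⟨le_rfl, hδ₀.le⟩
  have hone : ∀ {a m : ℂ}, ‖a‖ ≤ L * 0 ^ 2 → ‖m - 1‖ ≤ L * 0 → a = 0 ∧ m = 1 := by
    intro a m ha hm
    rw [zero_pow two_ne_zero, mul_zero] at ha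
    rw [mul_zero] at hm
    exact ⟨norm_le_zero_iff.1 ha, sub_eq_zero.1 (norm_le_zero_iff.1 hm)⟩
  obtain ⟨a, m, -, -, ha, hm1, -, hout⟩ := hlune (-1) (Or.inr rfl)
  obtain ⟨rfl, rfl⟩ := hone ha hm1
  obtain ⟨a, m, -, -, ha, hm1, hin, -⟩ := hlune 1 (Or.inl rfl)
  obtain ⟨rfl, rfl⟩ := hone ha hm1
  obtain ⟨ε₀, hε₀, hout⟩ := hout rfl
  obtain ⟨ε₁, hε₁, hin⟩ := hin rfl
  set S := Real.sin (μ * Real.pi / 2) with hSdef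
  set B := 1 / (2 * R) / S with hB
  have hB0 : 0 < B := by positivity
  have hev := ((eventually_mul_le (32 * B) one_pos).and
    (eventually_mul_le (1 / (2 * R)) (d := 1 / 2 * S) (by positivity)))
  obtain ⟨δ, hδ, hev⟩ := exists_pos_forall_mem_Ioo hev
  refine ⟨34 * B, δ, by positivity, hδ, fun z hz hzδ hθ hφ => ?_⟩
  obtain ⟨c1, c2⟩ := hev ‖z‖ (norm_nonneg z) hzδ
  have hz0 := G.ne_zero hz
  have hr : 0 < ‖z‖ := norm_pos_iff.2 hz0
  have hmem := mem_lune_of_shift G.isOpen hε₀ hout hz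
  have hbound : ∀ τ : ℝ, |τ| = 1 / (2 * R) →
      |luneSol μ 0 1 τ z - -Real.log (μ * ‖z‖ * Real.cos (arg (conj (axis μ) * z) / μ))| ≤
        34 * B * ‖z‖ := by
    intro τ hτ
    unfold luneSol
    rw [neg_sub_neg, abs_sub_comm, map_one, one_mul, sub_zero]
    refine (abs_log_coneFn_sub_le (β := B * ‖z‖) h1 h2 hz0 (by linarith) ?_ ?_).trans (by linarith)
    · refine (norm_bend_sub_le h1 h2 τ z).trans (le_of_eq ?_)
      rw [hτ, pow_two, ← mul_assoc]
    · rw [abs_of_nonpos hφ]; linarith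
  have hsin : 1 / 2 * S < Real.sin (arg (conj (axis μ) * z) + μ * Real.pi / 2) := by
    have hμ1 : Real.pi < μ * Real.pi := by nlinarith
    have hμ2 : μ * Real.pi < 2 * Real.pi := by nlinarith
    rcases le_total (arg (conj (axis μ) * z) + μ * Real.pi / 2) (Real.pi / 2) with h | h
    · have e1 := Real.sin_le_sin_of_le_of_le_pi_div_two (by linarith) h hθ
      have e2 := seven_tenths_le_cos (θ := Real.pi / 4) (by rw [abs_of_pos (by positivity)])
      rw [Real.cos_pi_div_four, ← Real.sin_pi_div_four] at e2
      linarith [Real.sin_le_one (μ * Real.pi / 2)]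
    · have e1 : S ≤ Real.sin (arg (conj (axis μ) * z) + μ * Real.pi / 2) := by
        rw [hSdef, ← Real.sin_pi_sub, ← Real.sin_pi_sub (_ + _)]
        exact Real.sin_le_sin_of_le_of_le_pi_div_two (by linarith) (by linarith) (by linarith)
      linarith
  have hmem' : z ∈ lune μ 0 1 (1 / (2 * R)) := by
    rw [mem_lune_iff h1 h2 norm_one]
    left
    have e1 : inner ℝ (I * 1) (z - 0) = z.im := by simp [Complex.inner]
    rw [e1, sub_zero, im_eq_norm_mul_sin μ z, pow_two, mul_comm, mul_assoc, mul_comm ‖z‖ (1 / _)]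
    exact mul_lt_mul_of_pos_left (c2.trans_lt hsin) hr
  exact ⟨_, _, ⟨0, 1, _, _, ε₁, norm_one, by positivity, hε₁, hin, hmem', rfl⟩,
    ⟨0, 1, _, _, ε₀, norm_one, hε₀, hout, hmem, rfl⟩, hbound _ (abs_of_pos (by positivity)),
    hbound _ (by rw [abs_neg, abs_of_pos (by positivity)])⟩

/-- Barriers on the half of the corner adjacent to the first arc. -/
theorem Geo.exists_half (G : Geo Ω μ γ₁ g₁ γ₂ g₂ b₁ b₂ K T η r₀ κ) :
    ∃ C δ : ℝ, 0 < C ∧ 0 < δ ∧ ∀ z ∈ Ω, ‖z‖ < δ → arg (conj (axis μ) * z) ≤ 0 →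
      ∃ x y f, UpperVal Ω μ z x ∧ LowerVal Ω μ z y ∧
        |x - f| ≤ C * Metric.infDist z (γ₁ '' Set.Icc 0 b₁) ∧
        |y - f| ≤ C * Metric.infDist z (γ₁ '' Set.Icc 0 b₁) ∧
        ((Metric.infDist z (γ₁ '' Set.Icc 0 b₁) < Metric.infDist z (γ₂ '' Set.Icc 0 b₂) ∧
            f = -Real.log (μ * ‖z‖ * Real.sin
              (Real.arcsin (Metric.infDist z (γ₁ '' Set.Icc 0 b₁) / ‖z‖) / μ))) ∨
          (Metric.infDist z (γ₁ '' Set.Icc 0 b₁) = Metric.infDist z (γ₂ '' Set.Icc 0 b₂) ∧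
            Real.pi / 2 ≤ arg (conj (axis μ) * z) + μ * Real.pi / 2 ∧
            f = -Real.log (μ * ‖z‖ *
              Real.sin ((arg (conj (axis μ) * z) + μ * Real.pi / 2) / μ)))) := by
  have h1 := G.one_lt
  have h2 := G.lt_two
  have hK := G.arc₁.K_pos
  have hpi := Real.pi_pos
  obtain ⟨C₁, δ₁, hC₁, hδ₁, hnear⟩ := G.exists_near
  obtain ⟨C₂, δ₂, hC₂, hδ₂, hmid⟩ := G.exists_middle
  obtain ⟨δ₃, hδ₃, hlt⟩ := G.exists_infDist_lt
  have hev := ((eventually_mul_le (480 * K) one_pos).and ((eventually_mul_le 2 G.arc₁.η_pos).and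
    ((eventually_mul_le 1 G.arc₁.T_pos).and ((eventually_mul_le 2 hδ₁).and
      ((eventually_mul_le 2 hδ₂).and ((eventually_mul_le 2 hδ₃).and
        (eventually_mul_le 2 G.r₀_pos)))))))
  obtain ⟨δ, hδ, hev⟩ := exists_pos_forall_mem_Ioo hev
  set C := C₁ + 2 * C₂ + 960 * K with hC
  refine ⟨C, δ, by positivity, hδ, fun z hz hzδ hφ => ?_⟩
  obtain ⟨c1, c2, c3, c4, c5, c6, c7⟩ := hev ‖z‖ (norm_nonneg z) hzδ
  have hr : 0 < ‖z‖ := norm_pos_iff.2 (G.ne_zero hz)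
  rw [one_mul] at c3
  have hsq := G.arc₁.infDist_sq (by simp) (z := z) (by linarith) c3 c2
  have hlt := hlt z hz (by linarith)
  have hd0 : 0 ≤ Metric.infDist z (γ₁ '' Set.Icc 0 b₁) := Metric.infDist_nonneg
  by_cases hθ : arg (conj (axis μ) * z) + μ * Real.pi / 2 < Real.pi / 4
  · have hlow := (abs_lt.1 (G.abs_arg_lt z hz (by linarith))).1
    obtain ⟨x, y, f, hx, hy, hf, hxf, hyf⟩ := hnear z hz (by linarith) (abs_lt.2 ⟨by linarith, hθ⟩)
    have hle : C₁ * Metric.infDist z (γ₁ '' Set.Icc 0 b₁) ≤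
        C * Metric.infDist z (γ₁ '' Set.Icc 0 b₁) :=
      mul_le_mul_of_nonneg_right (by linarith) hd0
    exact ⟨x, y, f, hx, hy, hxf.trans hle, hyf.trans hle, Or.inl ⟨hlt (by linarith), hf⟩⟩
  rw [not_lt] at hθ
  obtain ⟨x, y, hx, hy, hxf, hyf⟩ := hmid z hz (by linarith) hθ hφ
  rw [show arg (conj (axis μ) * z) / μ =
      (arg (conj (axis μ) * z) + μ * Real.pi / 2) / μ - Real.pi / 2 by field_simp; ring,
    Real.cos_sub_pi_div_two] at hxf hyf
  by_cases hθ2 : arg (conj (axis μ) * z) + μ * Real.pi / 2 < Real.pi / 2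
  · rw [inner_one_left μ] at hsq
    set θ := arg (conj (axis μ) * z) + μ * Real.pi / 2
    have hc0 : 0 ≤ Real.cos θ := Real.cos_nonneg_of_mem_Icc ⟨by linarith, hθ2.le⟩
    rw [max_eq_right (by positivity)] at hsq
    set d := Metric.infDist z (γ₁ '' Set.Icc 0 b₁)
    have hd : ‖z‖ / 2 ≤ d := by
      rw [← sq_le_sq₀ (by positivity) hd0]
      have h3 := Real.cos_le_cos_of_nonneg_of_le_pi (by linarith) (by linarith) hθ
      have h4 := pow_le_pow_left₀ hc0 h3 2
      rw [Real.cos_pi_div_four, div_pow, Real.sq_sqrt (by norm_num)] at h4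
      have h5 : (‖z‖ * Real.cos θ) ^ 2 * (1 + 20 * K * ‖z‖) ≤ ‖z‖ ^ 2 * (2 / 2 ^ 2) * (3 / 2) := by
        rw [mul_pow]
        gcongr
        linarith
      linarith [hsq.1]
    have hlog := abs_log_arcsin_sub_le h1 h2 hr hd0 (by positivity) (by linarith) hθ hθ2.le
      hsq.1 hsq.2
    have hfin : ∀ v : ℝ, |v - -Real.log (μ * ‖z‖ * Real.sin (θ / μ))| ≤ C₂ * ‖z‖ →
        |v - -Real.log (μ * ‖z‖ * Real.sin (Real.arcsin (d / ‖z‖) / μ))| ≤ C * d := by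
      intro v hv
      have e1 := abs_add_le (v - -Real.log (μ * ‖z‖ * Real.sin (θ / μ)))
        (Real.log (μ * ‖z‖ * Real.sin (Real.arcsin (d / ‖z‖) / μ)) -
          Real.log (μ * ‖z‖ * Real.sin (θ / μ)))
      rw [show ∀ a b c : ℝ, a - -b + (c - b) = a - -c by intros; ring] at e1
      have e2 := mul_le_mul_of_nonneg_left hd hC₂.le
      have e3 := mul_le_mul_of_nonneg_left hd hK.le
      have e4 := mul_nonneg hC₁.le hd0
      linarith
    exact ⟨x, y, _, hx, hy, hfin x hxf, hfin y hyf, Or.inl ⟨hlt hθ2, rfl⟩⟩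
  · rw [not_lt] at hθ2
    obtain ⟨d1, d2⟩ := G.infDist_eq_norm (by linarith) c3 c2 hθ2 hφ
    rw [d1, d2]
    have hle : C₂ * ‖z‖ ≤ C * ‖z‖ := mul_le_mul_of_nonneg_right (by linarith) hr.le
    exact ⟨x, y, _, hx, hy, hxf.trans hle, hyf.trans hle, Or.inr ⟨rfl, hθ2, rfl⟩⟩

end

section

/-- The reflection across the axis of the cone. -/
noncomputable def mirror (μ : ℝ) : ℂ ≃ₗᵢ[ℝ] ℂ :=
  conjLIE.trans (rotation (Circle.exp (μ * Real.pi)))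

theorem mirror_apply (μ : ℝ) (z : ℂ) : mirror μ z = edge μ * conj z := by
  simp [mirror, edge, rotation_apply, Circle.coe_exp]

theorem mirror_mirror (μ : ℝ) (z : ℂ) : mirror μ (mirror μ z) = z := by
  rw [mirror_apply, mirror_apply, map_mul, conj_conj, ← mul_assoc, mul_comm (edge μ),
    conj_mul_self_of_norm_one (norm_edge μ), one_mul]

theorem mirror_one (μ : ℝ) : mirror μ 1 = edge μ := by rw [mirror_apply, map_one, mul_one]

theorem mirror_edge (μ : ℝ) : mirror μ (edge μ) = 1 := by rw [← mirror_one, mirror_mirror]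

theorem mirror_axis (μ : ℝ) : mirror μ (axis μ) = axis μ := by rw [mirror_apply, edge_mul_conj_axis]

theorem mirror_mem_cone {μ : ℝ} {P : ℂ} : mirror μ P ∈ cone μ ↔ P ∈ cone μ := by
  show 0 < (mirror μ P).im ∨ 0 < (edge μ * conj (mirror μ P)).im ↔ 0 < P.im ∨ 0 < (edge μ * conj P).im
  rw [← mirror_apply, ← mirror_apply, mirror_mirror, or_comm]

theorem conj_axis_mul_mirror (μ : ℝ) (z : ℂ) :
    conj (axis μ) * mirror μ z = conj (conj (axis μ) * z) := by
  rw [mirror_apply, map_mul, conj_conj, ← mul_assoc, mul_comm _ (edge μ), edge_mul_conj_axis]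

theorem abs_arg_conj (z : ℂ) : |arg (conj z)| = |arg z| := by
  rw [arg_conj]
  split_ifs with h
  · rw [h]
  · rw [abs_neg]

theorem coneFn_mirror (μ : ℝ) (P : ℂ) : coneFn μ (mirror μ P) = coneFn μ P := by
  unfold coneFn
  rw [LinearIsometryEquiv.norm_map, conj_axis_mul_mirror, arg_conj]
  split_ifs with h
  · rw [h]
  · rw [neg_div, Real.cos_neg]

theorem conj_mul_mirror_sub (μ : ℝ) (a m z : ℂ) :
    conj m * (mirror μ z - a) = mirror μ (conj (conj m) * (z - mirror μ a)) := by
  rw [mirror_apply μ (_ * _), map_mul, conj_conj, mul_left_comm, ← mirror_apply, map_sub,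
    mirror_mirror]

theorem bend_mirror (μ τ : ℝ) (Y : ℂ) : bend μ τ (mirror μ Y) = mirror μ (bend μ τ Y) := by
  rw [mirror_apply, mirror_apply, edge_mul_conj_bend]

theorem lune_mirror (μ : ℝ) (a m : ℂ) (τ : ℝ) :
    lune μ (mirror μ a) (conj m) τ = mirror μ ⁻¹' lune μ a m τ := by
  ext z
  show bend μ τ _ ∈ cone μ ↔ bend μ τ (conj m * (mirror μ z - a)) ∈ cone μ
  rw [conj_mul_mirror_sub, bend_mirror, mirror_mem_cone]

theorem luneSol_mirror (μ : ℝ) (a m : ℂ) (τ : ℝ) (z : ℂ) :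
    luneSol μ (mirror μ a) (conj m) τ z = luneSol μ a m τ (mirror μ z) := by
  unfold luneSol
  rw [conj_mul_mirror_sub, bend_mirror, coneFn_mirror]

theorem closure_mirror (μ : ℝ) (s : Set ℂ) : closure (mirror μ ⁻¹' s) = mirror μ ⁻¹' closure s :=
  ((mirror μ).toHomeomorph.preimage_closure s).symm

theorem frontier_mirror (μ : ℝ) (s : Set ℂ) : frontier (mirror μ ⁻¹' s) = mirror μ ⁻¹' frontier s :=
  ((mirror μ).toHomeomorph.preimage_frontier s).symm

theorem mirror_preimage_preimage (μ : ℝ) (s : Set ℂ) : mirror μ ⁻¹' (mirror μ ⁻¹' s) = s := by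
  ext z
  simp [mirror_mirror]

theorem UpperVal.of_mirror {Ω : Set ℂ} {μ : ℝ} {z : ℂ} {x : ℝ}
    (h : UpperVal (mirror μ ⁻¹' Ω) μ (mirror μ z) x) : UpperVal Ω μ z x := by
  obtain ⟨a, m, w, τ, ε₀, hm, hτ, hε₀, hcl, hz, hx⟩ := h
  refine ⟨mirror μ a, conj m, mirror μ w, τ, ε₀, by rwa [norm_conj], hτ,
    hε₀, fun ε h0 h1 => ?_, ?_, ?_⟩
  · rw [← map_smul, ← map_add, lune_mirror, closure_mirror]
    exact (Set.preimage_mono (hcl ε h0 h1)).trans (mirror_preimage_preimage μ Ω).subset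
  · rwa [lune_mirror]
  · rwa [luneSol_mirror]

theorem LowerVal.of_mirror {Ω : Set ℂ} {μ : ℝ} {z : ℂ} {x : ℝ}
    (h : LowerVal (mirror μ ⁻¹' Ω) μ (mirror μ z) x) : LowerVal Ω μ z x := by
  obtain ⟨a, m, w, τ, ε₀, hm, hε₀, hcl, hz, hx⟩ := h
  refine ⟨mirror μ a, conj m, mirror μ w, τ, ε₀, by rwa [norm_conj],
    hε₀, fun ε h0 h1 => ?_, ?_, ?_⟩
  · rw [← map_smul, ← map_add, lune_mirror, ← mirror_preimage_preimage μ Ω, closure_mirror]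
    exact Set.preimage_mono (hcl ε h0 h1)
  · rwa [lune_mirror]
  · rwa [luneSol_mirror]

theorem infDist_mirror (μ : ℝ) (γ : ℝ → ℂ) (s : Set ℝ) (z : ℂ) :
    Metric.infDist (mirror μ z) ((fun t => mirror μ (γ t)) '' s) = Metric.infDist z (γ '' s) := by
  rw [← Function.comp_def, Set.image_comp]
  exact Metric.infDist_image (mirror μ).isometry

theorem inner_axis_mirror (μ : ℝ) (z : ℂ) :
    inner ℝ (axis μ) (mirror μ z) = inner ℝ (axis μ) z := by
  conv_lhs => rw [← mirror_axis μ]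
  exact (mirror μ).inner_map_map _ _

variable {γ g : ℝ → ℂ} {e : ℂ} {b K T η : ℝ}

theorem Arc.mirrored (h : Arc γ g e b K T η) (μ : ℝ) :
    Arc (fun t => mirror μ (γ t)) (fun t => mirror μ (g t)) (mirror μ e) b K T η where
  T_pos := h.T_pos
  T_le := h.T_le
  K_pos := h.K_pos
  η_pos := h.η_pos
  KT := h.KT
  zero := by rw [h.zero, map_zero]
  g_zero := by rw [h.g_zero]
  norm_g t ht := by rw [LinearIsometryEquiv.norm_map, h.norm_g t ht]
  deriv t :=
    (mirror μ).toContinuousLinearEquiv.toContinuousLinearMap.hasFDerivAt.comp_hasDerivAt t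
      (h.deriv t)
  lip t ht t' ht' := by
    rw [← map_sub, LinearIsometryEquiv.norm_map]; exact h.lip t ht t' ht'
  taylor t ht t' ht' := by
    rw [← map_sub, ← map_smul, ← map_sub, LinearIsometryEquiv.norm_map]; exact h.taylor t ht t' ht'
  far t ht := by rw [LinearIsometryEquiv.norm_map]; exact h.far t ht

variable {Ω : Set ℂ} {μ : ℝ} {γ₁ g₁ γ₂ g₂ : ℝ → ℂ} {b₁ b₂ r₀ κ : ℝ}

theorem Geo.mirrored (G : Geo Ω μ γ₁ g₁ γ₂ g₂ b₁ b₂ K T η r₀ κ) :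
    Geo (mirror μ ⁻¹' Ω) μ (fun t => mirror μ (γ₂ t)) (fun t => mirror μ (g₂ t))
      (fun t => mirror μ (γ₁ t)) (fun t => mirror μ (g₁ t)) b₂ b₁ K T η r₀ κ where
  one_lt := G.one_lt
  lt_two := G.lt_two
  arc₁ := by simpa only [mirror_edge] using G.arc₂.mirrored μ
  arc₂ := by simpa only [mirror_one] using G.arc₁.mirrored μ
  KT₁ := G.KT₁
  KT₂ := G.KT₂
  isOpen := G.isOpen.preimage (mirror μ).continuous
  zero_mem := by
    rw [frontier_mirror, Set.mem_preimage, map_zero]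
    exact G.zero_mem
  r₀_pos := G.r₀_pos
  κ_pos := G.κ_pos
  κ_lt := G.κ_lt
  frontier_subset q hq hqr := by
    rw [frontier_mirror] at hq
    rcases G.frontier_subset _ hq (by rwa [LinearIsometryEquiv.norm_map]) with ⟨t, ht, h⟩ | ⟨t, ht, h⟩
    · exact Or.inr ⟨t, ht, by dsimp only; rw [h, mirror_mirror]⟩
    · exact Or.inl ⟨t, ht, by dsimp only; rw [h, mirror_mirror]⟩
  inner_mem z hz h := G.inner_mem _ (by rwa [LinearIsometryEquiv.norm_map])
    (by rwa [inner_axis_mirror])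
  inner_gt z hz h := by
    have := G.inner_gt _ hz (by rwa [LinearIsometryEquiv.norm_map])
    rwa [inner_axis_mirror, LinearIsometryEquiv.norm_map] at this
  abs_arg_lt z hz h := by
    have := G.abs_arg_lt _ hz (by rwa [LinearIsometryEquiv.norm_map])
    rwa [conj_axis_mul_mirror, abs_arg_conj] at this

end

section

theorem polarAngle_eq {z : ℂ} {ρ θ : ℝ} (hρ : 0 < ρ) (h0 : 0 < θ) (h2 : θ ≤ 2 * Real.pi)
    (hz : z = ρ * exp (θ * I)) : polarAngle z = θ := by
  have hpi := Real.pi_pos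
  unfold polarAngle
  rcases le_or_gt θ Real.pi with h | h
  · have : arg z = θ := by
      rw [hz, exp_mul_I, arg_mul_cos_add_sin_mul_I hρ ⟨by linarith, h⟩]
    rw [this, if_pos h0]
  · have : arg z = θ - 2 * Real.pi := by
      have hz' : z = ρ * exp ((θ - 2 * Real.pi : ℝ) * I) := by
        rw [hz]
        congr 1
        rw [exp_eq_exp_iff_exists_int]
        exact ⟨1, by push_cast; ring⟩
      rw [hz', exp_mul_I, arg_mul_cos_add_sin_mul_I hρ ⟨by linarith, by linarith⟩]
    rw [this, if_neg (by linarith)]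
    ring

variable {Ω : Set ℂ} {μ : ℝ} {γ₁ g₁ γ₂ g₂ : ℝ → ℂ} {b₁ b₂ K T η r₀ κ : ℝ}

theorem Geo.min_infDist_le (G : Geo Ω μ γ₁ g₁ γ₂ g₂ b₁ b₂ K T η r₀ κ) {z : ℂ}
    (hz : 2 * ‖z‖ ≤ r₀) :
    min (Metric.infDist z (γ₁ '' Set.Icc 0 b₁)) (Metric.infDist z (γ₂ '' Set.Icc 0 b₂)) ≤
      Metric.infDist z (frontier Ω) := by
  rw [Metric.le_infDist ⟨0, G.zero_mem⟩]
  intro q hq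
  rcases lt_or_ge ‖q‖ r₀ with h | h
  · rcases G.frontier_subset q hq h with h | h
    · exact (min_le_left _ _).trans (Metric.infDist_le_dist_of_mem h)
    · exact (min_le_right _ _).trans (Metric.infDist_le_dist_of_mem h)
  · refine (min_le_left _ _).trans ((G.arc₁.infDist_le_norm z).trans ?_)
    rw [dist_comm, dist_eq_norm]
    linarith [norm_sub_norm_le q z]

theorem Geo.exists_bound (G : Geo Ω μ γ₁ g₁ γ₂ g₂ b₁ b₂ K T η r₀ κ)
    (hb : Bornology.IsBounded Ω) {u : ℂ → ℝ} (hu : ∀ z ∈ Ω, ContDiffAt ℝ 2 u z)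
    (hue : ∀ z ∈ Ω, lap u z = Real.exp (2 * u z))
    (hbd : ∀ p ∈ frontier Ω, Tendsto u (𝓝[Ω] p) atTop) :
    ∃ δ C : ℝ, 0 < δ ∧ 0 < C ∧ ∀ z ∈ Ω ∩ Metric.ball 0 δ,
      |u z - fMu μ (γ₁ '' Set.Icc 0 b₁) (γ₂ '' Set.Icc 0 b₂) z|
        ≤ C * Metric.infDist z (frontier Ω) := by
  have h1 := G.one_lt
  have h2 := G.lt_two
  have hpi := Real.pi_pos
  have hμ : 0 < μ := by linarith
  have hμπ : μ * Real.pi < 2 * Real.pi := by nlinarith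
  have hle : ∀ z x, UpperVal Ω μ z x → u z ≤ x := by
    rintro z _ ⟨a, m, w, τ, ε₀, hm, hτ, hε₀, hcl, hz, rfl⟩
    exact le_luneSol_of_shift h1 h2 hm hτ hu hue hε₀ hcl hz
  have hge : ∀ z x, z ∈ Ω → LowerVal Ω μ z x → x ≤ u z := by
    rintro z _ hzΩ ⟨a, m, w, τ, ε₀, hm, hε₀, hcl, hz, rfl⟩
    exact luneSol_le_of_shift h1 h2 hm G.isOpen hb hu hue hbd hε₀ hcl hzΩ hz
  have habs : ∀ {v x y f c : ℝ}, y ≤ v → v ≤ x → |x - f| ≤ c → |y - f| ≤ c → |v - f| ≤ c := by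
    intro v x y f c hy hx hxf hyf
    exact abs_le.2 ⟨by linarith [(abs_le.1 hyf).1], by linarith [(abs_le.1 hxf).2]⟩
  obtain ⟨C₁, δ₁, hC₁, hδ₁, H₁⟩ := G.exists_half
  obtain ⟨C₂, δ₂, hC₂, hδ₂, H₂⟩ := G.mirrored.exists_half
  have hr₀ := G.r₀_pos
  refine ⟨min (min δ₁ δ₂) (r₀ / 2), C₁ + C₂, by positivity, by positivity, ?_⟩
  rintro z ⟨hz, hzδ⟩
  rw [mem_ball_zero_iff, lt_min_iff, lt_min_iff] at hzδ
  obtain ⟨⟨hz1, hz2⟩, hz3⟩ := hzδ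
  have hmin := G.min_infDist_le (z := z) (by linarith)
  have hr : 0 < ‖z‖ := norm_pos_iff.2 (G.ne_zero hz)
  have hpolar := polar_of_arg μ z
  have hlow := (abs_lt.1 (G.abs_arg_lt z hz (by linarith)))
  have hfront : 0 ≤ Metric.infDist z (frontier Ω) := Metric.infDist_nonneg
  have harg : arg (conj (axis μ) * z) ≠ Real.pi := by
    intro h
    have e1 := G.inner_gt z hz (by linarith)
    rw [inner_axis, h, Real.cos_pi] at e1
    have := mul_lt_mul_of_pos_right G.κ_lt hr
    linarith
  rcases le_total (arg (conj (axis μ) * z)) 0 with hφ | hφ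
  · obtain ⟨x, y, f, hx, hy, hxf, hyf, hf⟩ := H₁ z hz hz1 hφ
    have key := habs (hge z y hz hy) (hle z x hx) hxf hyf
    have hf' : f = fMu μ (γ₁ '' Set.Icc 0 b₁) (γ₂ '' Set.Icc 0 b₂) z ∧
        Metric.infDist z (γ₁ '' Set.Icc 0 b₁) ≤ Metric.infDist z (γ₂ '' Set.Icc 0 b₂) := by
      rcases hf with ⟨hlt, hf⟩ | ⟨heq, hθ, hf⟩
      · exact ⟨by rw [hf, fMu, if_pos hlt], hlt.le⟩
      · refine ⟨?_, heq.le⟩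
        rw [hf, fMu, if_neg heq.not_lt, if_neg heq.not_gt,
          polarAngle_eq hr (by linarith) (by linarith) hpolar]
    rw [← hf'.1]
    rw [min_eq_left hf'.2] at hmin
    refine key.trans ?_
    have := mul_le_mul_of_nonneg_left hmin hC₁.le
    have := mul_nonneg hC₂.le hfront
    linarith
  · have hφ' : arg (conj (axis μ) * mirror μ z) = -arg (conj (axis μ) * z) := by
      rw [conj_axis_mul_mirror, arg_conj, if_neg harg]
    obtain ⟨x, y, f, hx, hy, hxf, hyf, hf⟩ := H₂ (mirror μ z)
      (by rwa [Set.mem_preimage, mirror_mirror]) (by rwa [LinearIsometryEquiv.norm_map])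
      (by rw [hφ']; linarith)
    rw [infDist_mirror] at hxf hyf hf
    rw [infDist_mirror, LinearIsometryEquiv.norm_map, hφ'] at hf
    have key := habs (hge z y hz hy.of_mirror) (hle z x hx.of_mirror) hxf hyf
    have hf' : f = fMu μ (γ₁ '' Set.Icc 0 b₁) (γ₂ '' Set.Icc 0 b₂) z ∧
        Metric.infDist z (γ₂ '' Set.Icc 0 b₂) ≤ Metric.infDist z (γ₁ '' Set.Icc 0 b₁) := by
      rcases hf with ⟨hlt, hf⟩ | ⟨heq, hθ, hf⟩
      · exact ⟨by rw [hf, fMu, if_neg hlt.not_gt, if_pos hlt], hlt.le⟩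
      · refine ⟨?_, heq.le⟩
        rw [hf, fMu, if_neg heq.not_gt, if_neg heq.not_lt,
          polarAngle_eq hr (by linarith) (by linarith) hpolar, ← Real.sin_pi_sub]
        congr 4
        field_simp
        ring
    rw [← hf'.1]
    rw [min_eq_right hf'.2] at hmin
    refine key.trans ?_
    have := mul_le_mul_of_nonneg_left hmin hC₂.le
    have := mul_nonneg hC₁.le hfront
    linarith

end

theorem exists_arc {γ : ℝ → ℂ} {b : ℝ} (hγ : ContDiff ℝ 2 γ) (h0 : γ 0 = 0) (hb : 0 < b)
    (hinj : Set.InjOn γ (Set.Icc 0 b)) (hunit : ∀ t ∈ Set.Icc 0 b, ‖deriv γ t‖ = 1) :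
    ∃ K₀ : ℝ, 0 < K₀ ∧ ∀ K, K₀ ≤ K → ∀ T, 0 < T → T ≤ b → K * T ≤ 1 / 4 →
      ∃ η₀ : ℝ, 0 < η₀ ∧ ∀ η, 0 < η → η ≤ η₀ → Arc γ (deriv γ) (deriv γ 0) b K T η := by
  have hd : ∀ t, HasDerivAt γ (deriv γ t) t := fun t =>
    (hγ.differentiable two_ne_zero).differentiableAt.hasDerivAt
  have hγ' : ContDiff ℝ 1 (deriv γ) := by
    have h : ContDiff ℝ (1 + 1) γ := hγ
    exact (contDiff_succ_iff_deriv.1 h).2.2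
  have hdd : ∀ t, HasDerivAt (deriv γ) (deriv (deriv γ) t) t := fun t =>
    (hγ'.differentiable one_ne_zero).differentiableAt.hasDerivAt
  obtain ⟨C, hC⟩ := isCompact_Icc.exists_bound_of_continuousOn (s := Set.Icc 0 b)
    (hγ'.continuous_deriv le_rfl).continuousOn
  refine ⟨max C 1, by positivity, fun K hK T hT hTb hKT => ?_⟩
  have hCK : C ≤ K := (le_max_left _ _).trans hK
  have hK0 : 0 < K := lt_of_lt_of_le (by positivity) hK
  have hlip : ∀ t ∈ Set.Icc 0 T, ∀ t' ∈ Set.Icc 0 T, ‖deriv γ t' - deriv γ t‖ ≤ K * |t' - t| := by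
    intro t ht t' ht'
    exact (convex_Icc 0 T).norm_image_sub_le_of_norm_hasDerivWithin_le
      (fun s _ => (hdd s).hasDerivWithinAt)
      (fun s hs => (hC s ⟨hs.1, hs.2.trans hTb⟩).trans hCK) ht ht'
  obtain ⟨s₀, hs₀, hmin⟩ := isCompact_Icc.exists_isMinOn ⟨T, Set.left_mem_Icc.2 hTb⟩
    hγ.continuous.norm.continuousOn
  have hs₀b : s₀ ∈ Set.Icc 0 b := ⟨hT.le.trans hs₀.1, hs₀.2⟩
  have hne : γ s₀ ≠ 0 := by
    intro h
    have := hinj hs₀b (Set.left_mem_Icc.2 hb.le) (h.trans h0.symm)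
    linarith [hs₀.1]
  refine ⟨‖γ s₀‖, norm_pos_iff.2 hne, fun η hη hη₀ => ⟨hT, hTb, hK0, hη, hKT, h0, rfl,
    fun t ht => hunit t ⟨ht.1, ht.2.trans hTb⟩, hd, hlip, fun t ht t' ht' => ?_,
    fun t ht => hη₀.trans (hmin ht)⟩⟩
  have hsub : Set.uIcc t t' ⊆ Set.Icc 0 T := Set.uIcc_subset_Icc ht ht'
  have := (convex_uIcc t t').norm_image_sub_le_of_norm_hasDerivWithin_le
    (f := fun s => γ s - s • deriv γ t) (f' := fun s => deriv γ s - (1 : ℝ) • deriv γ t)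
    (C := K * |t' - t|)
    (fun s _ => ((hd s).sub ((hasDerivAt_id s).smul_const (deriv γ t))).hasDerivWithinAt)
    (fun s hs => by
      rw [one_smul]
      refine (hlip t ht s (hsub hs)).trans (mul_le_mul_of_nonneg_left ?_ hK0.le)
      exact Set.abs_sub_left_of_mem_uIcc hs) Set.left_mem_uIcc Set.right_mem_uIcc
  rw [Real.norm_eq_abs, mul_assoc, abs_mul_abs_self, ← pow_two] at this
  rw [sub_smul]
  rwa [sub_sub_sub_comm] at this

theorem arg_conj_axis_mul_polar {μ ρ θ : ℝ} (hρ : 0 < ρ) (hθ : |θ - μ * Real.pi / 2| < Real.pi) :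
    arg (conj (axis μ) * (ρ * exp (θ * I))) = θ - μ * Real.pi / 2 := by
  rw [abs_lt] at hθ
  have : conj (axis μ) * (ρ * exp (θ * I)) = ρ * exp ((θ - μ * Real.pi / 2 : ℝ) * I) := by
    unfold axis
    rw [← exp_conj, map_mul, conj_ofReal, conj_I, mul_left_comm, ← Complex.exp_add]
    congr 2
    push_cast
    ring
  rw [this, exp_mul_I, arg_mul_cos_add_sin_mul_I hρ ⟨hθ.1, hθ.2.le⟩]

theorem exists_of_hasTangentCone {Ω : Set ℂ} {μ : ℝ} (h1 : 1 < μ) (h2 : μ < 2)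
    (h : HasTangentCone Ω μ) : ∃ r₀ κ : ℝ, 0 < r₀ ∧ 0 < κ ∧ κ < 1 ∧
      (∀ z : ℂ, ‖z‖ < r₀ → 0 < inner ℝ (axis μ) z → z ∈ Ω) ∧
      (∀ z ∈ Ω, ‖z‖ < r₀ → -(κ * ‖z‖) < inner ℝ (axis μ) z) ∧
      ∀ z ∈ Ω, ‖z‖ < r₀ → |arg (conj (axis μ) * z)| < μ * Real.pi / 2 + Real.pi / 4 := by
  have hpi := Real.pi_pos
  have hμ1 : Real.pi < μ * Real.pi := by nlinarith
  have hμ2 : μ * Real.pi < 2 * Real.pi := by nlinarith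
  obtain ⟨ε, hε, hεle⟩ : ∃ ε : ℝ, 0 < ε ∧ ε ≤ min (Real.pi / 8)
      (min ((Real.pi - μ * Real.pi / 2) / 2) (μ * Real.pi / 2 - Real.pi / 2)) :=
    ⟨_, lt_min (by positivity) (lt_min (by linarith) (by linarith)), le_rfl⟩
  rw [le_min_iff, le_min_iff] at hεle
  obtain ⟨e1, e2, e3⟩ := hεle
  obtain ⟨r₀, hr₀, hin, hout⟩ := h ε hε
  have harg : ∀ z ∈ Ω, ‖z‖ < r₀ →
      0 < ‖z‖ ∧ |arg (conj (axis μ) * z)| < μ * Real.pi / 2 + ε := by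
    intro z hz hzr
    obtain ⟨ρ, θ, hρ, -, hθ1, hθ2, rfl⟩ := hout ⟨hz, mem_ball_zero_iff.2 hzr⟩
    have hlt : |θ - μ * Real.pi / 2| < μ * Real.pi / 2 + ε :=
      abs_lt.2 ⟨by linarith, by linarith⟩
    rw [arg_conj_axis_mul_polar hρ (by linarith)]
    refine ⟨?_, hlt⟩
    rw [norm_mul, norm_exp_ofReal_mul_I, mul_one, norm_real, Real.norm_eq_abs]
    exact abs_pos.2 hρ.ne'
  have hcos1 : Real.cos (μ * Real.pi / 2 + ε) < 0 :=
    Real.cos_neg_of_pi_div_two_lt_of_lt (by linarith) (by linarith)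
  have hcos2 : -1 < Real.cos (μ * Real.pi / 2 + ε) := by
    rw [← Real.cos_pi]
    exact Real.cos_lt_cos_of_nonneg_of_le_pi (by linarith) le_rfl (by linarith)
  refine ⟨r₀, -Real.cos (μ * Real.pi / 2 + ε), hr₀, by linarith, by linarith, ?_, ?_, ?_⟩
  · intro z hzr hz
    have hz0 : 0 < ‖z‖ := norm_pos_iff.2 fun h => by simp [h] at hz
    rw [inner_axis] at hz
    have hcos := pos_of_mul_pos_right hz hz0.le
    have hlt : |arg (conj (axis μ) * z)| < Real.pi / 2 := by
      by_contra! hc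
      have := Real.cos_nonpos_of_pi_div_two_le_of_le hc
        (by linarith [abs_arg_le_pi (conj (axis μ) * z)])
      rw [Real.cos_abs] at this
      linarith
    rw [abs_lt] at hlt
    exact (hin ⟨‖z‖, _, hz0, hzr, by linarith, by linarith, polar_of_arg μ z⟩).1
  · intro z hz hzr
    obtain ⟨hz0, hlt⟩ := harg z hz hzr
    rw [inner_axis, neg_mul, neg_neg, mul_comm]
    refine mul_lt_mul_of_pos_left ?_ hz0
    rw [← Real.cos_abs (arg _)]
    exact Real.cos_lt_cos_of_nonneg_of_le_pi (abs_nonneg _) (by linarith) hlt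
  · intro z hz hzr
    linarith [(harg z hz hzr).2]


theorem exists_geo_of_cornerAt {Ω : Set ℂ} {μ : ℝ} {γ₁ γ₂ : ℝ → ℂ} {b₁ b₂ : ℝ}
    (h : CornerAt Ω μ γ₁ γ₂ b₁ b₂) (h1 : 1 < μ) (h2 : μ < 2) (hΩ : IsOpen Ω) :
    ∃ K T η r₀ κ : ℝ,
      Geo Ω μ γ₁ (deriv γ₁) γ₂ (deriv γ₂) b₁ b₂ K T η r₀ κ := by
  obtain ⟨K₁, hK₁, H₁⟩ :=
    exists_arc h.smooth₁ h.start₁ h.b₁_pos h.inj₁ h.unitSpeed₁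
  obtain ⟨K₂, hK₂, H₂⟩ :=
    exists_arc h.smooth₂ h.start₂ h.b₂_pos h.inj₂ h.unitSpeed₂
  obtain ⟨r₁, κ, hr₁, hκ, hκ1, ha, hb, hc⟩ :=
    exists_of_hasTangentCone h1 h2 h.tangentCone
  obtain ⟨r₂, hr₂, hfr⟩ := h.boundary
  set K := max K₁ K₂
  have hS := sin_half_pos h1 h2
  have hS' := neg_sin_pos h1 h2
  have hev := (eventually_mul_le K (d := 1 / 4) (by norm_num)).and
    ((eventually_mul_le 1 h.b₁_pos).and
      ((eventually_mul_le 1 h.b₂_pos).and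
        ((eventually_mul_le K (div_pos hS (by norm_num : (0 : ℝ) < 4))).and
          (eventually_mul_le K (div_pos hS' (by norm_num : (0 : ℝ) < 8))))))
  obtain ⟨T, hT, hev⟩ := exists_pos_forall_mem_Icc hev
  obtain ⟨c1, c2, c3, c4, c5⟩ := hev T ⟨hT.le, le_rfl⟩
  rw [one_mul] at c2 c3
  obtain ⟨η₁, hη₁, A₁⟩ := H₁ K (le_max_left _ _) T hT c2 c1
  obtain ⟨η₂, hη₂, A₂⟩ := H₂ K (le_max_right _ _) T hT c3 c1
  have hη : 0 < min η₁ η₂ := lt_min hη₁ hη₂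
  refine ⟨K, T, min η₁ η₂, min r₁ r₂, κ, h1, h2, ?_, ?_, c4, c5, hΩ, ?_, lt_min hr₁ hr₂, hκ, hκ1,
    ?_, fun z hz => ha z (hz.trans_le (min_le_left _ _)),
    fun z hz hzr => hb z hz (hzr.trans_le (min_le_left _ _)),
    fun z hz hzr => hc z hz (hzr.trans_le (min_le_left _ _))⟩
  · rw [← h.tangent₁]
    exact A₁ _ hη (min_le_left _ _)
  · have : edge μ = deriv γ₂ 0 := h.tangent₂.symm
    rw [this]
    exact A₂ _ hη (min_le_right _ _)
  · have : (0 : ℂ) ∈ frontier Ω ∩ Metric.ball 0 r₂ := by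
      rw [hfr]
      exact ⟨Or.inl ⟨0, ⟨le_rfl, h.b₁_pos.le⟩, h.start₁⟩, Metric.mem_ball_self hr₂⟩
    exact this.1
  · intro q hq hqr
    have : q ∈ frontier Ω ∩ Metric.ball 0 r₂ :=
      ⟨hq, mem_ball_zero_iff.2 (hqr.trans_le (min_le_right _ _))⟩
    rw [hfr] at this
    exact this.1

end LiouvilleCorner

/-- Theorem 5.6: boundary expansion near a corner of angle `μπ`,
`μ ∈ (1,2)`: `|u − f_μ| ≤ C d`. -/
theorem liouville_corner_expansion_large_angle (μ : ℝ) (hμ1 : 1 < μ) (hμ2 : μ < 2)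
    (Ω : Set ℂ) (hΩopen : IsOpen Ω) (hΩconn : IsConnected Ω)
    (hΩbdd : Bornology.IsBounded Ω)
    (γ₁ γ₂ : ℝ → ℂ) (b₁ b₂ : ℝ) (hcorner : CornerAt Ω μ γ₁ γ₂ b₁ b₂)
    (u : ℂ → ℝ) (hreg : ContDiffOn ℝ (⊤ : ℕ∞) u Ω)
    (heq : ∀ z ∈ Ω, lap u z = Real.exp (2 * u z))
    (hblow : ∀ p ∈ frontier Ω, Filter.Tendsto u (nhdsWithin p Ω) Filter.atTop) :
    ∃ δ C : ℝ, 0 < δ ∧ 0 < C ∧ ∀ z ∈ Ω ∩ Metric.ball 0 δ,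
      |u z - fMu μ (γ₁ '' Set.Icc 0 b₁) (γ₂ '' Set.Icc 0 b₂) z|
        ≤ C * Metric.infDist z (frontier Ω) := by
  obtain ⟨K, T, η, r₀, κ, G⟩ := LiouvilleCorner.exists_geo_of_cornerAt hcorner hμ1 hμ2 hΩopen
  exact G.exists_bound hΩbdd
    (fun z hz => (hreg.contDiffAt (hΩopen.mem_nhds hz)).of_le
      (WithTop.coe_le_coe.2 (le_top : (2 : ℕ∞) ≤ ⊤))) heq hblow
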